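/- Let k ≥ 6 be even and n ∈ (k/2)ℕ sufficiently large. If H is a k-uniform hypergraph on n vertices with minimum codegree δ_{k−1}(H) > n/2 − k + 1 when n ∈ kℕ and n/2 − n/k is even, and δ_{k−1}(H) > ⌊n/2⌋ − k + 2 otherwise, then H contains a Hamilton (k/2)-cycle. -/

import Mathlib

def HamHalfCycle (n k : ℕ) (E : Finset (Fin n) → Prop) : Prop :=
  ∃ (t : ℕ) (L : ℕ → Finset (Fin n)), t = 2 * n / k ∧ 0 < t ∧
    (∀ i, L (i + t) = L i) ∧
    (∀ i, (L i).card = k / 2) ∧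
    (∀ i < t, ∀ j < t, i ≠ j → Disjoint (L i) (L j)) ∧
    (Finset.range t).biUnion L = Finset.univ ∧
    (∀ i, E (L i ∪ L (i + 1)))

set_option linter.all false

section
open Finset
open scoped Classical
namespace HC

/-! ## Densities -/

noncomputable def pr {α : Type*} [Fintype α] (p : α → Prop) : ℝ :=
  ((Finset.univ.filter p).card : ℝ) / Fintype.card α

section prob
variable {α β : Type*} [Fintype α] [Fintype β]

lemma pr_nonneg (p : α → Prop) : 0 ≤ pr p := by unfold pr; positivity

lemma pr_le_one (p : α → Prop) : pr p ≤ 1 := by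
  unfold pr
  apply div_le_one_of_le₀ _ (by positivity)
  exact_mod_cast Finset.card_le_univ _

lemma pr_mono {p q : α → Prop} (h : ∀ a, p a → q a) : pr p ≤ pr q := by
  unfold pr
  gcongr with a _
  exact h a

lemma pr_congr {p q : α → Prop} (h : ∀ a, p a ↔ q a) : pr p = pr q := by
  have : p = q := by ext a; exact h a
  rw [this]

lemma pr_or_le (p q : α → Prop) : pr (fun a => p a ∨ q a) ≤ pr p + pr q := by
  unfold pr
  rw [← add_div]
  gcongr
  have := Finset.card_union_le (Finset.univ.filter p) (Finset.univ.filter q)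
  rw [← Finset.filter_or] at this
  have h2 : ((Finset.univ.filter (fun a => p a ∨ q a)).card : ℝ) ≤
    (Finset.univ.filter p).card + (Finset.univ.filter q).card := by exact_mod_cast this
  refine le_of_eq_of_le ?_ h2
  congr

lemma pr_true [Nonempty α] : pr (fun _ : α => True) = 1 := by
  unfold pr
  simp

lemma pr_false : pr (fun _ : α => False) = 0 := by
  unfold pr
  simp

lemma pr_not [Nonempty α] (p : α → Prop) : pr (fun a => ¬ p a) = 1 - pr p := by
  unfold pr
  have h := Finset.card_filter_add_card_filter_not (s := (Finset.univ : Finset α)) p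
  have h0 : (Fintype.card α : ℝ) ≠ 0 := by positivity
  field_simp
  rw [eq_sub_iff_add_eq']
  rw [Finset.card_univ] at h
  rw [← h]
  push_cast
  congr

lemma pr_and_ge [Nonempty α] (p q : α → Prop) : pr p + pr q - 1 ≤ pr (fun a => p a ∧ q a) := by
  have h := pr_or_le (fun a => ¬ p a) (fun a => ¬ q a)
  have h2 := pr_not (fun a => p a ∧ q a)
  rw [pr_not, pr_not] at h
  have : pr (fun a => ¬ (p a ∧ q a)) = pr (fun a => ¬ p a ∨ ¬ q a) := pr_congr fun a => by tauto
  linarith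

lemma pr_and_not_ge (p q : α → Prop) : pr p - pr q ≤ pr (fun a => p a ∧ ¬ q a) := by
  have h := pr_or_le (fun a => p a ∧ ¬ q a) q
  have : pr p ≤ pr (fun a => (p a ∧ ¬ q a) ∨ q a) := pr_mono fun a => by tauto
  linarith

lemma exists_of_pr_pos {p : α → Prop} (h : 0 < pr p) : ∃ a, p a := by
  by_contra! hh
  have : pr p = pr (fun _ : α => False) := pr_congr fun a => by simp [hh]
  rw [this, pr_false] at h
  exact lt_irrefl _ h

lemma pr_equiv (e : α ≃ β) (p : β → Prop) : pr (fun a => p (e a)) = pr p := by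
  unfold pr
  rw [Fintype.card_congr e]
  congr 2
  apply Finset.card_bij (fun a _ => e a)
  · simp
  · intro a _ b _ h; exact e.injective h
  · intro b hb; exact ⟨e.symm b, by simpa using hb, by simp⟩

lemma pr_prod (p : α → β → Prop) :
    pr (fun z : α × β => p z.1 z.2) = (∑ a, pr (p a)) / Fintype.card α := by
  unfold pr
  rw [← Finset.sum_div, Fintype.card_prod, div_div, Nat.cast_mul, mul_comm (Fintype.card α : ℝ)]
  congr 1
  rw [Finset.card_filter, Nat.cast_sum, Fintype.sum_prod_type]
  apply Finset.sum_congr rfl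
  intro a _
  rw [Finset.card_filter, Nat.cast_sum]

lemma pr_swap (p : α → β → Prop) :
    pr (fun z : α × β => p z.1 z.2) = pr (fun z : β × α => p z.2 z.1) :=
  pr_equiv (Equiv.prodComm β α) (fun z : α × β => p z.1 z.2) |>.symm

lemma pr_eq_sum (p : α → Prop) :
    pr p = (∑ a, if p a then (1:ℝ) else 0) / Fintype.card α := by
  unfold pr
  rw [Finset.card_filter]; push_cast; rfl

lemma pr_prod_ge {p : α → Prop} {q : α → β → Prop} {b : ℝ}
    (h : ∀ a, p a → b ≤ pr (q a)) :
    pr p * b ≤ pr (fun z : α × β => p z.1 ∧ q z.1 z.2) := by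
  rw [pr_prod (fun a b => p a ∧ q a b), pr_eq_sum p, div_mul_eq_mul_div, Finset.sum_mul]
  gcongr with a
  split_ifs with ha
  · rw [one_mul]
    exact (h a ha).trans (pr_mono fun b hb => ⟨ha, hb⟩)
  · rw [zero_mul]; exact pr_nonneg _

lemma pr_prod_le {q : α → β → Prop} {b : ℝ} (hb : 0 ≤ b)
    (h : ∀ a, pr (q a) ≤ b) : pr (fun z : α × β => q z.1 z.2) ≤ b := by
  rw [pr_prod]
  rcases isEmpty_or_nonempty α with hα | hα
  · simp [hb]
  rw [div_le_iff₀ (by positivity)]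
  calc _ ≤ ∑ a : α, b := Finset.sum_le_sum fun a _ => h a
    _ = _ := by simp [mul_comm]

lemma pr_prod_le' {p : α → Prop} {q : α → β → Prop} {b : ℝ} (hb : 0 ≤ b)
    (h : ∀ a, p a → pr (q a) ≤ b) : pr (fun z : α × β => p z.1 ∧ q z.1 z.2) ≤ pr p * b := by
  rw [pr_prod (fun a b => p a ∧ q a b), pr_eq_sum p, div_mul_eq_mul_div, Finset.sum_mul]
  gcongr with a
  split_ifs with ha
  · rw [one_mul]
    exact (pr_mono fun b hb => hb.2).trans (h a ha)
  · rw [zero_mul]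
    rw [← pr_false (α := β)]
    exact pr_mono fun b hb => (ha hb.1).elim

/-- Markov -/
lemma pr_markov (p : α → β → Prop) (s : ℝ) :
    pr (fun a => s ≤ pr (p a)) * s ≤ pr (fun z : α × β => p z.1 z.2) :=
  (pr_prod_ge (p := fun a => s ≤ pr (p a)) (q := p) (b := s) fun a h => h).trans
    (pr_mono fun z hz => hz.2)

/-- averaging -/
lemma pr_avg (p : α → β → Prop) {s : ℝ} (hs : 0 ≤ s) :
    pr (fun z : α × β => p z.1 z.2) ≤ pr (fun a => s ≤ pr (p a)) + s := by
  have h1 := pr_or_le (fun z : α × β => (s ≤ pr (p z.1)) ∧ p z.1 z.2)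
    (fun z : α × β => (¬ s ≤ pr (p z.1)) ∧ p z.1 z.2)
  have h2 := pr_prod_le' (p := fun a => s ≤ pr (p a)) (q := p) (b := 1) zero_le_one
    fun a _ => pr_le_one _
  have h3 := pr_prod_le' (p := fun a => ¬ s ≤ pr (p a)) (q := p) (b := s) hs
    fun a h => le_of_not_ge h
  have h4 := mul_le_mul_of_nonneg_right (pr_le_one (fun a => ¬ s ≤ pr (p a))) hs
  have h5 : pr (fun z : α × β => p z.1 z.2) ≤ pr (fun z : α × β => ((s ≤ pr (p z.1)) ∧ p z.1 z.2) ∨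
    ((¬ s ≤ pr (p z.1)) ∧ p z.1 z.2)) := pr_mono fun z hz => by tauto
  linarith

lemma pr_fst [Nonempty β] (p : α → Prop) : pr (fun z : α × β => p z.1) = pr p := by
  apply le_antisymm
  · have := pr_prod_le' (p := p) (q := fun _ (_ : β) => True) (b := 1) zero_le_one
      (fun a _ => pr_le_one _)
    rw [mul_one] at this
    exact (pr_mono fun z hz => ⟨hz, trivial⟩).trans this
  · have := pr_prod_ge (p := p) (q := fun _ (_ : β) => True) (b := 1) (fun a _ => (pr_true).ge)
    rw [mul_one] at this
    exact this.trans (pr_mono fun z hz => hz.1)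

lemma pr_snd [Nonempty α] (p : β → Prop) : pr (fun z : α × β => p z.2) = pr p := by
  rw [pr_swap (fun (_ : α) b => p b)]
  exact pr_fst p

lemma pr_le_sum {ι : Type*} (s : Finset ι) (p : ι → α → Prop) :
    pr (fun a => ∃ i ∈ s, p i a) ≤ ∑ i ∈ s, pr (p i) := by
  induction s using Finset.induction_on with
  | empty => simp [pr_false]
  | insert i s hi ih =>
    rw [Finset.sum_insert hi]
    have := pr_or_le (p i) (fun a => ∃ i ∈ s, p i a)
    have h2 : pr (fun a => ∃ j ∈ insert i s, p j a) ≤ pr (fun a => p i a ∨ ∃ i ∈ s, p i a) :=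
      pr_mono fun a => by simp
    linarith

lemma pr_mem_card (s : Finset α) : pr (fun a => a ∈ s) = (s.card : ℝ) / Fintype.card α := by
  unfold pr
  simp

end prob

/-! ## Tuples as multisets -/

section tuples
variable {V : Type} [Fintype V]

def mt {ι : Type} [Fintype ι] (x : ι → V) : Multiset V := Finset.univ.val.map x

def vs {m : ℕ} (l : List (Fin m → V)) : Multiset V := (l.map mt).sum

@[simp] lemma vs_nil {m : ℕ} : vs ([] : List (Fin m → V)) = 0 := rfl
@[simp] lemma vs_cons {m : ℕ} (x : Fin m → V) (l : List (Fin m → V)) :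
    vs (x :: l) = mt x + vs l := by simp [vs]
@[simp] lemma vs_append {m : ℕ} (l l' : List (Fin m → V)) :
    vs (l ++ l') = vs l + vs l' := by simp [vs]

@[simp] lemma card_mt {ι : Type} [Fintype ι] (x : ι → V) : (mt x).card = Fintype.card ι := by
  simp [mt]

lemma card_vs {m : ℕ} (l : List (Fin m → V)) : (vs l).card = m * l.length := by
  induction l with
  | nil => simp
  | cons a l ih => simp [ih]; ring

lemma mt_comp_equiv {ι κ : Type} [Fintype ι] [Fintype κ] (e : ι ≃ κ) (x : κ → V) :
    mt (fun i => x (e i)) = mt x := by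
  unfold mt
  have : (Finset.univ : Finset κ).val = (Finset.univ : Finset ι).val.map e := by
    rw [← Finset.map_univ_equiv e]; rfl
  rw [this, Multiset.map_map]; rfl

lemma mt_sum {ι κ : Type} [Fintype ι] [Fintype κ] (x : ι → V) (y : κ → V) :
    mt (Sum.elim x y) = mt x + mt y := by
  unfold mt
  rw [← Finset.univ_disjSum_univ]
  show Multiset.map _ (Multiset.disjSum _ _) = _
  simp [Multiset.disjSum, Function.comp_def]

lemma mt_append {p q : ℕ} (x : Fin p → V) (y : Fin q → V) :
    mt (Fin.append x y) = mt x + mt y := by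
  rw [← mt_sum, ← mt_comp_equiv (finSumFinEquiv (m := p) (n := q))]
  congr 1
  ext i
  rcases i with i | i <;> simp

lemma mt_snoc {q : ℕ} (x : Fin q → V) (v : V) :
    mt (Fin.snoc x v : Fin (q+1) → V) = mt x + {v} := by
  rw [← Fin.append_right_eq_snoc x (fun _ => v), mt_append]
  simp [mt]

lemma mt_nodup {ι : Type} [Fintype ι] (x : ι → V) : (mt x).Nodup ↔ Function.Injective x := by
  unfold mt
  constructor
  · intro h a b hab
    have := Multiset.inj_on_of_nodup_map h
    exact this a (by simp) b (by simp) hab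
  · intro h
    exact Finset.univ.nodup.map h

lemma mem_mt {ι : Type} [Fintype ι] (x : ι → V) (v : V) : v ∈ mt x ↔ ∃ i, x i = v := by
  simp [mt]

/-- every multiset of card q is mt of a tuple -/
lemma exists_mt {q : ℕ} (s : Multiset V) (h : s.card = q) : ∃ x : Fin q → V, mt x = s := by
  subst h
  obtain ⟨l, rfl⟩ := Quot.exists_rep s
  refine ⟨fun i => l.get (i.cast (by simp)), ?_⟩
  have := mt_comp_equiv (finCongr (show (Multiset.card (Quot.mk (List.isSetoid V) l)) = l.length by simp)) (l.get)
  refine this.trans ?_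
  show Multiset.map l.get _ = (l : Multiset V)
  rw [Fin.univ_val_map]
  simp

noncomputable def cnt (V : Type) [Fintype V] (q : ℕ) (P : Multiset V → Prop) : ℝ :=
  pr (fun f : Fin q → V => P (mt f))

lemma cnt_mono {q : ℕ} {P Q : Multiset V → Prop} (h : ∀ s, s.card = q → P s → Q s) :
    cnt V q P ≤ cnt V q Q := pr_mono fun a => h _ (by simp)

lemma cnt_or_le {q : ℕ} (P Q : Multiset V → Prop) :
    cnt V q (fun s => P s ∨ Q s) ≤ cnt V q P + cnt V q Q := pr_or_le _ _

lemma cnt_base {q : ℕ} (p : (Fin q → V) → Prop) :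
    pr p ≤ cnt V q (fun s => ∃ x, mt x = s ∧ p x) := pr_mono fun a h => ⟨a, rfl, h⟩

lemma cnt_add {q1 q2 : ℕ} {P1 : Multiset V → Prop} {P2 : Multiset V → Multiset V → Prop}
    {P : Multiset V → Prop} {a b : ℝ} (hb : 0 ≤ b) (h1 : a ≤ cnt V q1 P1)
    (h2 : ∀ s1, P1 s1 → b ≤ cnt V q2 (P2 s1))
    (h : ∀ s1 s2, P1 s1 → P2 s1 s2 → P (s1 + s2)) : a * b ≤ cnt V (q1 + q2) P := by
  unfold cnt at *
  rw [← pr_equiv (Fin.appendEquiv q1 q2)]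
  refine le_trans ?_ ((pr_prod_ge (p := fun f : Fin q1 → V => P1 (mt f))
    (q := fun f (g : Fin q2 → V) => P2 (mt f) (mt g)) (b := b) fun f hf => h2 _ hf).trans
    (pr_mono fun z hz => ?_))
  · gcongr
  · have := h _ _ hz.1 hz.2
    rw [← mt_append] at this
    exact this

lemma cnt_hit (q : ℕ) (U : Multiset V) (hU : U.Nodup) :
    cnt V q (fun s => ¬ (s + U).Nodup) ≤ q * (q + U.card) / Fintype.card V := by
  induction q with
  | zero =>
    unfold cnt
    have : pr (fun f : Fin 0 → V => ¬ (mt f + U).Nodup) = pr (fun f : Fin 0 → V => False) :=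
      pr_congr fun f => by simp [mt, hU]
    simp [this, pr_false]
  | succ q ih =>
    rcases isEmpty_or_nonempty V with hV | hV
    · unfold cnt pr
      simp
    unfold cnt at *
    have e1 : pr (fun f : Fin (q+1) → V => ¬ (mt f + U).Nodup) ≤
        pr (fun z : (Fin q → V) × V => (¬ (mt z.1 + U).Nodup) ∨ z.2 ∈ mt z.1 + U) := by
      rw [← pr_equiv ((Equiv.prodComm _ _).trans (Fin.snocEquiv (fun _ => V)))]
      apply pr_mono
      intro z hz
      by_contra! hh
      apply hz
      have : mt ((Fin.snocEquiv (fun _ => V)) (z.2, z.1)) = mt z.1 + {z.2} := mt_snoc _ _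
      show (mt ((Fin.snocEquiv (fun _ => V)) (z.2, z.1)) + U).Nodup
      rw [this, add_right_comm, add_comm, Multiset.singleton_add, Multiset.nodup_cons]
      exact ⟨hh.2, hh.1⟩
    have e2 := pr_or_le (fun z : (Fin q → V) × V => ¬ (mt z.1 + U).Nodup)
      (fun z : (Fin q → V) × V => z.2 ∈ mt z.1 + U)
    rw [pr_fst (fun f : Fin q → V => ¬ (mt f + U).Nodup)] at e2
    have e3 : pr (fun z : (Fin q → V) × V => z.2 ∈ mt z.1 + U) ≤ (q + U.card) / Fintype.card V := by
      apply pr_prod_le (q := fun (f : Fin q → V) v => v ∈ mt f + U) (by positivity)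
      intro f
      have : pr (fun v => v ∈ mt f + U) = pr (fun v => v ∈ (mt f + U).toFinset) :=
        pr_congr fun v => by simp
      rw [this, pr_mem_card]
      gcongr
      have := Multiset.toFinset_card_le (mt f + U)
      rw [Multiset.card_add, card_mt, Fintype.card_fin] at this
      exact_mod_cast this
    refine (e1.trans e2).trans ((add_le_add ih e3).trans ?_)
    rw [← add_div]
    gcongr
    push_cast
    nlinarith

lemma exists_of_cnt {q : ℕ} {P : Multiset V → Prop} {c : ℝ} (U : Multiset V) (hU : U.Nodup)
    (h : c ≤ cnt V q P) (hq : q * (q + U.card) < c * Fintype.card V) :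
    ∃ s, s.card = q ∧ P s ∧ (s + U).Nodup := by
  have hV : (0:ℝ) < Fintype.card V := by
    rcases (Nat.cast_nonneg (α := ℝ) (Fintype.card V)).eq_or_lt' with h0 | h0
    · rw [h0, mul_zero] at hq
      have : (0:ℝ) ≤ q * (q + U.card) := by positivity
      linarith
    · exact h0
  have h1 := cnt_hit q U hU
  have h2 : q * (q + U.card) / Fintype.card V < c := by rwa [div_lt_iff₀ hV]
  unfold cnt at *
  have := pr_and_not_ge (fun f : Fin q → V => P (mt f)) (fun f => ¬ (mt f + U).Nodup)
  obtain ⟨f, hf1, hf2⟩ := exists_of_pr_pos (p := fun f : Fin q → V => P (mt f) ∧ ¬ ¬ (mt f + U).Nodup)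
    (by linarith)
  exact ⟨mt f, by simp, hf1, not_not.1 hf2⟩

end tuples

end HC
end

section
open Finset
open scoped Classical
namespace HC

/-! ## Selection lemma -/

lemma weighted_pick {α I : Type*} [Fintype α] [Fintype I] [Nonempty I] (R : I → α → Prop)
    (w : I → ℝ) (hw : ∀ i, 0 < w i) (c : ℝ) (hR : ∀ i, c < pr (R i)) (hc : 0 ≤ c) :
    ∃ a, c * ∑ i, w i ≤ ∑ i, if R i a then w i else 0 := by
  by_contra! h
  have h1 : ∑ i, w i * c < ∑ i, w i * pr (R i) := by
    apply Finset.sum_lt_sum_of_nonempty Finset.univ_nonempty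
    intro i _
    exact mul_lt_mul_of_pos_left (hR i) (hw i)
  have h2 : ∑ i, w i * pr (R i) = (∑ a : α, ∑ i, if R i a then w i else 0) / Fintype.card α := by
    rw [Finset.sum_comm, Finset.sum_div]
    refine Finset.sum_congr rfl fun i _ => ?_
    rw [pr_eq_sum, ← mul_div_assoc, Finset.mul_sum]
    congr 1
    refine Finset.sum_congr rfl fun a _ => ?_
    split_ifs <;> simp
  have h3 : (∑ a : α, ∑ i, if R i a then w i else 0) / Fintype.card α ≤ c * ∑ i, w i := by
    rcases isEmpty_or_nonempty α with hα | hα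
    · simp
      exact mul_nonneg hc (Finset.sum_nonneg fun i _ => (hw i).le)
    rw [div_le_iff₀ (by positivity)]
    calc _ ≤ ∑ a : α, c * ∑ i, w i := Finset.sum_le_sum fun a _ => (h a).le
      _ = _ := by rw [Finset.sum_const, Finset.card_univ, nsmul_eq_mul, mul_comm]
  rw [← Finset.sum_mul, mul_comm] at h1
  linarith

lemma SL_aux {V : Type} [Fintype V] {I : Type} [Fintype I] [Nonempty I] (q : ℕ)
    (c : ℝ) (hc : 0 < c) (hc1 : c ≤ 1) (R : I → (Fin q → V) → Prop) (hR : ∀ i, c ≤ pr (R i))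
    (U : Multiset V) (hU : U.Nodup) (r : ℕ)
    (hr : (q : ℝ) * (q + (q * r + U.card)) < c / 2 * Fintype.card V) :
    ∃ F : List (Fin q → V), F.length = r ∧ (vs F + U).Nodup ∧
      (∀ s ∈ F, ∃ i, R i s) ∧
      ∑ i, (1/2 : ℝ) ^ (F.countP (fun s => decide (R i s))) ≤ Fintype.card I * (1 - c/4)^r := by
  induction r with
  | zero => exact ⟨[], by simp, by simpa using hU, by simp, by simp⟩
  | succ r ih =>
    obtain ⟨F, hF1, hF2, hF3, hF4⟩ := ih (lt_of_le_of_lt (by push_cast; gcongr; simp) hr)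
    have hcard : (vs F + U).card = q * r + U.card := by
      rw [Multiset.card_add, card_vs, hF1]
    set w : I → ℝ := fun i => (1/2 : ℝ) ^ (F.countP (fun s => decide (R i s))) with hw
    have hVpos : (0:ℝ) < Fintype.card V := by
      by_contra hneg
      have h0 : (Fintype.card V : ℝ) = 0 := le_antisymm (not_lt.1 hneg) (by positivity)
      rw [h0, mul_zero] at hr
      have : (0:ℝ) ≤ (q : ℝ) * (q + (q * ((r+1 : ℕ):ℝ) + U.card)) := by positivity
      linarith
    obtain ⟨f, hf⟩ := weighted_pick (fun i (f : Fin q → V) => R i f ∧ (mt f + (vs F + U)).Nodup)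
      w (fun i => by positivity) (c/2) (fun i => by
        have h1 := pr_and_not_ge (fun f : Fin q → V => R i f) (fun f => ¬ (mt f + (vs F + U)).Nodup)
        have h2 := cnt_hit q (vs F + U) hF2
        have h3 : (q:ℝ) * (q + (vs F + U).card) / Fintype.card V < c / 2 := by
          rw [div_lt_iff₀ hVpos, hcard]
          refine lt_of_le_of_lt ?_ hr
          push_cast
          gcongr
          simp
        have h4 := hR i
        unfold cnt at h2 h4
        simp only [not_not] at h1
        linarith) (by positivity)
    replace hf : c / 2 * ∑ i, w i ≤ ∑ i, if R i f ∧ (mt f + (vs F + U)).Nodup then w i else 0 := by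
      refine hf.trans (le_of_eq (Finset.sum_congr rfl fun i _ => ?_))
      congr
    have hWpos : 0 < ∑ i, w i := Finset.sum_pos (fun i _ => by positivity) Finset.univ_nonempty
    have hnd : (mt f + (vs F + U)).Nodup ∧ ∃ i, R i f := by
      by_contra hcon
      have : (∑ i, if R i f ∧ (mt f + (vs F + U)).Nodup then w i else 0) = 0 := by
        apply Finset.sum_eq_zero
        intro i _
        rw [if_neg]
        intro hh
        exact hcon ⟨hh.2, i, hh.1⟩
      rw [this] at hf
      have : 0 < c/2 * ∑ i, w i := by positivity
      linarith
    refine ⟨f :: F, by simp [hF1], ?_, ?_, ?_⟩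
    · rw [vs_cons, add_assoc]; exact hnd.1
    · intro s hs
      rcases List.mem_cons.1 hs with rfl | hs
      · exact hnd.2
      · exact hF3 s hs
    · have e : ∀ i, (1/2 : ℝ) ^ ((f :: F).countP (fun s => decide (R i s))) =
          w i - 1/2 * if R i f ∧ (mt f + (vs F + U)).Nodup then w i else 0 := by
        intro i
        rw [List.countP_cons]
        by_cases h : R i f
        · simp [h, hnd.1, pow_succ, hw]; ring
        · simp [h, hw]
      rw [Finset.sum_congr rfl fun i _ => e i, Finset.sum_sub_distrib, ← Finset.mul_sum]
      have : ∑ i, w i ≤ Fintype.card I * (1 - c/4)^r := hF4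
      calc _ ≤ (∑ i, w i) * (1 - c/4) := by linarith
        _ ≤ (Fintype.card I * (1 - c/4)^r) * (1 - c/4) := by
          apply mul_le_mul_of_nonneg_right this; linarith
        _ = _ := by ring

lemma log_small (K : ℝ) (ε : ℝ) (hε : 0 < ε) : ∃ n0 : ℕ, ∀ n : ℕ, n0 ≤ n → K * Real.log n ≤ ε * n := by
  have h := (Real.isLittleO_log_id_atTop.comp_tendsto tendsto_natCast_atTop_atTop).def
    (c := ε / (|K| + 1)) (by positivity)
  obtain ⟨n0, hn0⟩ := Filter.eventually_atTop.1 h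
  refine ⟨n0, fun n hn => ?_⟩
  have := hn0 n hn
  simp only [Function.comp, id, Real.norm_eq_abs, Nat.abs_cast] at this
  have hk : (0:ℝ) < |K| + 1 := by positivity
  calc K * Real.log n ≤ |K * Real.log n| := le_abs_self _
    _ = |K| * |Real.log n| := abs_mul _ _
    _ ≤ (|K| + 1) * (ε / (|K| + 1) * n) := by gcongr; linarith
    _ = ε * n := by field_simp

lemma SL (q K : ℕ) (hq : 0 < q) (c γ : ℝ) (hc : 0 < c) (hγ : 0 < γ) :
    ∃ β : ℝ, 0 < β ∧ ∃ n0 : ℕ, ∀ (V : Type) [Fintype V], n0 ≤ Fintype.card V →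
    ∀ (I : Type) [Fintype I] [Nonempty I], Fintype.card I ≤ (Fintype.card V) ^ K →
    ∀ R : I → (Fin q → V) → Prop, (∀ i, c ≤ pr (R i)) →
    ∀ U : Multiset V, U.Nodup → (q : ℝ) * U.card ≤ c / 8 * Fintype.card V →
    ∃ F : List (Fin q → V), (F.length : ℝ) ≤ γ * Fintype.card V ∧ (vs F + U).Nodup ∧
      (∀ s ∈ F, ∃ i, R i s) ∧
      ∀ i, β * Fintype.card V ≤ F.countP (fun s => decide (R i s)) := by
  set g : ℝ := min γ (c / (16 * q^2)) with hg
  have hq' : (0:ℝ) < q := by exact_mod_cast hq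
  have hg0 : 0 < g := by rw [hg]; positivity
  obtain ⟨n1, hn1⟩ := log_small K (c * g / 16) (by positivity)
  refine ⟨c * g / 16, by positivity, n1 + ⌈(16 * q^2 / c : ℝ)⌉₊ + ⌈(8/g : ℝ)⌉₊ + 1, ?_⟩
  intro V _ hV I _ _ hI R hR U hU hUq
  set n := Fintype.card V with hn
  have hV1 : n1 ≤ n := by omega
  have hV2 : (16 * q^2 / c : ℝ) ≤ n := Nat.ceil_le.1 (by omega)
  have hV3 : (8 / g : ℝ) ≤ n := Nat.ceil_le.1 (by omega)
  have hV4 : 0 < n := by omega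
  have hn0 : (0:ℝ) < n := by exact_mod_cast hV4
  have hc1 : c ≤ 1 := (hR (Classical.arbitrary I)).trans (pr_le_one _)
  rw [div_le_iff₀ hc] at hV2
  rw [div_le_iff₀ hg0] at hV3
  set r := ⌊g * n⌋₊ with hr
  have hr1 : (r:ℝ) ≤ g * n := Nat.floor_le (by positivity)
  have hr2 : g * n - 1 ≤ r := (Nat.sub_one_lt_floor _).le
  have hg2 : g * (16 * q^2) ≤ c := by
    have : g ≤ c / (16 * q^2) := min_le_right _ _
    rwa [le_div_iff₀ (by positivity)] at this
  obtain ⟨F, hF1, hF2, hF3, hF4⟩ := SL_aux q c hc hc1 R hR U hU r (by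
    have : (q:ℝ)^2 * r ≤ c / 16 * n := by
      calc (q:ℝ)^2 * r ≤ q^2 * (g * n) := by gcongr
        _ = (g * (16 * q^2)) / 16 * n := by ring
        _ ≤ c / 16 * n := by gcongr
    have h3 : 0 < c * n := by positivity
    nlinarith)
  refine ⟨F, ?_, hF2, hF3, fun i => ?_⟩
  · rw [hF1]
    exact hr1.trans (by gcongr; exact min_le_left _ _)
  · set a := F.countP (fun s => decide (R i s)) with ha
    have h1 : (1/2:ℝ)^a ≤ n^K * (1 - c/4)^r := by
      calc (1/2:ℝ)^a ≤ ∑ i, (1/2 : ℝ) ^ (F.countP (fun s => decide (R i s))) :=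
            Finset.single_le_sum (f := fun i => (1/2 : ℝ) ^ (F.countP (fun s => decide (R i s))))
              (fun i _ => by positivity) (Finset.mem_univ i)
        _ ≤ _ := hF4
        _ ≤ _ := by
          have : (Fintype.card I : ℝ) ≤ n^K := by exact_mod_cast hI
          have : (0:ℝ) ≤ 1 - c/4 := by linarith
          gcongr
    have h2 : (1 - c/4)^r ≤ Real.exp (-(c/4) * r) := by
      rw [mul_comm, Real.exp_nat_mul]
      gcongr
      · linarith
      · have := Real.add_one_le_exp (-(c/4)); linarith
    have h3 : Real.exp (-(a:ℝ)) ≤ (1/2:ℝ)^a := by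
      have : Real.exp (-(a:ℝ)) = (Real.exp (-1))^a := by
        rw [← Real.exp_nat_mul]; ring_nf
      rw [this]
      gcongr
      rw [Real.exp_neg, one_div]
      gcongr
      have := Real.add_one_le_exp (1:ℝ); linarith
    have h4 : Real.exp (-(a:ℝ)) ≤ Real.exp (K * Real.log n + -(c/4) * r) := by
      rw [Real.exp_add, Real.exp_nat_mul, Real.exp_log hn0]
      refine h3.trans (h1.trans ?_)
      gcongr
    have h5 := Real.exp_le_exp.1 h4
    have h6 := hn1 n hV1
    have h7 : c / 4 * (g * n - 1) ≤ c/4 * r := by gcongr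
    have h8 : c * 8 ≤ c * (n * g) := by gcongr
    nlinarith

end HC
end

section
open Finset
open scoped Classical
namespace HC

section paths
variable {V : Type} [Fintype V] {m : ℕ}

def GoodPath (A : (Fin m → V) → (Fin m → V) → Prop) (St En : (Fin m → V) → Prop)
    (Q : List (Fin m → V)) : Prop :=
  List.IsChain A Q ∧ (∃ x, Q.head? = some x ∧ St x) ∧ (∃ y, Q.getLast? = some y ∧ En y)

def Rep (A : (Fin m → V) → (Fin m → V) → Prop) (Q Q' : List (Fin m → V)) : Prop :=
  List.IsChain A Q' ∧ Q'.head? = Q.head? ∧ Q'.getLast? = Q.getLast?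

def ConnP (A : (Fin m → V) → (Fin m → V) → Prop) (y x : Fin m → V) (s : Multiset V) : Prop :=
  ∃ C : List (Fin m → V), List.IsChain A (y :: (C ++ [x])) ∧ vs C = s

def AbsP (A : (Fin m → V) → (Fin m → V) → Prop) (St En : (Fin m → V) → Prop) (T : Multiset V)
    (s : Multiset V) : Prop :=
  ∃ Q Q', GoodPath A St En Q ∧ vs Q = s ∧ Rep A Q Q' ∧ vs Q' = s + T

variable {A : (Fin m → V) → (Fin m → V) → Prop} {St En : (Fin m → V) → Prop}

lemma GoodPath.ne_nil {Q : List (Fin m → V)} (h : GoodPath A St En Q) : Q ≠ [] := by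
  rintro rfl
  simp [GoodPath] at h

lemma Rep.refl {Q : List (Fin m → V)} (h : List.IsChain A Q) : Rep A Q Q := ⟨h, rfl, rfl⟩

lemma glue {Q1 Q2 C : List (Fin m → V)} {y x : Fin m → V} (h1 : List.IsChain A Q1)
    (hy : Q1.getLast? = some y) (h2 : List.IsChain A Q2) (hx : Q2.head? = some x)
    (hC : List.IsChain A (y :: (C ++ [x]))) : List.IsChain A (Q1 ++ (C ++ Q2)) := by
  obtain ⟨Q1', rfl⟩ := List.getLast?_eq_some_iff.1 hy
  obtain ⟨Q2', rfl⟩ := List.head?_eq_some_iff.1 hx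
  rw [List.append_assoc, List.singleton_append, List.isChain_split]
  refine ⟨h1, ?_⟩
  rw [← List.cons_append, List.isChain_split]
  exact ⟨hC, h2⟩

lemma head?_glue {Q1 Q2 : List (Fin m → V)} {x : Fin m → V} (h : Q1.head? = some x) :
    (Q1 ++ Q2).head? = some x := by simp [List.head?_append, h]

lemma getLast?_glue {Q1 Q2 : List (Fin m → V)} {x : Fin m → V} (h : Q2.getLast? = some x) :
    (Q1 ++ Q2).getLast? = some x := by simp [List.getLast?_append, h]

lemma join (cq : ℕ) (B : ℕ) (Gv : V → Prop)
    (hsup : ∀ y x, En y → St x → ∀ X : Multiset V, X.Nodup → X.card ≤ B →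
      ∃ s : Multiset V, s.card = cq ∧ ConnP A y x s ∧ (∀ v ∈ s, Gv v) ∧ (s + X).Nodup)
    (Qs : List (List (Fin m → V))) (hne : Qs ≠ []) (hQ : ∀ Q ∈ Qs, GoodPath A St En Q)
    (hB : cq * Qs.length ≤ B) :
    ∃ (P : List (Fin m → V)) (X : Multiset V), GoodPath A St En P ∧ vs P = (Qs.map vs).sum + X ∧
      X.Nodup ∧ X.card + cq = cq * Qs.length ∧ (∀ v ∈ X, Gv v) ∧
      (∀ Qs', List.Forall₂ (Rep A) Qs Qs' → ∃ P', Rep A P P' ∧ vs P' = (Qs'.map vs).sum + X) := by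
  induction Qs with
  | nil => exact absurd rfl hne
  | cons Q Qs ih =>
    rcases eq_or_ne Qs [] with rfl | hne'
    · refine ⟨Q, 0, hQ Q (by simp), by simp, by simp, by simp, by simp, ?_⟩
      intro Qs' h
      obtain ⟨Q', l, hQ', hl, rfl⟩ := List.forall₂_cons_left_iff.1 h
      rw [List.forall₂_nil_left_iff] at hl
      subst hl
      exact ⟨Q', hQ', by simp⟩
    · obtain ⟨P, X, hP, hPv, hXn, hXc, hXG, hrep⟩ := ih hne' (fun Q' h => hQ Q' (by simp [h]))
        (le_trans (by gcongr; simp) hB)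
      have hQQ := hQ Q (by simp)
      obtain ⟨hQc, ⟨x0, hx0, hSx0⟩, ⟨y, hy, hEy⟩⟩ := hQQ
      obtain ⟨hPc, ⟨x, hx, hSx⟩, ⟨y1, hy1, hEy1⟩⟩ := hP
      obtain ⟨s, hs1, ⟨C, hC, hCs⟩, hs3, hs4⟩ := hsup y x hEy hSx X hXn
        ((le_trans (by omega) hXc.le).trans (le_trans (by gcongr; simp) hB))
      refine ⟨Q ++ (C ++ P), s + X, ⟨glue hQc hy hPc hx hC, ⟨x0, head?_glue hx0, hSx0⟩,
        ⟨y1, getLast?_glue (getLast?_glue hy1), hEy1⟩⟩, ?_, hs4, ?_, ?_, ?_⟩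
      · simp [hPv, hCs]; abel
      · rw [Multiset.card_add, hs1, List.length_cons, mul_add]; omega
      · intro v hv
        rcases Multiset.mem_add.1 hv with h | h
        · exact hs3 v h
        · exact hXG v h
      · intro Qs' h
        obtain ⟨Q', l, hQ', hl, rfl⟩ := List.forall₂_cons_left_iff.1 h
        obtain ⟨P', hP', hP'v⟩ := hrep l hl
        refine ⟨Q' ++ (C ++ P'), ⟨glue hQ'.1 (hQ'.2.2.trans hy) hP'.1 (hP'.2.1.trans hx) hC, ?_, ?_⟩, ?_⟩
        · rw [head?_glue (hQ'.2.1.trans hx0), head?_glue hx0]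
        · rw [getLast?_glue (getLast?_glue (hP'.2.2.trans hy1)), getLast?_glue (getLast?_glue hy1)]
        · simp [hP'v, hCs]; abel

/-- chopping a long tuple -/
def chop (l m : ℕ) (f : Fin (l * m) → V) : List (Fin m → V) :=
  List.ofFn (fun j : Fin l => fun i : Fin m => f (finProdFinEquiv (j, i)))

lemma vs_ofFn {l : ℕ} (g : Fin l → Fin m → V) : vs (List.ofFn g) = mt (fun z : Fin l × Fin m => g z.1 z.2) := by
  unfold vs
  rw [List.map_ofFn, List.sum_ofFn]
  unfold mt
  rw [← Finset.univ_product_univ]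
  ext v
  rw [Multiset.count_sum']
  simp only [Multiset.count_map, Function.comp]
  show _ = (Finset.filter (fun a : Fin l × Fin m => v = g a.1 a.2) (univ ×ˢ univ)).card
  rw [Finset.card_filter, Finset.sum_product]
  refine Finset.sum_congr rfl fun j _ => ?_
  rw [← Finset.card_filter]
  rfl

lemma vs_chop (l : ℕ) (f : Fin (l * m) → V) : vs (chop l m f) = mt f := by
  unfold chop
  rw [vs_ofFn, ← mt_comp_equiv finProdFinEquiv]

lemma exists_chop (l : ℕ) (Q : List (Fin m → V)) (h : Q.length = l) : ∃ f, chop l m f = Q := by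
  subst h
  refine ⟨fun z => Q.get (finProdFinEquiv.symm z).1 (finProdFinEquiv.symm z).2, ?_⟩
  unfold chop
  simp only [Equiv.symm_apply_apply]
  exact List.ofFn_get Q

lemma mt_eq_iff {ι κ : Type} [Fintype ι] [Fintype κ] {f : ι → V} {g : κ → V} (h : mt f = mt g) :
    ∃ σ : ι ≃ κ, f = fun i => g (σ i) := by
  have hc : ∀ v, Nonempty ({a // f a = v} ≃ {b // g b = v}) := by
    intro v
    rw [← Fintype.card_eq, Fintype.card_subtype, Fintype.card_subtype]
    have := congrArg (Multiset.count v) h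
    unfold mt at this
    rw [Multiset.count_map, Multiset.count_map] at this
    have e1 : (Finset.univ.filter (fun a => f a = v)) = Finset.univ.filter (fun a => v = f a) := by
      ext; simp [eq_comm]
    have e2 : (Finset.univ.filter (fun a => g a = v)) = Finset.univ.filter (fun a => v = g a) := by
      ext; simp [eq_comm]
    rw [e1, e2]
    exact this
  have e := hc
  exact ⟨Equiv.ofFiberEquiv (fun v => (e v).some), by ext i; exact (Equiv.ofFiberEquiv_map (fun v => (e v).some) i).symm⟩

lemma cnt_perm {q : ℕ} {P : Multiset V → Prop} {D : (Fin q → V) → Prop} {c : ℝ}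
    (h : c ≤ cnt V q P) (hD : ∀ s : Multiset V, s.card = q → P s → ∃ f, mt f = s ∧ D f) :
    c / (q.factorial : ℝ) ≤ pr D := by
  have h1 : pr (fun f : Fin q → V => P (mt f)) ≤
      pr (fun f : Fin q → V => ∃ σ ∈ (Finset.univ : Finset (Equiv.Perm (Fin q))), D (fun i => f (σ i))) := by
    apply pr_mono
    intro f hf
    obtain ⟨g, hg, hDg⟩ := hD (mt f) (by simp) hf
    obtain ⟨σ, hσ⟩ := mt_eq_iff hg
    exact ⟨σ, Finset.mem_univ _, hσ ▸ hDg⟩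
  have h2 := pr_le_sum (Finset.univ : Finset (Equiv.Perm (Fin q))) (fun σ (f : Fin q → V) => D (fun i => f (σ i)))
  have h3 : ∀ σ : Equiv.Perm (Fin q), pr (fun f : Fin q → V => D (fun i => f (σ i))) = pr D := by
    intro σ
    exact pr_equiv (Equiv.arrowCongr σ.symm (Equiv.refl V)) D
  rw [Finset.sum_congr rfl fun σ _ => h3 σ, Finset.sum_const, Finset.card_univ, Fintype.card_perm,
    Fintype.card_fin, nsmul_eq_mul] at h2
  rw [div_le_iff₀ (by positivity), mul_comm]
  exact h.trans (h1.trans h2)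

/-- assignment of tasks -/
lemma assign {q l : ℕ} {I : Type} (T : I → Multiset V) (ch : (Fin q → V) → List (Fin m → V))
    (D : I → (Fin q → V) → Prop)
    (hD : ∀ i f, D i f → ∃ Q', Rep A (ch f) Q' ∧ vs Q' = vs (ch f) + T i)
    (L : List I) (F : List (Fin q → V)) (hF : ∀ f ∈ F, List.IsChain A (ch f))
    (hL : ∀ i ∈ L, L.length ≤ F.countP (fun s => decide (D i s))) :
    ∃ Qs', List.Forall₂ (Rep A) (F.map ch) Qs' ∧ (Qs'.map vs).sum = ((F.map ch).map vs).sum + (L.map T).sum := by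
  induction L generalizing F with
  | nil =>
    refine ⟨F.map ch, ?_, by simp⟩
    rw [List.forall₂_same]
    intro Q hQ
    obtain ⟨f, hf, rfl⟩ := List.mem_map.1 hQ
    exact Rep.refl (hF f hf)
  | cons i L ih =>
    have h1 : 0 < F.countP (fun s => decide (D i s)) := lt_of_lt_of_le (by simp) (hL i (by simp))
    rw [List.countP_pos_iff] at h1
    obtain ⟨f, hfF, hf⟩ := h1
    have hf := of_decide_eq_true hf
    obtain ⟨F1, F2, rfl⟩ := List.append_of_mem hfF
    obtain ⟨Qs', hQs', hsum⟩ := ih (F1 ++ F2) (fun g hg => hF g (by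
        rcases List.mem_append.1 hg with h | h <;> simp [h])) (fun j hj => by
      have := hL j (by simp [hj])
      rw [List.countP_append, List.countP_cons, List.length_cons] at this
      rw [List.countP_append]
      split_ifs at this <;> omega)
    obtain ⟨Q', hQ', hQv⟩ := hD i f hf
    rw [List.map_append] at hQs'
    have a1 := (List.forall₂_take_append _ _ _ hQs'.flip).flip
    have a2 := (List.forall₂_drop_append _ _ _ hQs'.flip).flip
    refine ⟨Qs'.take (F1.map ch).length ++ (Q' :: Qs'.drop (F1.map ch).length), ?_, ?_⟩
    · rw [List.map_append, List.map_cons]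
      exact List.rel_append a1 (List.Forall₂.cons hQ' a2)
    · have e : (Qs'.map vs).sum = ((Qs'.take (F1.map ch).length).map vs).sum +
          ((Qs'.drop (F1.map ch).length).map vs).sum := by
        rw [← List.sum_append, ← List.map_append, List.take_append_drop]
      rw [List.map_append, List.sum_append, List.map_cons, List.sum_cons, hQv]
      rw [e] at hsum
      simp only [List.map_append, List.sum_append, List.map_cons, List.sum_cons] at hsum ⊢
      rw [add_left_comm, hsum]
      abel

end paths

lemma AL' (m l cq K : ℕ) (hm : 0 < m) (hl : 0 < l) (c γ : ℝ) (hc : 0 < c) (hγ : 0 < γ) :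
    ∃ β : ℝ, 0 < β ∧ ∃ n0 : ℕ, ∀ (V : Type) [Fintype V], n0 ≤ Fintype.card V →
    ∀ (A : (Fin m → V) → (Fin m → V) → Prop) (St En : (Fin m → V) → Prop),
    (∀ y x, En y → St x → c ≤ cnt V cq (ConnP A y x)) →
    ∀ (I : Type) [Fintype I] [Nonempty I], Fintype.card I ≤ (Fintype.card V) ^ K →
    ∀ T : I → Multiset V, (∀ i, c ≤ cnt V (l * m) (AbsP A St En (T i))) →
    ∀ U : Multiset V, U.Nodup → (U.card : ℝ) ≤ β * Fintype.card V →
    ∃ P, GoodPath A St En P ∧ (vs P + U).Nodup ∧ ((vs P).card : ℝ) ≤ γ * Fintype.card V ∧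
      (∃ N : ℕ, (vs P).card + cq = N * (l * m + cq)) ∧
      ∀ L : List I, (L.length : ℝ) ≤ β * Fintype.card V →
        ∃ P', Rep A P P' ∧ vs P' = vs P + (L.map T).sum := by
  set q := l * m with hq
  have hq0 : 0 < q := by positivity
  set c' : ℝ := c / q.factorial with hc'
  have hc'0 : 0 < c' := by positivity
  set a : ℝ := q + cq with ha
  have ha0 : 0 < a := by positivity
  set g : ℝ := min (γ / a) (c / (8 * (cq + 1) * a)) with hg
  have hg0 : 0 < g := by positivity
  obtain ⟨β1, hβ1, n1, hSL⟩ := SL q K hq0 c' g hc'0 hg0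
  set β : ℝ := min β1 (min (c' / (8 * q)) (c / (8 * (cq + 1)))) with hβ
  have hβ0 : 0 < β := by positivity
  refine ⟨β, hβ0, n1 + ⌈(8 * (cq + 1)^2 / c : ℝ)⌉₊ + 1, ?_⟩
  intro V _ hV A St En hconn I _ _ hI T hT U hU hUc
  set n := Fintype.card V with hn
  have hn1 : (8 * (cq + 1)^2 / c : ℝ) ≤ n := Nat.ceil_le.1 (by omega)
  rw [div_le_iff₀ hc] at hn1
  have hnpos : (0:ℝ) < n := by
    have : 0 < n := by omega
    exact_mod_cast this
  set D : I → (Fin q → V) → Prop := fun i f =>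
    GoodPath A St En (chop l m f) ∧ ∃ Q', Rep A (chop l m f) Q' ∧ vs Q' = vs (chop l m f) + T i with hD
  have hDpr : ∀ i, c' ≤ pr (D i) := by
    intro i
    apply cnt_perm (hT i)
    rintro s hs ⟨Q, Q', hQ, hQs, hrep, hQ'⟩
    have hlen : Q.length = l := by
      have := card_vs Q
      rw [hQs, hs, hq, mul_comm] at this
      exact (Nat.eq_of_mul_eq_mul_left hm this).symm
    obtain ⟨f, hf⟩ := exists_chop l Q hlen
    refine ⟨f, ?_, ?_⟩
    · rw [← hQs, ← hf, vs_chop]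
    · refine ⟨hf ▸ hQ, Q', hf ▸ hrep, ?_⟩
      rw [hf, hQs, hQ']
  obtain ⟨F, hF1, hF2, hF3, hF4⟩ := hSL V (by omega) I hI D hDpr U hU (by
    have : β ≤ c' / (8 * q) := (min_le_right _ _).trans (min_le_left _ _)
    calc (q:ℝ) * U.card ≤ q * (β * n) := by gcongr
      _ ≤ q * (c' / (8 * q) * n) := by gcongr
      _ = c' / 8 * n := by field_simp)
  have hFne : F ≠ [] := by
    rintro rfl
    have := hF4 (Classical.arbitrary I)
    simp at this
    have h2 : 0 < β1 * n := by positivity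
    linarith
  have hgood : ∀ f ∈ F, GoodPath A St En (chop l m f) := by
    intro f hf
    obtain ⟨i, hi⟩ := hF3 f hf
    exact hi.1
  have hsumF : ((F.map (chop l m)).map vs).sum = vs F := by
    rw [List.map_map]
    unfold vs
    congr 1
    apply List.map_congr_left
    intro f _
    exact vs_chop l f
  have hFc : (vs F).card = q * F.length := card_vs F
  obtain ⟨P, X, hP, hPv, hXn, hXc0, hXG, hrep⟩ := join (A := A) (St := St) (En := En) cq (cq * F.length)
    (fun v => v ∉ vs F + U) (fun y x hy hx X hX hXc => by
      set U' : Multiset V := X.filter (fun v => v ∉ vs F + U) + (vs F + U) with hU'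
      have hU'n : U'.Nodup := by
        rw [hU', Multiset.nodup_add]
        refine ⟨hX.filter _, hF2, ?_⟩
        rw [Multiset.disjoint_left]
        intro v hv
        exact (Multiset.mem_filter.1 hv).2
      have hU'c : (U'.card : ℝ) ≤ a * F.length + U.card := by
        have h1 : U'.card ≤ X.card + (q * F.length + U.card) := by
          rw [hU', Multiset.card_add, Multiset.card_add, hFc]
          gcongr
          exact Multiset.filter_le _ _
        have h2 : (U'.card : ℝ) ≤ (cq * F.length : ℕ) + (q * F.length + U.card) := by
          exact_mod_cast h1.trans (by omega)
        rw [ha]; push_cast at h2; linarith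
      obtain ⟨s, hs1, hs2, hs3⟩ := exists_of_cnt U' hU'n (hconn y x hy hx) (by
        have h1 : a * F.length ≤ a * (g * n) := by gcongr
        have h2 : a * (g * n) ≤ a * (c / (8 * (cq + 1) * a) * n) := by
          gcongr; exact min_le_right _ _
        have h3 : a * (c / (8 * (cq + 1) * a) * n) = c / (8 * (cq+1)) * n := by field_simp
        have h4 : (U.card : ℝ) ≤ c / (8 * (cq + 1)) * n := hUc.trans (by
          gcongr; exact (min_le_right _ _).trans (min_le_right _ _))
        have h5 : (cq + 1 : ℝ) * (c / (8 * (cq+1)) * n) = c * n / 8 := by field_simp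
        have h6 : (U'.card : ℝ) ≤ 2 * (c / (8 * (cq+1)) * n) := by linarith
        have h7 : 0 < c * n := by positivity
        calc (cq : ℝ) * (cq + U'.card) ≤ (cq + 1) * ((cq + 1) + 2 * (c / (8 * (cq+1)) * n)) := by
              gcongr <;> linarith
          _ = (cq+1)^2 + 2 * ((cq + 1 : ℝ) * (c / (8 * (cq+1)) * n)) := by ring
          _ < c * n := by rw [h5]; linarith)
      have hd := (Multiset.nodup_add.1 hs3).2.2
      have hsF : ∀ v ∈ s, v ∉ vs F + U := fun v hv hv2 =>
        Multiset.disjoint_left.1 hd hv (by rw [hU']; exact Multiset.mem_add.2 (Or.inr hv2))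
      refine ⟨s, hs1, hs2, hsF, ?_⟩
      rw [Multiset.nodup_add]
      refine ⟨(Multiset.nodup_add.1 hs3).1, hX, ?_⟩
      rw [Multiset.disjoint_left]
      intro v hv hvX
      exact Multiset.disjoint_left.1 hd hv (by
        rw [hU']; exact Multiset.mem_add.2 (Or.inl (Multiset.mem_filter.2 ⟨hvX, hsF v hv⟩))))
    (F.map (chop l m)) (by simpa using hFne)
    (fun Q hQ => by obtain ⟨f, hf, rfl⟩ := List.mem_map.1 hQ; exact hgood f hf) (by simp)
  rw [hsumF] at hPv
  refine ⟨P, hP, ?_, ?_, ⟨F.length, ?_⟩, ?_⟩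
  · rw [hPv, add_comm (vs F), add_assoc, Multiset.nodup_add]
    refine ⟨hXn, hF2, ?_⟩
    rw [Multiset.disjoint_left]
    exact fun {v} => hXG v
  · rw [hPv, Multiset.card_add, hFc]
    rw [List.length_map] at hXc0
    have hXc : X.card ≤ cq * F.length := le_trans (by omega) hXc0.le
    have h1 : ((q * F.length + X.card : ℕ) : ℝ) ≤ a * F.length := by
      have : (X.card : ℝ) ≤ cq * F.length := by exact_mod_cast hXc
      push_cast
      rw [ha]; linarith
    calc ((q * F.length + X.card : ℕ) : ℝ) ≤ a * F.length := h1
      _ ≤ a * (g * n) := by gcongr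
      _ ≤ a * (γ / a * n) := by gcongr; exact min_le_left _ _
      _ = γ * n := by field_simp
  · rw [List.length_map] at hXc0
    rw [hPv, Multiset.card_add, hFc, add_assoc, hXc0]
    ring
  · intro L hL
    obtain ⟨Qs', h1, h2⟩ := assign (A := A) (l := l) T (chop l m) D (fun i f h => h.2) L F
      (fun f hf => (hgood f hf).1) (fun i _ => by
        have h3 := hF4 i
        have h4 : β * n ≤ β1 * n := by gcongr; exact min_le_left _ _
        exact_mod_cast (hL.trans (h4.trans h3)))
    obtain ⟨P', hP', hP'v⟩ := hrep Qs' h1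
    refine ⟨P', hP', ?_⟩
    rw [hP'v, h2, hsumF, hPv]
    abel

lemma AL (m l cq K : ℕ) (hm : 0 < m) (hl : 0 < l) (c γ : ℝ) (hc : 0 < c) (hγ : 0 < γ) :
    ∃ β : ℝ, 0 < β ∧ ∃ n0 : ℕ, ∀ (V : Type) [Fintype V], n0 ≤ Fintype.card V →
    ∀ (A : (Fin m → V) → (Fin m → V) → Prop) (St En : (Fin m → V) → Prop),
    (∀ y x, En y → St x → c ≤ cnt V cq (ConnP A y x)) →
    ∀ (I : Type) [Fintype I] [Nonempty I], Fintype.card I ≤ (Fintype.card V) ^ K →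
    ∀ T : I → Multiset V, (∀ i, c ≤ cnt V (l * m) (AbsP A St En (T i))) →
    ∀ U : Multiset V, U.Nodup → (U.card : ℝ) ≤ β * Fintype.card V →
    ∃ P, GoodPath A St En P ∧ (vs P + U).Nodup ∧ ((vs P).card : ℝ) ≤ γ * Fintype.card V ∧
      ∀ L : List I, (L.length : ℝ) ≤ β * Fintype.card V →
        ∃ P', Rep A P P' ∧ vs P' = vs P + (L.map T).sum := by
  obtain ⟨β, hβ, n0, h⟩ := AL' m l cq K hm hl c γ hc hγ
  refine ⟨β, hβ, n0, fun V _ hV A St En hconn I _ _ hI T hT U hU hUc => ?_⟩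
  obtain ⟨P, h1, h2, h3, -, h4⟩ := h V hV A St En hconn I hI T hT U hU hUc
  exact ⟨P, h1, h2, h3, h4⟩

end HC
end

section
open Finset
open scoped Classical
namespace HC

section mindeg
variable {L R : Type*} [Fintype L] [Fintype R]

lemma pr_restrict (s : Finset L) (E : L → R → Prop) :
    pr (fun z : L × R => z.1 ∈ s ∧ E z.1 z.2) = (∑ a ∈ s, pr (E a)) / Fintype.card L := by
  rw [pr_prod (fun a b => a ∈ s ∧ E a b)]
  congr 1
  rw [← Finset.sum_subset (Finset.subset_univ s)]
  · refine Finset.sum_congr rfl fun a ha => pr_congr fun b => by simp [ha]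
  · intro a _ ha
    rw [← pr_false (α := R)]
    exact pr_congr fun b => by simp [ha]

lemma pr_erase (s : Finset L) (E : L → R → Prop) (x : L) (hx : x ∈ s) :
    pr (fun z : L × R => z.1 ∈ s.erase x ∧ E z.1 z.2) =
      pr (fun z : L × R => z.1 ∈ s ∧ E z.1 z.2) - pr (E x) / Fintype.card L := by
  rw [pr_restrict, pr_restrict, ← Finset.add_sum_erase s _ hx]
  ring

lemma mindeg [Nonempty L] [Nonempty R] (E : L → R → Prop) (d : ℝ) (hd : 0 < d)
    (h : d ≤ pr (fun z : L × R => E z.1 z.2)) :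
    ∃ (p : L → Prop) (r : R → Prop), (∃ x, p x) ∧ (∀ x, p x → d/3 ≤ pr (fun y => r y ∧ E x y)) ∧
      (∀ y, r y → d/3 ≤ pr (fun x => p x ∧ E x y)) := by
  let Φ : Finset L × Finset R → ℝ := fun st =>
    pr (fun z : L × R => z.1 ∈ st.1 ∧ (z.2 ∈ st.2 ∧ E z.1 z.2)) - d/3 * pr (fun x => x ∈ st.1)
      - d/3 * pr (fun y => y ∈ st.2)
  obtain ⟨⟨s, t⟩, hst⟩ := Finite.exists_max Φ
  have hL : (0:ℝ) < Fintype.card L := by positivity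
  have hR : (0:ℝ) < Fintype.card R := by positivity
  have hswap : ∀ (s : Finset L) (t : Finset R), pr (fun z : L × R => z.1 ∈ s ∧ (z.2 ∈ t ∧ E z.1 z.2)) =
      pr (fun z : R × L => z.1 ∈ t ∧ (z.2 ∈ s ∧ E z.2 z.1)) := by
    intro s t
    rw [pr_swap (fun a b => a ∈ s ∧ (b ∈ t ∧ E a b))]
    exact pr_congr fun z => by tauto
  refine ⟨(· ∈ s), (· ∈ t), ?_, ?_, ?_⟩
  · by_contra! hne
    have h0 := hst (Finset.univ, Finset.univ)
    have h1 : Φ (s, t) ≤ 0 := by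
      have : s = ∅ := Finset.eq_empty_of_forall_notMem hne
      subst this
      have e : pr (fun z : L × R => z.1 ∈ (∅ : Finset L) ∧ (z.2 ∈ t ∧ E z.1 z.2)) = 0 := by
        rw [← pr_false (α := L × R)]
        exact pr_congr fun z => by simp
      show pr (fun z : L × R => z.1 ∈ (∅ : Finset L) ∧ (z.2 ∈ t ∧ E z.1 z.2)) - _ - _ ≤ 0
      rw [e]
      have a1 := pr_nonneg (fun x => x ∈ (∅ : Finset L))
      have a2 := pr_nonneg (fun x => x ∈ t)
      have := mul_nonneg (show 0 ≤ d/3 by positivity) a1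
      have := mul_nonneg (show 0 ≤ d/3 by positivity) a2
      linarith
    have h2 : Φ (Finset.univ, Finset.univ) = pr (fun z : L × R => E z.1 z.2) - d/3 - d/3 := by
      show pr (fun z : L × R => z.1 ∈ Finset.univ ∧ (z.2 ∈ Finset.univ ∧ E z.1 z.2)) -
        d/3 * pr (fun x : L => x ∈ Finset.univ) - d/3 * pr (fun x : R => x ∈ Finset.univ) = _
      simp [pr_true]
    linarith
  · intro x hx
    have h0 := hst (s.erase x, t)
    have h1 := pr_erase s (fun a b => b ∈ t ∧ E a b) x hx
    have h2 : pr (fun y => y ∈ s.erase x) = pr (fun y => y ∈ s) - 1 / Fintype.card L := by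
      rw [pr_mem_card, pr_mem_card, ← Finset.card_erase_add_one hx]; push_cast; ring
    simp only [Φ] at h0
    rw [h1, h2] at h0
    have h3 : d / 3 * (1 / Fintype.card L) ≤ pr (fun y => y ∈ t ∧ E x y) / Fintype.card L := by linarith
    rw [← mul_div_assoc, mul_one] at h3
    exact (div_le_div_iff_of_pos_right hL).1 h3
  · intro x hx
    have h0 := hst (s, t.erase x)
    have h1 := pr_erase t (fun a b => b ∈ s ∧ E b a) x hx
    have h2 : pr (fun y => y ∈ t.erase x) = pr (fun y => y ∈ t) - 1 / Fintype.card R := by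
      rw [pr_mem_card, pr_mem_card, ← Finset.card_erase_add_one hx]; push_cast; ring
    simp only [Φ] at h0
    rw [hswap, hswap, h1, h2] at h0
    have h3 : d / 3 * (1 / Fintype.card R) ≤ pr (fun y => y ∈ s ∧ E y x) / Fintype.card R := by linarith
    rw [← mul_div_assoc, mul_one] at h3
    exact (div_le_div_iff_of_pos_right hR).1 h3

end mindeg

/-- extraction lemma -/
lemma EL (m' b : ℕ) (d : ℝ) (hd : 0 < d) : ∃ n0 : ℕ, ∀ (V : Type) [Fintype V], n0 ≤ Fintype.card V →
    ∀ (G : Type) [Fintype G] (u : G → V), Function.Injective u →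
    12 * ((2 * b + 1) * (m' + 1)) ≤ d * Fintype.card G →
    ∀ (A : (Fin (m'+1) → V) → (Fin (m'+1) → V) → Prop)
    (EE : (Fin (m'+1) → V) → (Fin m' → V) → G → Prop),
    (∀ x R g, EE x R g → A x (Fin.snoc R (u g)) ∧ A (Fin.snoc R (u g)) x ∧ (mt x).Nodup) →
    d ≤ pr (fun z : ((Fin (m'+1) → V) × (Fin m' → V)) × G => EE z.1.1 z.1.2 z.2) →
    ∃ (Q : List (Fin (m'+1) → V)) (S T : Multiset V), List.IsChain A Q ∧ Q.length = 2 * b + 1 ∧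
      vs Q = S + T ∧ (vs Q).Nodup ∧ T.card = b ∧
      (∀ v ∈ S, ∃ x R g, EE x R g ∧ (v ∈ mt x ∨ v ∈ mt R)) ∧
      (∀ v ∈ T, ∃ x R g, EE x R g ∧ v = u g) := by
  set M : ℕ := (2 * b + 1) * (m' + 1) with hM
  refine ⟨⌈(12 * ((m'+1) * (m' + 2 + M)) / d : ℝ)⌉₊ + 1, ?_⟩
  intro V _ hV G _ u hu hG A EE hEE hpr
  set n := Fintype.card V with hn
  have hn1 : (12 * ((m'+1) * (m' + 2 + M)) / d : ℝ) ≤ n := Nat.ceil_le.1 (by omega)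
  have hn0 : (0:ℝ) < n := by
    have : 0 < n := by omega
    exact_mod_cast this
  rw [div_le_iff₀ hd] at hn1
  have hM0 : (0:ℝ) < M := by rw [hM]; positivity
  have hG' : 12 * (M : ℝ) ≤ d * Fintype.card G := by rw [hM]; push_cast; linarith
  have hG0 : (0:ℝ) < Fintype.card G := by
    by_contra hneg
    have h0 : (Fintype.card G : ℝ) = 0 := le_antisymm (not_lt.1 hneg) (by positivity)
    rw [h0] at hG'
    linarith
  haveI : Nonempty G := by
    rw [← Fintype.card_pos_iff]; exact_mod_cast hG0
  haveI : Nonempty V := by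
    rw [← Fintype.card_pos_iff]; exact_mod_cast hn0
  let e : (Fin (m'+1) → V) × (G × (Fin m' → V)) ≃ ((Fin (m'+1) → V) × (Fin m' → V)) × G :=
    ((Equiv.refl _).prodCongr (Equiv.prodComm _ _)).trans (Equiv.prodAssoc _ _ _).symm
  rw [← pr_equiv e] at hpr
  obtain ⟨p, r, ⟨x0, hx0⟩, hp, hr⟩ := mindeg (fun (x : Fin (m'+1) → V) (y : G × (Fin m' → V)) => EE x y.2 y.1) d hd hpr
  have key : ∀ j : ℕ, j ≤ b → ∃ (Q : List (Fin (m'+1) → V)) (S T : Multiset V) (x : Fin (m'+1) → V),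
      Q.head? = some x ∧ p x ∧ List.IsChain A Q ∧ Q.length = 2 * j + 1 ∧
      vs Q = S + T ∧ (vs Q).Nodup ∧ T.card = j ∧
      (∀ v ∈ S, ∃ x R g, EE x R g ∧ (v ∈ mt x ∨ v ∈ mt R)) ∧
      (∀ v ∈ T, ∃ x R g, EE x R g ∧ v = u g) := by
    intro j
    induction j with
    | zero =>
      intro _
      obtain ⟨y, hy⟩ := exists_of_pr_pos (lt_of_lt_of_le (by positivity) (hp x0 hx0))
      refine ⟨[x0], mt x0, 0, x0, rfl, hx0, by simp, by simp, by simp, by simpa using (hEE _ _ _ hy.2).2.2,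
        by simp, ?_, by simp⟩
      intro v hv
      exact ⟨x0, y.2, y.1, hy.2, Or.inl hv⟩
    | succ j ih =>
      intro hj
      obtain ⟨Q, S, T, x, hQx, hpx, hQc, hQl, hQv, hQn, hTc, hS, hT⟩ := ih (by omega)
      have hQM : (vs Q).card + (m' + 1) ≤ M := by
        rw [card_vs, hQl, hM]
        nlinarith
      have hQM' : ((vs Q).card : ℝ) + (m' + 1) ≤ M := by exact_mod_cast hQM
      -- choose y
      have hbad1 : pr (fun y : G × (Fin m' → V) => u y.1 ∈ vs Q) ≤ d / 12 := by
        rw [pr_fst (fun g : G => u g ∈ vs Q)]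
        have : pr (fun g : G => u g ∈ vs Q) ≤ ((vs Q).card : ℝ) / Fintype.card G := by
          unfold pr
          gcongr
          calc _ = ((Finset.univ.filter (fun g : G => u g ∈ vs Q)).image u).card := by
                rw [Finset.card_image_of_injective _ hu]; congr
            _ ≤ (vs Q).toFinset.card := by
                apply Finset.card_le_card
                intro v hv
                simp only [Finset.mem_image, Finset.mem_filter, Finset.mem_univ, true_and] at hv
                obtain ⟨g, hg, rfl⟩ := hv
                simpa using hg
            _ ≤ _ := Multiset.toFinset_card_le _
        refine this.trans ?_
        rw [div_le_iff₀ hG0]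
        linarith
      have hbad2 : pr (fun y : G × (Fin m' → V) => u y.1 ∉ vs Q ∧ ¬ (mt y.2 + (vs Q + {u y.1})).Nodup) ≤ d / 12 := by
        apply pr_prod_le (q := fun (g : G) (R : Fin m' → V) => u g ∉ vs Q ∧ ¬ (mt R + (vs Q + {u g})).Nodup) (by positivity)
        intro g
        by_cases hg : u g ∈ vs Q
        · rw [show pr (fun R : Fin m' → V => u g ∉ vs Q ∧ ¬ (mt R + (vs Q + {u g})).Nodup) = pr (fun _ => False) from
            pr_congr fun R => by simp [hg]]
          rw [pr_false]; positivity
        · have hnd : (vs Q + {u g}).Nodup := by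
            rw [add_comm, Multiset.singleton_add, Multiset.nodup_cons]; exact ⟨hg, hQn⟩
          have := cnt_hit m' (vs Q + {u g}) hnd
          unfold cnt at this
          refine (pr_mono fun R hR => hR.2).trans (this.trans ?_)
          rw [div_le_iff₀ hn0, Multiset.card_add, Multiset.card_singleton]
          have : (m':ℝ) * (m' + (((vs Q).card + 1 : ℕ) : ℝ)) ≤ (m' + 1) * (m' + 2 + M) := by
            push_cast
            gcongr <;> linarith
          linarith
      have hgood := pr_and_not_ge (fun y : G × (Fin m' → V) => r y ∧ EE x y.2 y.1)
        (fun y : G × (Fin m' → V) => u y.1 ∈ vs Q ∨ (u y.1 ∉ vs Q ∧ ¬ (mt y.2 + (vs Q + {u y.1})).Nodup))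
      have hor := pr_or_le (fun y : G × (Fin m' → V) => u y.1 ∈ vs Q) (fun y => u y.1 ∉ vs Q ∧ ¬ (mt y.2 + (vs Q + {u y.1})).Nodup)
      have hpx' := hp x hpx
      obtain ⟨⟨g, R⟩, ⟨hry, hE1⟩, hav⟩ := exists_of_pr_pos (lt_of_lt_of_le (by linarith) hgood)
      push Not at hav
      have hnd1 := hav.2 hav.1
      -- choose x'
      set y : Fin (m'+1) → V := Fin.snoc R (u g) with hy
      have hmy : mt y = mt R + {u g} := mt_snoc _ _
      have hnd1' : (vs (y :: Q)).Nodup := by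
        rw [vs_cons, hmy]
        convert hnd1 using 1
        simp only []
        abel
      have hbad3 := cnt_hit (m'+1) (vs (y :: Q)) hnd1'
      unfold cnt at hbad3
      have hgood2 := pr_and_not_ge (fun x' : Fin (m'+1) → V => p x' ∧ EE x' R g) (fun x' => ¬ (mt x' + vs (y :: Q)).Nodup)
      have hle : ((m'+1 : ℕ):ℝ) * (((m'+1 : ℕ):ℝ) + (vs (y :: Q)).card) / n ≤ d / 12 := by
        rw [div_le_iff₀ hn0]
        have : (vs (y :: Q)).card ≤ M := by
          rw [vs_cons, Multiset.card_add, card_mt, Fintype.card_fin]; omega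
        have h2 : ((vs (y :: Q)).card : ℝ) ≤ M := by exact_mod_cast this
        have : ((m'+1 : ℕ):ℝ) * (((m'+1 : ℕ):ℝ) + (vs (y :: Q)).card) ≤ (m' + 1) * (m' + 2 + M) := by
            push_cast
            gcongr
            linarith
        linarith
      have hry' := hr (g, R) hry
      simp only at hry'
      obtain ⟨x', ⟨hpx1, hE2⟩, hnd2⟩ := exists_of_pr_pos (lt_of_lt_of_le (by linarith) hgood2)
      rw [not_not] at hnd2
      refine ⟨x' :: y :: Q, mt x' + (mt R + S), {u g} + T, x', rfl, hpx1, ?_, ?_, ?_, ?_, ?_, ?_, ?_⟩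
      · rw [List.isChain_cons_cons]
        refine ⟨(hEE _ _ _ hE2).1, ?_⟩
        obtain ⟨Q', rfl⟩ := List.head?_eq_some_iff.1 hQx
        rw [List.isChain_cons_cons]
        exact ⟨(hEE _ _ _ hE1).2.1, hQc⟩
      · simp [hQl]; ring
      · rw [vs_cons, vs_cons, hmy, hQv]; abel
      · rw [vs_cons]; exact hnd2
      · simp [hTc]
      · intro v hv
        rcases Multiset.mem_add.1 hv with h | h
        · exact ⟨x', R, g, hE2, Or.inl h⟩
        rcases Multiset.mem_add.1 h with h | h
        · exact ⟨x', R, g, hE2, Or.inr h⟩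
        · exact hS v h
      · intro v hv
        rcases Multiset.mem_add.1 hv with h | h
        · exact ⟨x', R, g, hE2, by simpa using h⟩
        · exact hT v h
  obtain ⟨Q, S, T, x, -, -, h1, h2, h3, h4, h5, h6, h7⟩ := key b le_rfl
  exact ⟨Q, S, T, h1, h2, h3, h4, h5, h6, h7⟩

end HC
end

section
open Finset
open scoped Classical
namespace HC

def Adj {V : Type} [Fintype V] {m : ℕ} (Ed : Multiset V → Prop) (x y : Fin m → V) : Prop :=
  Ed (mt x + mt y)

lemma Adj.symm {V : Type} [Fintype V] {m : ℕ} {Ed : Multiset V → Prop} {x y : Fin m → V}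
    (h : Adj Ed x y) : Adj Ed y x := by unfold Adj at *; rwa [add_comm]

section helpers
variable {α V : Type*} [Fintype α] [Fintype V]

lemma pr_or_disj (p q : α → Prop) (h : ∀ a, p a → ¬ q a) : pr (fun a => p a ∨ q a) = pr p + pr q := by
  unfold pr
  rw [← add_div, ← Nat.cast_add, ← Finset.card_union_of_disjoint]
  · congr 3
    ext a; simp
  · rw [Finset.disjoint_left]
    intro a; simpa using h a

lemma pr_subtype (G : Finset V) (P : α → V → Prop) (hV : 0 < Fintype.card V) :
    pr (fun z : α × V => z.2 ∈ G ∧ P z.1 z.2) =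
      pr (fun z : α × {v // v ∈ G} => P z.1 z.2) * (G.card / Fintype.card V) := by
  rw [pr_swap (fun a v => v ∈ G ∧ P a v), pr_restrict G (fun v a => P a v),
    pr_swap (fun a (v : {v // v ∈ G}) => P a v), pr_prod (fun (v : {v // v ∈ G}) a => P a v)]
  rw [Finset.sum_coe_sort G (fun v => pr fun a => P a v), Fintype.card_coe]
  rcases G.eq_empty_or_nonempty with rfl | hG
  · simp
  have : (0:ℝ) < G.card := by exact_mod_cast hG.card_pos
  field_simp

lemma pr_all (q : ℕ) (p : V → Prop) : pr (fun f : Fin q → V => ∀ i, p (f i)) = (pr p)^q := by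
  unfold pr
  have : (Finset.univ.filter (fun f : Fin q → V => ∀ i, p (f i))) =
      Fintype.piFinset (fun _ => Finset.univ.filter p) := by
    ext f; simp [Fintype.mem_piFinset]
  have h2 := congrArg Finset.card this
  rw [Fintype.card_piFinset_const] at h2
  rw [div_pow]
  congr 1
  · rw [← Nat.cast_pow, ← h2]; congr
  · simp

lemma pr_list_le {ι : Type*} (l : List ι) (p : ι → α → Prop) :
    pr (fun a => ∃ i ∈ l, p i a) ≤ (l.map (fun i => pr (p i))).sum := by
  induction l with
  | nil => simp [pr_false]
  | cons i l ih =>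
    have := pr_or_le (p i) (fun a => ∃ i ∈ l, p i a)
    have h2 : pr (fun a => ∃ j ∈ (i :: l), p j a) ≤ pr (fun a => p i a ∨ ∃ i ∈ l, p i a) :=
      pr_mono fun a => by simp
    simp only [List.map_cons, List.sum_cons]
    linarith

end helpers

section
variable {V : Type} [Fintype V]

lemma hit2 (a b : ℕ) (U : Multiset V) (hU : U.Nodup) :
    pr (fun z : (Fin a → V) × (Fin b → V) => ¬ (mt z.1 + mt z.2 + U).Nodup) ≤
      (a + b : ℕ) * ((a + b : ℕ) + U.card) / Fintype.card V := by
  have := cnt_hit (a + b) U hU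
  unfold cnt at this
  rw [← pr_equiv (Fin.appendEquiv a b)] at this
  refine le_trans (le_of_eq (pr_congr fun z => ?_)) this
  show _ ↔ ¬ (mt (Fin.append z.1 z.2) + U).Nodup
  rw [mt_append]

lemma pr_mem_multiset (s : Multiset V) (h : s.Nodup) : pr (fun v => v ∈ s) = s.card / Fintype.card V := by
  have : pr (fun v => v ∈ s) = pr (fun v => v ∈ s.toFinset) := pr_congr fun v => by simp
  rw [this, pr_mem_card, Multiset.toFinset_card_of_nodup h]

lemma pr_mem_multiset_le (s : Multiset V) : pr (fun v => v ∈ s) ≤ s.card / Fintype.card V := by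
  have : pr (fun v => v ∈ s) = pr (fun v => v ∈ s.toFinset) := pr_congr fun v => by simp
  rw [this, pr_mem_card]
  gcongr
  exact Multiset.toFinset_card_le s

lemma nodup_card_le (s : Multiset V) (h : s.Nodup) : s.card ≤ Fintype.card V := by
  rw [← Multiset.toFinset_card_of_nodup h]; exact Finset.card_le_univ _

lemma mem_sum_vs {m : ℕ} (F : List (List (Fin m → V))) (v : V) :
    v ∈ (F.map vs).sum ↔ ∃ Q ∈ F, v ∈ vs Q := by
  induction F with
  | nil => simp
  | cons Q F ih => simp [ih]

lemma card_sum_vs {m b : ℕ} (F : List (List (Fin m → V))) (h : ∀ Q ∈ F, Q.length = b) :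
    ((F.map vs).sum).card = F.length * (b * m) := by
  induction F with
  | nil => simp
  | cons Q F ih =>
    rw [List.map_cons, List.sum_cons, Multiset.card_add, ih (fun Q hQ => h Q (by simp [hQ])), card_vs,
      h Q (by simp), List.length_cons]
    ring

/-- disjoint additivity -/
lemma pr_list_disj {α : Type*} [Fintype α] {m : ℕ} (F : List (List (Fin m → V))) (hF : ((F.map vs).sum).Nodup)
    (P : α → V → Prop) :
    (F.map (fun Q => pr (fun z : α × V => z.2 ∈ vs Q ∧ P z.1 z.2))).sum ≤
      pr (fun z : α × V => z.2 ∈ (F.map vs).sum ∧ P z.1 z.2) := by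
  induction F with
  | nil => simp [pr_false]
  | cons Q F ih =>
    rw [List.map_cons, List.sum_cons] at hF
    have hF2 := Multiset.nodup_add.1 hF
    have h1 := pr_or_disj (fun z : α × V => z.2 ∈ vs Q ∧ P z.1 z.2)
      (fun z : α × V => z.2 ∈ (F.map vs).sum ∧ P z.1 z.2)
      (fun z h h' => Multiset.disjoint_left.1 hF2.2.2 h.1 h'.1)
    have h2 := ih hF2.2.1
    rw [List.map_cons, List.sum_cons]
    have h3 : pr (fun z : α × V => z.2 ∈ ((Q :: F).map vs).sum ∧ P z.1 z.2) =
       pr (fun z : α × V => (z.2 ∈ vs Q ∧ P z.1 z.2) ∨ (z.2 ∈ (F.map vs).sum ∧ P z.1 z.2)) :=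
      pr_congr fun z => by simp; tauto
    linarith

end

def CovOK {V : Type} [Fintype V] {m : ℕ} (b : ℕ) (Ed : Multiset V → Prop) (F : List (List (Fin m → V))) : Prop :=
  ∀ Q ∈ F, List.IsChain (Adj Ed) Q ∧ Q.length = 2 * b + 1

abbrev ZT (V : Type) (m' : ℕ) := (Fin (m'+1) → V) × (Fin m' → V)

def ms {V : Type} [Fintype V] {m' : ℕ} (z : ZT V m') : Multiset V := mt z.1 + mt z.2

set_option maxHeartbeats 1000000 in
lemma cov_improve (m' b : ℕ) (hm : 2 ≤ m') (γ : ℝ) (hγ : 0 < γ) (hγ1 : γ ≤ 1) :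
    ∃ n0 : ℕ, ∀ (V : Type) [Fintype V], n0 ≤ Fintype.card V →
    ∀ (Ed : Multiset V → Prop), (∀ s, Ed s → s.Nodup) →
    (∀ s : Multiset V, s.Nodup → s.card = 2 * m' + 1 → (45/100 : ℝ) ≤ pr (fun v => Ed (s + {v}))) →
    ∀ U : Multiset V, U.Nodup → (U.card : ℝ) ≤ Fintype.card V / 100 →
    ∀ F : List (List (Fin (m'+1) → V)), CovOK b Ed F → ((F.map vs).sum + U).Nodup →
      γ * Fintype.card V < Fintype.card V - ((F.map vs).sum + U).card →
    ∃ F' : List (List (Fin (m'+1) → V)), CovOK b Ed F' ∧ ((F'.map vs).sum + U).Nodup ∧ F'.length = F.length + 1 := by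
  set ρ0 : ℝ := γ ^ (2 * m' + 1) with hρ0
  have hρ00 : 0 < ρ0 := by positivity
  set d : ℝ := ρ0 / 100 with hd
  have hd0 : 0 < d := by positivity
  obtain ⟨n1, hEL⟩ := EL m' b d hd0
  set M : ℕ := (2 * b + 1) * (m' + 1) with hM
  set l : ℕ := ⌈(12 / d : ℝ)⌉₊ + 1 with hl
  have hl1 : (12 / d : ℝ) ≤ l := Nat.ceil_le.1 (by omega)
  rw [div_le_iff₀ hd0] at hl1
  have hl0 : (0:ℝ) < l := by rw [hl]; positivity
  have hM0 : 0 < M := by rw [hM]; positivity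
  have hMr : (0:ℝ) < M := by exact_mod_cast hM0
  set B : ℝ := 100 * ((2 * m' + 1) * (2 * m' + 1 + (l + 1) * M)) / ρ0 with hB
  clear_value B M l d ρ0
  refine ⟨n1 + ⌈B⌉₊ + ⌈(l * M / (8/100) : ℝ)⌉₊ + ⌈(12 * M / d : ℝ)⌉₊ + 1, ?_⟩
  intro V _ hV Ed hEd hcod U hU hUc F hF hFn hleft
  set n := Fintype.card V with hn
  have hn1 : B ≤ n := Nat.ceil_le.1 (by omega)
  have hn2 : (l * M / (8/100) : ℝ) ≤ n := Nat.ceil_le.1 (by omega)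
  have hn3 : (12 * M / d : ℝ) ≤ n := Nat.ceil_le.1 (by omega)
  have hn0' : 0 < n := by omega
  have hn0 : (0:ℝ) < n := by exact_mod_cast hn0'
  rw [hB, div_le_iff₀ hρ00] at hn1
  rw [div_le_iff₀ hd0] at hn3
  rw [div_le_iff₀ (by norm_num)] at hn2
  haveI : Nonempty V := by rw [← Fintype.card_pos_iff]; exact hn0'
  set D := (F.map vs).sum + U with hD
  obtain ⟨inW, hinW⟩ : ∃ f : ZT V m' → Prop, ∀ z, f z ↔ ∀ v ∈ ms z, v ∉ D := ⟨_, fun _ => Iff.rfl⟩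
  set ρ := pr inW with hρ
  have hρ1 : ρ0 ≤ ρ := by
    have h1 : pr (fun v => v ∉ D) = 1 - D.card / n := by rw [pr_not, pr_mem_multiset D hFn]
    have h2 : γ ≤ pr (fun v => v ∉ D) := by
      rw [h1, le_sub_iff_add_le, ← le_sub_iff_add_le', div_le_iff₀ hn0]
      linarith
    have h3 := pr_prod_ge (p := fun f : Fin (m'+1) → V => ∀ i, f i ∉ D)
      (q := fun _ (g : Fin m' → V) => ∀ i, g i ∉ D) (b := γ ^ m')
      (fun _ _ => by rw [pr_all m' (fun v => v ∉ D)]; gcongr)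
    rw [pr_all (m'+1) (fun v => v ∉ D)] at h3
    have h4 : γ ^ (m'+1) * γ^m' ≤ pr (fun v => v ∉ D) ^ (m'+1) * γ^m' := by gcongr
    rw [hρ0, show 2 * m' + 1 = (m'+1) + m' by ring, pow_add]
    refine h4.trans (h3.trans (pr_mono ?_))
    rintro ⟨x, R⟩ ⟨h5, h6⟩
    rw [hinW]
    intro v hv
    rcases Multiset.mem_add.1 hv with h | h
    · obtain ⟨i, rfl⟩ := (mem_mt _ _).1 h; exact h5 i
    · obtain ⟨i, rfl⟩ := (mem_mt _ _).1 h; exact h6 i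
  have hρpos : 0 < ρ := lt_of_lt_of_le hρ00 hρ1
  -- hit bound
  have hhit : ∀ X : Multiset V, X.Nodup → X.card ≤ (l + 1) * M → pr (fun z : ZT V m' => ¬ (ms z + X).Nodup) ≤ ρ / 100 := by
    intro X hX hXc
    refine (hit2 (m'+1) m' X hX).trans ?_
    rw [div_le_iff₀ hn0]
    have h1 : (X.card : ℝ) ≤ (l + 1) * M := by exact_mod_cast hXc
    have h2 : ((m' + 1 + m' : ℕ) : ℝ) * ((m' + 1 + m' : ℕ) + X.card) ≤ (2 * m' + 1) * (2 * m' + 1 + (l + 1) * M) := by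
      have e1 : ((m' + 1 + m' : ℕ) : ℝ) = 2 * m' + 1 := by push_cast; ring
      rw [e1]
      gcongr
    have h3 : n * ρ0 ≤ n * ρ := by gcongr
    linarith
  have hsnoc : ∀ (x : Fin (m'+1) → V) (R : Fin m' → V) (v : V), Ed (ms (x, R) + {v}) →
      Adj Ed x (Fin.snoc R v) ∧ Adj Ed (Fin.snoc R v) x ∧ (mt x).Nodup := by
    intro x R v h
    have h1 : Adj Ed x (Fin.snoc R v) := by
      unfold Adj
      rw [mt_snoc, ← add_assoc]; exact h
    refine ⟨h1, h1.symm, ?_⟩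
    have := hEd _ h
    exact (Multiset.nodup_add.1 (Multiset.nodup_add.1 this).1).1
  have mem_ms : ∀ (x : Fin (m'+1) → V) (R : Fin m' → V) (v : V), (v ∈ mt x ∨ v ∈ mt R) → v ∈ ms (x, R) :=
    fun x R v h => Multiset.mem_add.2 h
  by_cases hcase : ρ / 100 ≤ pr (fun z : ZT V m' × V => inW z.1 ∧ z.2 ∉ D ∧ Ed (ms z.1 + {z.2}))
  · have hc1 : d ≤ pr (fun z : ZT V m' × V => inW z.1 ∧ z.2 ∉ D ∧ Ed (ms z.1 + {z.2})) := le_trans (by rw [hd]; linarith) hcase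
    have hc3 : d ≤ pr (fun z : ((Fin (m'+1) → V) × (Fin m' → V)) × V => inW (z.1.1,z.1.2) ∧ z.2 ∉ D ∧ Ed (ms (z.1.1,z.1.2) + {z.2})) := hc1
    have hc4 := hEL V (by omega) V id Function.injective_id
      (by rw [hM] at hn3; push_cast at hn3; linarith) (Adj Ed)
      (fun x R v => inW (x, R) ∧ v ∉ D ∧ Ed (ms (x, R) + {v})) (fun x R v h => hsnoc x R v h.2.2)
    obtain ⟨Q, S, T, hQ1, hQ2, hQ3, hQ4, hQ5, hQ6, hQ7⟩ := hc4 hc3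
    refine ⟨Q :: F, ?_, ?_, by simp⟩
    · intro Q' hQ'
      rcases List.mem_cons.1 hQ' with rfl | h
      · exact ⟨hQ1, hQ2⟩
      · exact hF Q' h
    · rw [List.map_cons, List.sum_cons, add_assoc, Multiset.nodup_add]
      refine ⟨hQ4, hFn, ?_⟩
      rw [Multiset.disjoint_left]
      intro v hv
      rw [hQ3] at hv
      rcases Multiset.mem_add.1 hv with h | h
      · obtain ⟨x, R, g, hE, h2⟩ := hQ6 v h
        exact (hinW _).1 hE.1 v (mem_ms x R v h2)
      · obtain ⟨x, R, g, hE, rfl⟩ := hQ7 v h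
        exact hE.2.1
  push Not at hcase
  set DF := (F.map vs).sum with hDF
  have hDFn : DF.Nodup := (Multiset.nodup_add.1 hFn).1
  have hbig : (42/100) * ρ ≤ pr (fun z : ZT V m' × V => z.2 ∈ DF ∧ (inW z.1 ∧ Ed (ms z.1 + {z.2}))) := by
    have h1 : ρ - ρ / 100 ≤ pr (fun z : ZT V m' => inW z ∧ ¬ ¬ (ms z + 0).Nodup) := by
      have := pr_and_not_ge inW (fun z => ¬ (ms z + 0).Nodup)
      have h2 := hhit 0 (by simp) (by simp)
      linarith
    have h2 := pr_prod_ge (p := fun z : ZT V m' => inW z ∧ ¬ ¬ (ms z + 0).Nodup)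
      (q := fun z v => Ed (ms z + {v})) (b := 45/100) (fun z hz => by
        apply hcod
        · simpa using hz.2
        · simp [ms]; ring)
    have h3 := pr_prod_le' (p := inW) (q := fun _ (v : V) => v ∈ U) (b := 1/100) (by norm_num) (fun z hz => by
        refine (pr_mem_multiset_le U).trans ?_
        rw [div_le_iff₀ hn0]; linarith)
    have h4 := pr_or_le (fun z : ZT V m' × V => inW z.1 ∧ z.2 ∈ U) (fun z : ZT V m' × V => inW z.1 ∧ z.2 ∉ D ∧ Ed (ms z.1 + {z.2}))
    have h5 := pr_or_le (fun z : ZT V m' × V => z.2 ∈ DF ∧ (inW z.1 ∧ Ed (ms z.1 + {z.2})))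
      (fun z : ZT V m' × V => (inW z.1 ∧ z.2 ∈ U) ∨ (inW z.1 ∧ z.2 ∉ D ∧ Ed (ms z.1 + {z.2})))
    have h6 : pr (fun z : ZT V m' × V => (inW z.1 ∧ ¬ ¬ (ms z.1 + 0).Nodup) ∧ Ed (ms z.1 + {z.2})) ≤
      pr (fun z : ZT V m' × V => (z.2 ∈ DF ∧ (inW z.1 ∧ Ed (ms z.1 + {z.2}))) ∨
        ((inW z.1 ∧ z.2 ∈ U) ∨ (inW z.1 ∧ z.2 ∉ D ∧ Ed (ms z.1 + {z.2})))) := by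
      apply pr_mono
      intro z hz
      by_cases ha : z.2 ∈ DF
      · exact Or.inl ⟨ha, hz.1.1, hz.2⟩
      by_cases hb : z.2 ∈ U
      · exact Or.inr (Or.inl ⟨hz.1.1, hb⟩)
      · refine Or.inr (Or.inr ⟨hz.1.1, ?_, hz.2⟩)
        rw [hD, Multiset.mem_add]; tauto
    have h7 : (ρ - ρ/100) * (45/100) ≤ pr (fun z : ZT V m' => inW z ∧ ¬ ¬ (ms z + 0).Nodup) * (45/100) := by gcongr
    simp only [← hρ] at h3
    linarith
  let e : List (Fin (m'+1) → V) → ℝ := fun Q => pr (fun z : ZT V m' × V => z.2 ∈ vs Q ∧ (inW z.1 ∧ Ed (ms z.1 + {z.2})))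
  have hesum : (42/100) * ρ ≤ (F.map e).sum := by
    refine hbig.trans (le_trans (pr_mono ?_) (pr_list_le F (fun Q (z : ZT V m' × V) => z.2 ∈ vs Q ∧ (inW z.1 ∧ Ed (ms z.1 + {z.2})))))
    rintro z ⟨h1, h2⟩
    obtain ⟨Q, hQ, hv⟩ := (mem_sum_vs F z.2).1 h1
    exact ⟨Q, hQ, hv, h2⟩
  have hinv : ∀ s : Multiset V, pr (fun z : ZT V m' × V => z.2 ∈ s ∧ (inW z.1 ∧ Ed (ms z.1 + {z.2}))) ≤ ρ * (s.card / n) := by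
    intro s
    have := pr_prod_le' (p := inW) (q := fun _ (v : V) => v ∈ s) (b := s.card / n) (by positivity)
      (fun z hz => pr_mem_multiset_le s)
    exact (pr_mono fun z hz => ⟨hz.2.1, hz.1⟩).trans this
  have heub : ∀ Q ∈ F, e Q ≤ ρ * (M / n) := by
    intro Q hQ
    have := hinv (vs Q)
    rw [card_vs, (hF Q hQ).2, mul_comm (m'+1), ← hM] at this
    exact this
  have hFlen : ∀ Q ∈ F, Q.length = 2 * b + 1 := fun Q hQ => (hF Q hQ).2
  have hFc : DF.card = F.length * M := by rw [hM]; exact card_sum_vs F hFlen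
  have hFM : (F.length : ℝ) * M ≤ n := by
    have := nodup_card_le DF hDFn
    rw [hFc] at this
    exact_mod_cast this
  let rich : List (Fin (m'+1) → V) → Prop := fun Q => ρ * (M / n) / 3 ≤ e Q
  have hrich : ∀ F' : List (List (Fin (m'+1) → V)), (∀ Q ∈ F', e Q ≤ ρ * (M / n)) →
      (F'.map e).sum ≤ (F'.filter (fun Q => decide (rich Q))).length * (ρ * (M / n)) + F'.length * (ρ * (M / n) / 3) := by
    intro F' h
    induction F' with
    | nil => simp
    | cons Q F' ih =>
      have h1 := ih (fun Q hQ => h Q (by simp [hQ]))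
      have h2 := h Q (by simp)
      have h3 : 0 ≤ ρ * (M / n) := by positivity
      rw [List.map_cons, List.sum_cons, List.length_cons]
      by_cases hr : rich Q
      · rw [List.filter_cons_of_pos (by simpa using hr), List.length_cons]
        push_cast
        linarith
      · rw [List.filter_cons_of_neg (by simpa using hr)]
        have hr' : e Q < ρ * (M / n) / 3 := not_le.1 hr
        push_cast
        linarith
  set F1 := F.filter (fun Q => decide (rich Q)) with hF1
  set F2 := F.filter (fun Q => ! decide (rich Q)) with hF2
  have hF1l : l ≤ F1.length := by
    have h1 := hesum.trans (hrich F heub)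
    have h2 : (F.length : ℝ) * (ρ * (M / n) / 3) ≤ ρ / 3 := by
      calc (F.length : ℝ) * (ρ * (M / n) / 3) = (F.length * M) * (ρ / 3 / n) := by field_simp
        _ ≤ n * (ρ / 3 / n) := by gcongr
        _ = ρ / 3 := by field_simp
    have h3 : (8/100) * ρ ≤ F1.length * (ρ * (M / n)) := by linarith
    have h4 : (8/100) * (n:ℝ) ≤ F1.length * M := by
      have : (8/100) * ρ * (n / ρ) ≤ F1.length * (ρ * (M / n)) * (n / ρ) := by gcongr
      field_simp at this
      linarith
    have h5 : (l : ℝ) * M ≤ F1.length * M := by linarith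
    exact_mod_cast le_of_mul_le_mul_right h5 hMr
  set Tt := F1.take l with hTt
  set Rst := F1.drop l ++ F2 with hRst
  clear_value Rst
  have hperm : F.Perm (Tt ++ Rst) := by
    rw [hTt, hRst, ← List.append_assoc, List.take_append_drop]
    exact (List.filter_append_perm _ F).symm
  have hTtl : Tt.length = l := by rw [hTt, List.length_take]; omega
  set G0 := (Tt.map vs).sum with hG0
  have hDFeq : DF = G0 + (Rst.map vs).sum := by
    rw [hDF, (hperm.map vs).sum_eq, List.map_append, List.sum_append]
  have hTtF : ∀ Q ∈ Tt, Q ∈ F := fun Q hQ => hperm.mem_iff.2 (List.mem_append_left _ hQ)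
  have hRstF : ∀ Q ∈ Rst, Q ∈ F := fun Q hQ => hperm.mem_iff.2 (List.mem_append_right _ hQ)
  have hG0n : G0.Nodup := by rw [hDFeq] at hDFn; exact (Multiset.nodup_add.1 hDFn).1
  have hG0c : G0.card = l * M := by
    rw [hG0, card_sum_vs Tt (fun Q hQ => hFlen Q (hTtF Q hQ)), hTtl, hM]
  have hG0big : l * (ρ * (M / n) / 3) ≤ pr (fun z : ZT V m' × V => z.2 ∈ G0 ∧ (inW z.1 ∧ Ed (ms z.1 + {z.2}))) := by
    have hpl := pr_list_disj Tt hG0n (fun (z : ZT V m') (v : V) => inW z ∧ Ed (ms z + {v}))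
    rw [← hG0] at hpl
    refine le_trans ?_ hpl
    have : (Tt.map (fun Q => ρ * (M / n) / 3)).sum ≤ (Tt.map e).sum := by
      apply List.sum_le_sum
      intro Q hQ
      have : Q ∈ F1 := List.mem_of_mem_take hQ
      rw [hF1, List.mem_filter] at this
      exact of_decide_eq_true this.2
    refine le_trans (le_of_eq ?_) this
    rw [List.map_const', List.sum_replicate, hTtl, nsmul_eq_mul]
  have hmb : 6 * b ≤ M := by rw [hM]; nlinarith
  have key : ∀ j ≤ l + 1, ∃ (Fs : List (List (Fin (m'+1) → V))) (S T : Multiset V), Fs.length = j ∧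
      CovOK b Ed Fs ∧ (Fs.map vs).sum = S + T ∧ (S + T).Nodup ∧ T.card = j * b ∧ (∀ v ∈ S, v ∉ D) ∧ (∀ v ∈ T, v ∈ G0) := by
    intro j
    induction j with
    | zero => exact fun _ => ⟨[], 0, 0, rfl, by simp [CovOK], by simp, by simp, by simp, by simp, by simp⟩
    | succ j ih =>
      intro hj
      obtain ⟨Fs, S, T, h1, h2, h3, h4, h5, h6, h7⟩ := ih (by omega)
      have hSTc : (S + T).card ≤ (l + 1) * M := by
        rw [← h3, card_sum_vs Fs (fun Q hQ => (h2 Q hQ).2), h1, ← hM]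
        gcongr; omega
      have hhj := hhit (S + T) h4 hSTc
      have hb1 : pr (fun z : ZT V m' × V => z.2 ∈ T ∧ (inW z.1 ∧ Ed (ms z.1 + {z.2}))) ≤ l * (ρ * (M / n)) / 6 := by
        refine (hinv T).trans ?_
        rw [h5]
        have : (j * b * 6: ℝ) ≤ l * M := by
          have : j * (6 * b) ≤ l * M := Nat.mul_le_mul (by omega) hmb
          have h2 : ((j * (6 * b) : ℕ) : ℝ) ≤ ((l * M : ℕ) : ℝ) := by exact_mod_cast this
          push_cast at h2; linarith
        calc ρ * (((j * b : ℕ):ℝ) / n) = ρ / n / 6 * (j * b * 6) := by push_cast; ring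
          _ ≤ ρ / n / 6 * (l * M) := by gcongr
          _ = _ := by ring
      have hb2 : pr (fun z : ZT V m' × V => ¬ (ms z.1 + (S + T)).Nodup ∧ z.2 ∈ G0) ≤ l * (ρ * (M / n)) / 100 := by
        have := pr_prod_le' (p := fun z : ZT V m' => ¬ (ms z + (S + T)).Nodup) (q := fun _ (v : V) => v ∈ G0) (b := G0.card / n)
          (by positivity) (fun z hz => pr_mem_multiset_le G0)
        refine this.trans ?_
        rw [hG0c]
        calc _ ≤ (ρ / 100) * (((l * M : ℕ):ℝ) / n) := by gcongr
          _ = _ := by push_cast; ring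
      have hmain : l * (ρ * (M / n)) / 10 ≤ pr (fun z : ZT V m' × V => z.2 ∈ G0.toFinset ∧
          (inW z.1 ∧ (ms z.1 + (S + T)).Nodup ∧ z.2 ∉ T ∧ Ed (ms z.1 + {z.2}))) := by
        have a1 := pr_or_le (fun z : ZT V m' × V => z.2 ∈ T ∧ (inW z.1 ∧ Ed (ms z.1 + {z.2})))
          (fun z : ZT V m' × V => ¬ (ms z.1 + (S + T)).Nodup ∧ z.2 ∈ G0)
        have a2 := pr_or_le (fun z : ZT V m' × V => z.2 ∈ G0.toFinset ∧
          (inW z.1 ∧ (ms z.1 + (S + T)).Nodup ∧ z.2 ∉ T ∧ Ed (ms z.1 + {z.2})))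
          (fun z : ZT V m' × V => (z.2 ∈ T ∧ (inW z.1 ∧ Ed (ms z.1 + {z.2}))) ∨ (¬ (ms z.1 + (S + T)).Nodup ∧ z.2 ∈ G0))
        have a3 : pr (fun z : ZT V m' × V => z.2 ∈ G0 ∧ (inW z.1 ∧ Ed (ms z.1 + {z.2}))) ≤ pr (fun z : ZT V m' × V =>
          (z.2 ∈ G0.toFinset ∧ (inW z.1 ∧ (ms z.1 + (S + T)).Nodup ∧ z.2 ∉ T ∧ Ed (ms z.1 + {z.2}))) ∨
          ((z.2 ∈ T ∧ (inW z.1 ∧ Ed (ms z.1 + {z.2}))) ∨ (¬ (ms z.1 + (S + T)).Nodup ∧ z.2 ∈ G0))) := by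
          apply pr_mono
          rintro z ⟨b1, b2, b3⟩
          by_cases c1 : z.2 ∈ T
          · exact Or.inr (Or.inl ⟨c1, b2, b3⟩)
          by_cases c2 : (ms z.1 + (S + T)).Nodup
          · exact Or.inl ⟨by simpa using b1, b2, c2, c1, b3⟩
          · exact Or.inr (Or.inr ⟨c2, b1⟩)
        have a4 : 0 ≤ l * (ρ * (M / n)) := by positivity
        linarith
      rw [pr_subtype G0.toFinset (fun (z : ZT V m') v => inW z ∧ (ms z + (S + T)).Nodup ∧ v ∉ T ∧ Ed (ms z + {v})) hn0',
        Multiset.toFinset_card_of_nodup hG0n, hG0c] at hmain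
      have hmain2 : ρ / 10 ≤ pr (fun z : ZT V m' × {v // v ∈ G0.toFinset} => inW z.1 ∧ (ms z.1 + (S + T)).Nodup ∧ (z.2 : V) ∉ T ∧ Ed (ms z.1 + {(z.2 : V)})) := by
        have hc : 0 < ((l * M : ℕ) : ℝ) / n := by push_cast; positivity
        refine le_of_mul_le_mul_right (le_trans (le_of_eq ?_) hmain) hc
        push_cast; ring
      have hc1 := le_trans (show d ≤ ρ / 10 by rw [hd]; linarith) hmain2
      have hc3 : d ≤ pr (fun z : ((Fin (m'+1) → V) × (Fin m' → V)) × {v // v ∈ G0.toFinset} => inW (z.1.1,z.1.2) ∧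
        (ms (z.1.1,z.1.2) + (S + T)).Nodup ∧ (z.2 : V) ∉ T ∧ Ed (ms (z.1.1,z.1.2) + {(z.2 : V)})) := hc1
      have hc4 := hEL V (by omega) {v // v ∈ G0.toFinset} (fun v => v.1)
        Subtype.val_injective (by
          rw [Fintype.card_coe, Multiset.toFinset_card_of_nodup hG0n, hG0c]
          have : 12 * (M : ℝ) ≤ (l * d) * M := by gcongr
          rw [hM] at this ⊢; push_cast at this ⊢; linarith) (Adj Ed)
        (fun x R v => inW (x, R) ∧ (ms (x, R) + (S + T)).Nodup ∧ (v : V) ∉ T ∧ Ed (ms (x, R) + {(v : V)}))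
        (fun x R v h => hsnoc x R v h.2.2.2)
      obtain ⟨Q, S', T', q1, q2, q3, q4, q5, q6, q7⟩ := hc4 hc3
      refine ⟨Q :: Fs, S' + S, T' + T, by simp [h1], ?_, ?_, ?_, ?_, ?_, ?_⟩
      · intro Q' hQ'
        rcases List.mem_cons.1 hQ' with rfl | h
        · exact ⟨q1, q2⟩
        · exact h2 Q' h
      · rw [List.map_cons, List.sum_cons, q3, h3]; abel
      · rw [show S' + S + (T' + T) = (S' + T') + (S + T) by abel, Multiset.nodup_add]
        refine ⟨q3 ▸ q4, h4, ?_⟩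
        rw [Multiset.disjoint_left]
        intro v hv
        rcases Multiset.mem_add.1 hv with h | h
        · obtain ⟨x, R, g, hE, h8⟩ := q6 v h
          exact Multiset.disjoint_left.1 (Multiset.nodup_add.1 hE.2.1).2.2 (mem_ms x R v h8)
        · obtain ⟨x, R, g, hE, rfl⟩ := q7 v h
          rw [Multiset.mem_add]
          rintro (h9 | h9)
          · apply h6 _ h9
            rw [hD, hDFeq]
            have := g.2
            rw [Multiset.mem_toFinset] at this
            simp [this]
          · exact hE.2.2.1 h9
      · rw [Multiset.card_add, q5, h5]; ring
      · intro v hv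
        rcases Multiset.mem_add.1 hv with h | h
        · obtain ⟨x, R, g, hE, h8⟩ := q6 v h
          exact (hinW _).1 hE.1 v (mem_ms x R v h8)
        · exact h6 v h
      · intro v hv
        rcases Multiset.mem_add.1 hv with h | h
        · obtain ⟨x, R, g, hE, rfl⟩ := q7 v h
          have := g.2
          rwa [Multiset.mem_toFinset] at this
        · exact h7 v h
  obtain ⟨Fs, S, T, h1, h2, h3, h4, h5, h6, h7⟩ := key (l+1) le_rfl
  refine ⟨Fs ++ Rst, ?_, ?_, ?_⟩
  · intro Q hQ
    rcases List.mem_append.1 hQ with h | h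
    · exact h2 Q h
    · exact hF Q (hRstF Q h)
  · have hTG : T ≤ G0 := (Multiset.le_iff_subset (Multiset.nodup_add.1 h4).2.1).2 h7
    rw [List.map_append, List.sum_append, h3, add_assoc, add_assoc, Multiset.nodup_add]
    have hle : T + ((Rst.map vs).sum + U) ≤ D := by
      rw [hD, hDFeq, add_assoc]
      gcongr
    refine ⟨(Multiset.nodup_add.1 h4).1, Multiset.nodup_of_le hle hFn, ?_⟩
    rw [Multiset.disjoint_left]
    intro v hv hv2
    exact h6 v hv (Multiset.mem_of_le hle hv2)
  · have := hperm.length_eq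
    rw [List.length_append, hTtl] at this
    rw [List.length_append, h1]; omega

lemma Cov (m' b : ℕ) (hm : 2 ≤ m') (γ : ℝ) (hγ : 0 < γ) (hγ1 : γ ≤ 1) :
    ∃ n0 : ℕ, ∀ (V : Type) [Fintype V], n0 ≤ Fintype.card V →
    ∀ (Ed : Multiset V → Prop), (∀ s, Ed s → s.Nodup) →
    (∀ s : Multiset V, s.Nodup → s.card = 2 * m' + 1 → (45/100 : ℝ) ≤ pr (fun v => Ed (s + {v}))) →
    ∀ U : Multiset V, U.Nodup → (U.card : ℝ) ≤ Fintype.card V / 100 →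
    ∃ F : List (List (Fin (m'+1) → V)), CovOK b Ed F ∧ ((F.map vs).sum + U).Nodup ∧
      Fintype.card V - ((F.map vs).sum + U).card ≤ γ * Fintype.card V := by
  obtain ⟨n0, h⟩ := cov_improve m' b hm γ hγ hγ1
  refine ⟨n0, ?_⟩
  intro V _ hV Ed hEd hcod U hU hUc
  by_contra! hcon
  have key : ∀ j : ℕ, ∃ F : List (List (Fin (m'+1) → V)), CovOK b Ed F ∧ ((F.map vs).sum + U).Nodup ∧ F.length = j := by
    intro j
    induction j with
    | zero => exact ⟨[], by simp [CovOK], by simpa using hU, rfl⟩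
    | succ j ih =>
      obtain ⟨F, h1, h2, h3⟩ := ih
      obtain ⟨F', h4, h5, h6⟩ := h V hV Ed hEd hcod U hU hUc F h1 h2 (hcon F h1 h2)
      exact ⟨F', h4, h5, by omega⟩
  obtain ⟨F, h1, h2, h3⟩ := key (Fintype.card V + 1)
  have h4 := nodup_card_le _ (Multiset.nodup_add.1 h2).1
  rw [card_sum_vs F (fun Q hQ => (h1 Q hQ).2), h3] at h4
  have : 0 < (2 * b + 1) * (m' + 1) := by positivity
  nlinarith

end HC
end

section
open Finset
open scoped Classical
namespace HC

section
variable {V : Type} [Fintype V] {m : ℕ}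

/-- sequential choice, multiset version -/
lemma cnt_bind {q1 q2 : ℕ} {P1 P : Multiset V → Prop} {a b : ℝ} (hb : 0 ≤ b) (h1 : a ≤ cnt V q1 P1)
    (h2 : ∀ s1, P1 s1 → b ≤ cnt V q2 (fun s2 => P (s1 + s2))) : a * b ≤ cnt V (q1 + q2) P :=
  cnt_add (P2 := fun s1 s2 => P (s1 + s2)) hb h1 h2 (fun _ _ _ h => h)

/-- sequential choice, tuple version -/
lemma cnt_pick {q1 q2 : ℕ} {p : (Fin q1 → V) → Prop} {P : Multiset V → Prop} {a b : ℝ} (hb : 0 ≤ b) (h1 : a ≤ pr p)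
    (h2 : ∀ x, p x → b ≤ cnt V q2 (fun s2 => P (mt x + s2))) : a * b ≤ cnt V (q1 + q2) P := by
  refine cnt_bind hb (h1.trans (cnt_base p)) ?_
  rintro s ⟨x, rfl, hx⟩
  exact h2 x hx

lemma cnt_end {q1 : ℕ} {p : (Fin q1 → V) → Prop} {P : Multiset V → Prop} {a : ℝ} (h1 : a ≤ pr p)
    (h2 : ∀ x, p x → P (mt x)) : a ≤ cnt V q1 P := h1.trans (pr_mono h2)

/-- exchange gadgets -/
def ExP (A : (Fin m → V) → (Fin m → V) → Prop) (St En : (Fin m → V) → Prop) (T0 T : Multiset V)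
    (s : Multiset V) : Prop :=
  ∃ Q Q', GoodPath A St En Q ∧ vs Q = s + T0 ∧ Rep A Q Q' ∧ vs Q' = s + T

variable {A : (Fin m → V) → (Fin m → V) → Prop} {St En : (Fin m → V) → Prop}

lemma ExP.abs {T s : Multiset V} (h : ExP A St En 0 T s) : AbsP A St En T s := by
  obtain ⟨Q, Q', h1, h2, h3, h4⟩ := h
  exact ⟨Q, Q', h1, by simpa using h2, h3, h4⟩

lemma exp_prod {q1 q2 cq : ℕ} {c1 c2 c : ℝ} (hc1 : 0 ≤ c1) (hc2 : 0 ≤ c2) (hc : 0 ≤ c)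
    (hconn : ∀ y x, En y → St x → c ≤ cnt V cq (ConnP A y x)) {T0 T T0' T' X X' : Multiset V}
    (h1 : c1 ≤ cnt V q1 (fun s => ExP A St En T0 T (s + X))) (h2 : c2 ≤ cnt V q2 (fun s => ExP A St En T0' T' (s + X'))) :
    c1 * (c2 * c) ≤ cnt V (q1 + (q2 + cq)) (fun s => ExP A St En (T0 + T0') (T + T') (s + (X + X'))) := by
  refine cnt_bind (by positivity) h1 ?_
  rintro s1 ⟨Q1, Q1', ⟨g1, ⟨x1, hx1, sx1⟩, ⟨y1, hy1, ey1⟩⟩, v1, r1, v1'⟩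
  refine cnt_bind (by positivity) h2 ?_
  rintro s2 ⟨Q2, Q2', ⟨g2, ⟨x2, hx2, sx2⟩, ⟨y2, hy2, ey2⟩⟩, v2, r2, v2'⟩
  refine (hconn y1 x2 ey1 sx2).trans (cnt_mono ?_)
  rintro s3 _ ⟨C, hC, rfl⟩
  refine ⟨Q1 ++ (C ++ Q2), Q1' ++ (C ++ Q2'), ⟨glue g1 hy1 g2 hx2 hC, ⟨x1, head?_glue hx1, sx1⟩,
    ⟨y2, getLast?_glue (getLast?_glue hy2), ey2⟩⟩, ?_, ⟨glue r1.1 (r1.2.2.trans hy1) r2.1 (r2.2.1.trans hx2) hC, ?_, ?_⟩, ?_⟩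
  · simp [v1, v2]; abel
  · rw [head?_glue (r1.2.1.trans hx1), head?_glue hx1]
  · rw [getLast?_glue (getLast?_glue (r2.2.2.trans hy2)), getLast?_glue (getLast?_glue hy2)]
  · simp [v1', v2']; abel

lemma exp_trans {q1 q2 cq : ℕ} {c1 c2 c : ℝ} (hc1 : 0 ≤ c1) (hc2 : 0 ≤ c2) (hc : 0 ≤ c)
    (hconn : ∀ y x, En y → St x → c ≤ cnt V cq (ConnP A y x)) {T0 T T' X X' : Multiset V}
    (h1 : c1 ≤ cnt V q1 (fun s => ExP A St En T0 T (s + X))) (h2 : c2 ≤ cnt V q2 (fun s => ExP A St En T T' (s + X'))) :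
    c1 * (c2 * c) ≤ cnt V (q1 + (q2 + cq)) (fun s => ExP A St En T0 T' (s + (X + X' + T))) := by
  refine (exp_prod hc1 hc2 hc hconn h1 h2).trans (cnt_mono ?_)
  rintro s _ ⟨Q, Q', g, v, r, v'⟩
  exact ⟨Q, Q', g, by rw [v]; abel, r, by rw [v']; abel⟩

def Inj (x : Fin m → V) : Prop := (mt x).Nodup

end

section N
variable {V : Type} [Fintype V] {m : ℕ}

def Near (Ed : Multiset V → Prop) (c : ℝ) (x y : Fin m → V) : Prop := c ≤ pr (fun z : Fin m → V => Adj Ed x z ∧ Adj Ed z y)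

def HypN (m : ℕ) (Ed : Multiset V → Prop) (c η : ℝ) : Prop := ∀ x y : Fin m → V, (mt x).Nodup → (mt y).Nodup →
  η ≤ pr (fun a : (Fin m → V) × ((Fin m → V) × (Fin m → V)) => Near Ed c x a.1 ∧ Near Ed c a.1 a.2.1 ∧ Near Ed c a.2.1 a.2.2
    ∧ Near Ed c a.2.2 y)

lemma adj_nodup {Ed : Multiset V → Prop} (hEd : ∀ s, Ed s → s.Nodup) {x y : Fin m → V} (h : Adj Ed x y) :
    (mt x).Nodup ∧ (mt y).Nodup := by
  have := hEd _ h
  exact ⟨(Multiset.nodup_add.1 this).1, (Multiset.nodup_add.1 this).2.1⟩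

/-- picking three tuples -/
lemma cnt_pick3 {q2 : ℕ} {p : (Fin m → V) × ((Fin m → V) × (Fin m → V)) → Prop} {P : Multiset V → Prop} {a b : ℝ} (hb : 0 ≤ b)
    (h1 : a ≤ pr p)
    (h2 : ∀ x, p x → b ≤ cnt V q2 (fun s2 => P (mt x.1 + (mt x.2.1 + mt x.2.2) + s2))) : a * b ≤ cnt V ((m + (m + m)) + q2) P := by
  refine cnt_pick (p := fun f : Fin (m + (m+m)) → V => ∃ x, p x ∧ mt f = mt x.1 + (mt x.2.1 + mt x.2.2)) hb ?_ ?_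
  · rw [← pr_equiv (Fin.appendEquiv m (m+m))]
    rw [← pr_equiv ((Equiv.refl (Fin m → V)).prodCongr (Fin.appendEquiv m m))] 
    refine h1.trans (pr_mono ?_)
    rintro ⟨x, y, z⟩ h
    refine ⟨_, h, ?_⟩
    show mt (Fin.append x (Fin.append y z)) = _
    rw [mt_append, mt_append]
  · rintro f ⟨x, hx, hf⟩
    rw [hf]; exact h2 x hx

lemma N_conn {Ed : Multiset V → Prop} {c η : ℝ} (hc : 0 ≤ c) (hN : HypN m Ed c η) (y x : Fin m → V)
    (hy : (mt y).Nodup) (hx : (mt x).Nodup) :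
    η * (c * (c * (c * c))) ≤ cnt V ((m + (m+m)) + (m + (m + (m + m)))) (ConnP (Adj Ed) y x) := by
  refine cnt_pick3 (by positivity) (hN y x hy hx) ?_
  rintro ⟨a, b, d⟩ ⟨h1, h2, h3, h4⟩
  refine cnt_pick (by positivity) h1 ?_
  rintro z1 ⟨z11, z12⟩
  refine cnt_pick (by positivity) h2 ?_
  rintro z2 ⟨z21, z22⟩
  refine cnt_pick (by positivity) h3 ?_
  rintro z3 ⟨z31, z32⟩
  refine cnt_end h4 ?_
  rintro z4 ⟨z41, z42⟩
  refine ⟨[z1, a, z2, b, z3, d, z4], ?_, ?_⟩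
  · simp_all
  · simp; abel

lemma N_ex1 {Ed : Multiset V → Prop} (hEd : ∀ s, Ed s → s.Nodup) {c : ℝ} (hc : 0 ≤ c) {a b : Fin m → V} (h : Near Ed c a b) :
    c * c ≤ cnt V (m + m) (fun s => ExP (m := m) (Adj Ed) Inj Inj (mt b) (mt a) (s + 0)) := by
  refine cnt_pick (by positivity) h ?_
  rintro z1 ⟨z11, z12⟩
  refine cnt_end h ?_
  rintro z2 ⟨z21, z22⟩
  refine ⟨[z1, b, z2], [z1, a, z2], ⟨?_, ⟨z1, rfl, (adj_nodup hEd z12).1⟩, ⟨z2, rfl, (adj_nodup hEd z21).2⟩⟩, ?_, ⟨?_, rfl, rfl⟩, ?_⟩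
  · simp [z12, z22.symm]
  · simp; abel
  · simp [z11.symm, z21]
  · simp; abel

lemma N_ex (c η : ℝ) (hc : 0 < c) (hη : 0 < η) : ∃ κ : ℝ, 0 < κ ∧ ∀ (V : Type) [Fintype V] (Ed : Multiset V → Prop)
    (hEd : ∀ s, Ed s → s.Nodup) (hN : HypN m Ed c η)
    (x y : Fin m → V) (hx : (mt x).Nodup) (hy : (mt y).Nodup),
      κ ≤ cnt V (32 * m) (fun s => ExP (m := m) (Adj Ed) Inj Inj (mt y) (mt x) (s + 0)) := by
  set C : ℝ := η * (c * (c * (c * c))) with hC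
  have hC0 : 0 < C := by positivity
  refine ⟨η * ((c*c) * ((c*c) * C) * (((c*c) * ((c*c) * C)) * C)), by positivity, ?_⟩
  intro V _ Ed hEd hN x y hx hy
  have hconn : ∀ y x, Inj y → Inj x → C ≤ cnt V ((m + (m+m)) + (m + (m + (m + m)))) (ConnP (m := m) (Adj Ed) y x) :=
    fun y x hy hx => N_conn hc.le hN y x hy hx
  have hq : 32 * m = (m + (m + m)) + ((m + m + ((m + m) + ((m + (m+m)) + (m + (m + (m + m)))))) +
      ((m + m + ((m + m) + ((m + (m+m)) + (m + (m + (m + m)))))) + ((m + (m+m)) + (m + (m + (m + m)))))) := by ring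
  rw [hq]
  refine cnt_pick3 (by positivity) (hN x y hx hy) ?_
  rintro ⟨a, b, d⟩ ⟨h1, h2, h3, h4⟩
  have t1 := exp_trans (by positivity) (by positivity) hC0.le hconn (N_ex1 hEd hc.le h2) (N_ex1 hEd hc.le h1)
  have t2 := exp_trans (by positivity) (by positivity) hC0.le hconn (N_ex1 hEd hc.le h4) (N_ex1 hEd hc.le h3)
  have t3 := exp_trans (by positivity) (by positivity) hC0.le hconn t2 t1
  refine t3.trans (cnt_mono ?_)
  intro s _ h
  convert h using 1
  simp; abel

/-- the absorbers in the non-extremal case -/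
lemma N_abs (c η : ℝ) (hc : 0 < c) (hη : 0 < η) : ∃ κ : ℝ, 0 < κ ∧ ∀ (V : Type) [Fintype V] (Ed : Multiset V → Prop)
    (hEd : ∀ s, Ed s → s.Nodup) (hN : HypN m Ed c η)
    (x y : Fin m → V) (hx : (mt x).Nodup) (hy : (mt y).Nodup),
      κ ≤ cnt V (82 * m) (AbsP (m := m) (Adj Ed) Inj Inj (mt x + mt y)) := by
  obtain ⟨κ, hκ, hex⟩ := N_ex (m := m) c η hc hη
  set C : ℝ := η * (c * (c * (c * c))) with hC
  have hC0 : 0 < C := by positivity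
  refine ⟨η * (c * (c * (κ * (κ * C) * C))), by positivity, ?_⟩
  intro V _ Ed hEd hN x y hx hy
  have hconn : ∀ y x, Inj y → Inj x → C ≤ cnt V ((m + (m+m)) + (m + (m + (m + m)))) (ConnP (m := m) (Adj Ed) y x) :=
    fun y x hy hx => N_conn hc.le hN y x hy hx
  have hnear : η ≤ pr (fun a : (Fin m → V) × (Fin m → V) => Near Ed c a.1 a.2) := by
    refine (hN x y hx hy).trans ?_
    haveI : Nonempty (Fin m → V) := ⟨x⟩
    have h1 := pr_fst (β := Fin m → V) (fun a : (Fin m → V) × (Fin m → V) => Near Ed c a.1 a.2)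
    rw [← pr_equiv ((Equiv.prodAssoc (Fin m → V) (Fin m → V) (Fin m → V)).symm)] at h1
    rw [← h1]
    apply pr_mono
    rintro ⟨a, b, d⟩ h
    exact h.2.1
  have hq : 82 * m = (m + m) + (m + (m + ((32 * m + (32 * m + ((m + (m+m)) + (m + (m + (m + m)))))) + ((m + (m+m)) + (m + (m + (m + m))))))) := by ring
  rw [hq]
  refine cnt_pick (p := fun f : Fin (m+m) → V => ∃ a : (Fin m → V) × (Fin m → V), mt f = mt a.1 + mt a.2 ∧ Near Ed c a.1 a.2)
    (by positivity) ?_ ?_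
  · rw [← pr_equiv (Fin.appendEquiv m m)]
    refine hnear.trans (pr_mono ?_)
    rintro ⟨a, b⟩ h
    exact ⟨(a, b), mt_append a b, h⟩
  rintro f ⟨⟨Z, Y2⟩, hf, hZY⟩
  rw [hf]
  refine cnt_pick (by positivity) hZY ?_
  rintro Y1 ⟨p1, p2⟩
  refine cnt_pick (by positivity) hZY ?_
  rintro Z' ⟨p3, p4⟩
  have e1 := hex V Ed hEd hN x Y1 hx (adj_nodup hEd p2).1
  have e2 := hex V Ed hEd hN y Y2 hy (adj_nodup hEd p2).2
  have e3 := exp_prod hκ.le hκ.le hC0.le hconn e1 e2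
  refine (cnt_bind (q2 := ((m + (m+m)) + (m + (m + (m + m)))))
    (P := fun s => AbsP (m := m) (Adj Ed) Inj Inj (mt x + mt y) (mt Z + mt Y2 + (mt Y1 + (mt Z' + s)))) hC0.le e3 ?_)
  rintro s1 ⟨Q1, Q1', ⟨g1, ⟨x1, hx1, sx1⟩, ⟨y1, hy1, ey1⟩⟩, v1, r1, v1'⟩
  refine (hconn Z' x1 (adj_nodup hEd p3).2 sx1).trans (cnt_mono ?_)
  rintro s3 _ ⟨K, hK, rfl⟩
  have hZZ : List.IsChain (Adj Ed) [Z, Z'] := by simp [p3]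
  have hZZ' : List.IsChain (Adj Ed) [Z, Y1, Y2, Z'] := by simp [p1, p2, p4.symm]
  refine ⟨[Z, Z'] ++ (K ++ Q1), [Z, Y1, Y2, Z'] ++ (K ++ Q1'), ⟨glue hZZ rfl g1 hx1 hK, ⟨Z, rfl, (adj_nodup hEd p3).1⟩,
    ⟨y1, getLast?_glue (getLast?_glue hy1), ey1⟩⟩, ?_, ⟨glue hZZ' rfl r1.1 (r1.2.1.trans hx1) hK, rfl, ?_⟩, ?_⟩
  · simp [v1]; abel
  · rw [getLast?_glue (getLast?_glue (r1.2.2.trans hy1)), getLast?_glue (getLast?_glue hy1)]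
  · simp [v1']; abel

end N
end HC
end

section
open Finset
open scoped Classical
namespace HC

def HamCyc {V : Type} [Fintype V] (m : ℕ) (Ed : Multiset V → Prop) : Prop :=
  ∃ (Q : List (Fin m → V)) (x : Fin m → V), Q.head? = some x ∧ List.IsChain (Adj Ed) (Q ++ [x]) ∧ vs Q = Finset.univ.val

section
variable {V : Type} [Fintype V] {m : ℕ}

lemma countP_hit {q : ℕ} (F : List (Fin q → V)) (hF : (vs F).Nodup) (p : (Fin q → V) → Prop) (X : Multiset V)
    (h : ∀ f ∈ F, p f → ∃ v ∈ X, v ∈ mt f) : F.countP (fun f => decide (p f)) ≤ (X.filter (fun v => v ∈ vs F)).card := by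
  induction F with
  | nil => simp
  | cons f F ih =>
    rw [vs_cons, Multiset.nodup_add] at hF
    have h1 := ih hF.2.1 (fun g hg => h g (by simp [hg]))
    have h2 := Multiset.filter_add_filter (fun v => v ∈ mt f) (fun v => v ∈ vs F) X
    have h3 : X.filter (fun v => v ∈ mt f ∧ v ∈ vs F) = 0 := by
      rw [Multiset.filter_eq_nil]
      exact fun v _ hv => Multiset.disjoint_left.1 hF.2.2 hv.1 hv.2
    rw [h3, add_zero] at h2
    have h4 : X.filter (fun v => v ∈ vs (f :: F)) = X.filter (fun v => v ∈ mt f ∨ v ∈ vs F) := by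
      congr 1; ext v; simp
    rw [h4, ← h2, Multiset.card_add, List.countP_cons]
    by_cases hp : p f
    · obtain ⟨v, hv, hv2⟩ := h f (by simp) hp
      have : 0 < (X.filter (fun v => v ∈ mt f)).card := Multiset.card_pos_iff_exists_mem.2 ⟨v, Multiset.mem_filter.2 ⟨hv, hv2⟩⟩
      simp [hp]; omega
    · simp [hp]; omega

lemma mt_le_vs {x : Fin m → V} {Q : List (Fin m → V)} (h : x ∈ Q) : mt x ≤ vs Q := by
  induction Q with
  | nil => simp at h
  | cons y Q ih =>
    rw [vs_cons]
    rcases List.mem_cons.1 h with rfl | h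
    · exact Multiset.le_add_right _ _
    · exact (ih h).trans (Multiset.le_add_left _ _)

lemma vs_le_sum {Q : List (Fin m → V)} {F : List (List (Fin m → V))} (h : Q ∈ F) : vs Q ≤ (F.map vs).sum := by
  induction F with
  | nil => simp at h
  | cons y F ih =>
    rw [List.map_cons, List.sum_cons]
    rcases List.mem_cons.1 h with rfl | h
    · exact Multiset.le_add_right _ _
    · exact (ih h).trans (Multiset.le_add_left _ _)

lemma good_of_chain {A : (Fin m → V) → (Fin m → V) → Prop} {Q : List (Fin m → V)} (h : List.IsChain A Q) (hne : Q ≠ []) (hn : (vs Q).Nodup) :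
    GoodPath A Inj Inj Q := by
  refine ⟨h, ⟨Q.head hne, List.head?_eq_some_head hne, ?_⟩, ⟨Q.getLast hne, List.getLast?_eq_some_getLast hne, ?_⟩⟩
  · exact Multiset.nodup_of_le (mt_le_vs (List.head_mem hne)) hn
  · exact Multiset.nodup_of_le (mt_le_vs (List.getLast_mem hne)) hn

lemma card_sum_vs2 (F : List (List (Fin m → V))) : ((F.map vs).sum).card = m * (F.map List.length).sum := by
  induction F with
  | nil => simp
  | cons Q F ih => simp [ih, card_vs]; ring

abbrev TaskI (V : Type) [Fintype V] (m : ℕ) := {z : (Fin m → V) × (Fin m → V) // (mt z.1 + mt z.2).Nodup}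

lemma card_TaskI : Fintype.card (TaskI V m) ≤ (Fintype.card V) ^ (2 * m) := by
  refine (Fintype.card_subtype_le _).trans ?_
  simp [two_mul, pow_add]

lemma nonempty_TaskI (h : 2 * m ≤ Fintype.card V) : Nonempty (TaskI V m) := by
  have : Nonempty (Fin (m + m) ↪ V) := Function.Embedding.nonempty_of_card_le (by simp; omega)
  obtain ⟨f⟩ := this
  refine ⟨⟨(fun i => f (Fin.castAdd m i), fun i => f (Fin.natAdd m i)), ?_⟩⟩
  have h := (mt_nodup f).2 f.injective
  have h2 : mt (fun i => f i) = mt (fun i => f (Fin.castAdd m i)) + mt (fun i => f (Fin.natAdd m i)) := by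
    rw [← mt_append]; congr 1; exact (Fin.append_castAdd_natAdd (f := fun i => f i)).symm
  rw [← h2]; exact h

def tk (i : TaskI V m) : Multiset V := mt i.1.1 + mt i.1.2

lemma pair_up : ∀ (j : ℕ) (l : List (Fin m → V)), l.length = 2 * j → (vs l).Nodup →
    ∃ L : List (TaskI V m), (L.map tk).sum = vs l ∧ L.length = j := by
  intro j
  induction j with
  | zero =>
    intro l hl _
    obtain rfl : l = [] := List.length_eq_zero_iff.1 (by simpa using hl)
    exact ⟨[], by simp, rfl⟩
  | succ j ih =>
    intro l hl hn
    match l, hl, hn with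
    | x :: y :: l, hl, hn =>
      rw [vs_cons, vs_cons, ← add_assoc] at hn
      obtain ⟨L, h1, h2⟩ := ih l (by simp at hl; omega) (Multiset.nodup_add.1 hn).2.1
      refine ⟨⟨(x, y), (Multiset.nodup_add.1 hn).1⟩ :: L, ?_, by simp [h2]⟩
      simp [h1, tk, add_assoc]

lemma drop_one (b N : ℕ) (Ed : Multiset V → Prop) (F : List (List (Fin m → V))) (hF : CovOK (b+1) Ed F) (hne : F ≠ []) :
    ∃ F1 : List (List (Fin m → V)), F1.length = F.length ∧ (∀ Q ∈ F1, Q ≠ [] ∧ List.IsChain (Adj Ed) Q) ∧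
      (F1.map vs).sum ≤ (F.map vs).sum ∧ (F.map vs).sum.card ≤ (F1.map vs).sum.card + m ∧ Even (N + (F1.map List.length).sum) := by
  have hQne : ∀ Q ∈ F, Q ≠ [] ∧ List.IsChain (Adj Ed) Q := by
    intro Q hQ
    refine ⟨?_, (hF Q hQ).1⟩
    rintro rfl
    have := (hF _ hQ).2
    simp at this
  by_cases he : Even (N + (F.map List.length).sum)
  · exact ⟨F, rfl, hQne, le_rfl, by omega, he⟩
  · obtain ⟨Q, F', rfl⟩ := List.exists_cons_of_ne_nil hne
    have hQ := hF Q (by simp)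
    match Q, hQ, hF, hQne, he with
    | x :: y :: Q, hQ, hF, hQne, he =>
      refine ⟨(y :: Q) :: F', by simp, ?_, ?_, ?_, ?_⟩
      · intro R hR
        rcases List.mem_cons.1 hR with rfl | h
        · exact ⟨by simp, List.IsChain.tail hQ.1⟩
        · exact hQne R (by simp [h])
      · simp [add_assoc]
      · simp; omega
      · simp at he ⊢
        rw [Nat.even_iff]; rw [Nat.odd_iff] at he; omega

end

lemma N_final (m' : ℕ) (hm : 2 ≤ m') (c η : ℝ) (hc : 0 < c) (hη : 0 < η) :
    ∃ n0 : ℕ, ∀ (V : Type) [Fintype V], n0 ≤ Fintype.card V → (m'+1) ∣ Fintype.card V →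
    ∀ (Ed : Multiset V → Prop), (∀ s, Ed s → s.Nodup) →
    (∀ s : Multiset V, s.Nodup → s.card = 2 * m' + 1 → (45/100 : ℝ) ≤ pr (fun v => Ed (s + {v}))) →
    HypN (m'+1) Ed c η → HamCyc (m'+1) Ed := by
  obtain ⟨m, hmm⟩ : ∃ m, m = m' + 1 := ⟨_, rfl⟩
  obtain ⟨κ, hκ, habs⟩ := N_abs (m := m) c η hc hη
  obtain ⟨C, hC⟩ : ∃ C : ℝ, C = η * (c * (c * (c * c))) := ⟨_, rfl⟩
  have hC0 : 0 < C := by rw [hC]; positivity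
  obtain ⟨c0, hc0⟩ : ∃ C0 : ℝ, C0 = min C κ := ⟨_, rfl⟩
  have hc00 : 0 < c0 := by rw [hc0]; positivity
  obtain ⟨cq, hcq⟩ : ∃ cq : ℕ, cq = ((m + (m+m)) + (m + (m + (m + m)))) := ⟨_, rfl⟩
  have hcq0 : 0 < cq := by omega
  have hcqr : (0:ℝ) < cq := by exact_mod_cast hcq0
  obtain ⟨γ1, hγ1⟩ : ∃ x : ℝ, x = min (1/400) (c0 / (8 * cq)) := ⟨_, rfl⟩
  have hγ10 : 0 < γ1 := by rw [hγ1]; positivity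
  obtain ⟨β1, hβ1, n1, hAL⟩ := AL m 82 cq (2*m) (by omega) (by omega) c0 γ1 hc00 hγ10
  obtain ⟨γ2, hγ2⟩ : ∃ x : ℝ, x = min (1/400) (β1/4) / cq := ⟨_, rfl⟩
  have hγ20 : 0 < γ2 := by rw [hγ2]; positivity
  obtain ⟨β2, hβ2, n2, hSL⟩ := SL cq (2*m) hcq0 c0 γ2 hc00 hγ20
  obtain ⟨b, hb⟩ : ∃ b : ℕ, b = ⌈(2 * cq / β2 : ℝ)⌉₊ := ⟨_, rfl⟩
  have hb1 : (2 * cq / β2 : ℝ) ≤ b := by rw [hb]; exact Nat.le_ceil _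
  rw [div_le_iff₀ hβ2] at hb1
  obtain ⟨γ3, hγ3⟩ : ∃ x : ℝ, x = min (1/2) (β1/4) := ⟨_, rfl⟩
  have hγ30 : 0 < γ3 := by rw [hγ3]; positivity
  obtain ⟨n3, hCov⟩ := Cov m' (b+1) hm γ3 hγ30 (by rw [hγ3]; exact (min_le_left _ _).trans (by norm_num))
  refine ⟨n1 + n2 + n3 + ⌈(8 * cq / β2 : ℝ)⌉₊ + ⌈(4 * m / β1 : ℝ)⌉₊ + 2 * m + 1, ?_⟩
  intro V _ hV hdvd Ed hEd hcod hN
  obtain ⟨n, hn⟩ : ∃ n, n = Fintype.card V := ⟨_, rfl⟩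
  rw [← hn] at hV hdvd
  rw [← hmm] at hdvd hN ⊢
  have hn4 : (8 * cq / β2 : ℝ) ≤ n := Nat.ceil_le.1 (by omega)
  have hn5 : (4 * m / β1 : ℝ) ≤ n := Nat.ceil_le.1 (by omega)
  rw [div_le_iff₀ hβ2] at hn4
  rw [div_le_iff₀ hβ1] at hn5
  have hn0 : (0:ℝ) < n := by have : 0 < n := by omega
                             exact_mod_cast this
  obtain ⟨t, ht⟩ := hdvd
  have hconn : ∀ y x, Inj y → Inj x → c0 ≤ cnt V cq (ConnP (m := m) (Adj Ed) y x) := by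
    intro y x hy hx
    rw [hcq]
    refine le_trans ?_ (N_conn hc.le hN y x hy hx)
    rw [hc0, hC]; exact min_le_left _ _
  haveI := nonempty_TaskI (V := V) (m := m) (by omega)
  obtain ⟨P, hPg, hPn, hPc, hPabs⟩ := hAL V (by omega) (Adj Ed) Inj Inj hconn (TaskI V m) card_TaskI tk
    (fun i => le_trans (by rw [hc0]; exact min_le_right _ _)
      (habs V Ed hEd hN i.1.1 i.1.2 (Multiset.nodup_add.1 i.2).1 (Multiset.nodup_add.1 i.2).2.1)) 0 (by simp) (by simp; positivity)
  rw [add_zero] at hPn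
  rw [← hn] at hPc hPabs
  have hPc1 : ((vs P).card : ℝ) ≤ 1/400 * n := hPc.trans (by gcongr; rw [hγ1]; exact min_le_left _ _)
  have hPc2 : ((vs P).card : ℝ) ≤ c0 / (8 * cq) * n := hPc.trans (by gcongr; rw [hγ1]; exact min_le_right _ _)
  -- reservoir
  haveI : Nonempty {z : (Fin m → V) × (Fin m → V) // Inj z.1 ∧ Inj z.2} := by
    obtain ⟨i⟩ := nonempty_TaskI (V := V) (m := m) (by omega)
    exact ⟨⟨i.1, (Multiset.nodup_add.1 i.2).1, (Multiset.nodup_add.1 i.2).2.1⟩⟩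
  obtain ⟨Rs, hR1, hR2, hR3, hR4⟩ := hSL V (by omega) {z : (Fin m → V) × (Fin m → V) // Inj z.1 ∧ Inj z.2}
    ((Fintype.card_subtype_le _).trans (by simp [two_mul, pow_add])) (fun z f => ConnP (Adj Ed) z.1.1 z.1.2 (mt f))
    (fun z => hconn _ _ z.2.1 z.2.2) (vs P) hPn (by
      rw [← hn]
      calc (cq : ℝ) * (vs P).card ≤ cq * (c0 / (8 * cq) * n) := by gcongr
        _ = c0 / 8 * n := by field_simp)
  rw [← hn] at hR1 hR4
  have hRc : ((vs Rs).card : ℝ) ≤ min (1/400) (β1/4) * n := by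
    rw [card_vs]
    push_cast
    calc (cq : ℝ) * Rs.length ≤ cq * (γ2 * n) := by gcongr
      _ = min (1/400) (β1/4) * n := by rw [hγ2]; field_simp
  have hRc1 : ((vs Rs).card : ℝ) ≤ 1/400 * n := hRc.trans (by gcongr; exact min_le_left _ _)
  have hRc2 : ((vs Rs).card : ℝ) ≤ β1/4 * n := hRc.trans (by gcongr; exact min_le_right _ _)
  subst hmm
  -- covering
  obtain ⟨F, hF1, hF2, hF3⟩ := hCov V (by omega) Ed hEd hcod (vs Rs + vs P) hR2 (by
    rw [← hn, Multiset.card_add]; push_cast; linarith)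
  rw [← hn] at hF3
  have hFne : F ≠ [] := by
    rintro rfl
    have : γ3 * n ≤ 1/2 * n := by gcongr; rw [hγ3]; exact min_le_left _ _
    simp at hF3
    linarith
  have hFlen : ((2 * (b+1) + 1 : ℝ)) * F.length ≤ n := by
    have h1 := nodup_card_le _ (Multiset.nodup_add.1 hF2).1
    rw [card_sum_vs F (fun Q hQ => (hF1 Q hQ).2), ← hn] at h1
    have h2 : (2 * (b+1) + 1) * F.length ≤ n := by
      refine le_trans ?_ h1
      calc (2 * (b+1) + 1) * F.length = F.length * ((2 * (b+1) + 1) * 1) := by ring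
        _ ≤ _ := by gcongr; omega
    exact_mod_cast h2
  obtain ⟨F1, hF1l, hF1c, hF1le, hF1card, hF1e⟩ := drop_one b (t + P.length + 7 * (F.length + 1)) Ed F hF1 hFne
  -- supply
  have hsup : ∀ y x : Fin (m'+1) → V, Inj y → Inj x → ∀ X : Multiset V, X.Nodup → X.card ≤ cq * (F.length + 1) →
      ∃ s : Multiset V, s.card = cq ∧ ConnP (Adj Ed) y x s ∧ (∀ v ∈ s, v ∈ vs Rs) ∧ (s + X).Nodup := by
    intro y x hy hx X hX hXc
    by_contra! hcon
    have h1 := hR4 ⟨(y, x), hy, hx⟩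
    have h2 := countP_hit Rs (Multiset.nodup_add.1 hR2).1 (fun f => ConnP (Adj Ed) y x (mt f)) X (by
      intro f hf hcf
      by_contra! hno
      refine hcon (mt f) (by simp) hcf (fun v hv => Multiset.mem_of_le (mt_le_vs hf) hv) ?_
      rw [Multiset.nodup_add]
      refine ⟨Multiset.nodup_of_le (mt_le_vs hf) (Multiset.nodup_add.1 hR2).1, hX, ?_⟩
      rw [Multiset.disjoint_left]
      intro v hv hv2
      exact hno v hv2 hv)
    have h3 : (X.filter (fun v => v ∈ vs Rs)).card ≤ X.card := Multiset.card_le_card (Multiset.filter_le _ _)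
    have h4 : (Rs.countP (fun f => decide (ConnP (Adj Ed) y x (mt f))) : ℝ) ≤ cq * (F.length + 1) := by
      exact_mod_cast h2.trans (h3.trans hXc)
    have h5 : β2 * n ≤ cq * (F.length + 1) := h1.trans h4
    have h6 : 2 * ((cq:ℝ) * F.length) ≤ β2 * n := by
      calc 2 * ((cq:ℝ) * F.length) = 2 * cq * F.length := by ring
        _ ≤ (b * β2) * F.length := by gcongr
        _ = β2 * (b * F.length) := by ring
        _ ≤ β2 * n := by
          gcongr
          refine le_trans ?_ hFlen
          gcongr; linarith
    linarith
  have hDn : ((F.map vs).sum + (vs Rs + vs P)).Nodup := hF2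
  have hF1n : ((F1.map vs).sum + (vs Rs + vs P)).Nodup := Multiset.nodup_of_le (by gcongr) hF2
  obtain ⟨P1, X, hP1g, hP1v, hXn, hXc, hXG, hrep⟩ := join (A := Adj Ed) (St := Inj) (En := Inj) cq (cq * (F.length + 1)) (fun v => v ∈ vs Rs) hsup
    (P :: F1) (by simp) (by
      intro Q hQ
      rcases List.mem_cons.1 hQ with rfl | h
      · exact hPg
      · exact good_of_chain (hF1c Q h).2 (hF1c Q h).1 (Multiset.nodup_of_le (vs_le_sum h) (Multiset.nodup_add.1 hF1n).1))
    (by simp [hF1l])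
  rw [List.length_cons, hF1l] at hXc
  obtain ⟨hP1c, ⟨x0, hx0, sx0⟩, ⟨y0, hy0, ey0⟩⟩ := hP1g
  obtain ⟨s, hs1, ⟨K, hK, hKs⟩, hs3, hs4⟩ := hsup y0 x0 ey0 sx0 X hXn (by omega)
  have hsXle : s + X ≤ vs Rs := (Multiset.le_iff_subset hs4).2 (by
    intro v hv
    rcases Multiset.mem_add.1 hv with h | h
    · exact hs3 v h
    · exact hXG v h)
  obtain ⟨D, hD⟩ : ∃ D, D = (F1.map vs).sum + ((s + X) + vs P) := ⟨_, rfl⟩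
  have hDle : D ≤ (F1.map vs).sum + (vs Rs + vs P) := by rw [hD]; gcongr
  have hDn : D.Nodup := Multiset.nodup_of_le hDle hF1n
  have hDu : D ≤ (Finset.univ : Finset V).val := (Multiset.le_iff_subset hDn).2 (fun v _ => Finset.mem_univ v)
  obtain ⟨Lf, hLf⟩ := Multiset.le_iff_exists_add.1 hDu
  have hLfn : Lf.Nodup := by
    have := (Finset.univ : Finset V).nodup
    rw [hLf] at this
    exact (Multiset.nodup_add.1 this).2.1
  have hcardn : n = D.card + Lf.card := by
    rw [← Multiset.card_add, ← hLf, hn]; rfl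
  have hDc : D.card = (m'+1) * ((F1.map List.length).sum + 7 * (F.length + 1) + P.length) := by
    rw [hD, Multiset.card_add, Multiset.card_add, Multiset.card_add, hs1, add_comm cq, hXc, card_sum_vs2, card_vs, hcq]
    ring
  have hdv : (m'+1) ∣ Lf.card := (Nat.dvd_add_right (Dvd.intro _ hDc.symm)).1 (hcardn ▸ Dvd.intro _ ht.symm)
  obtain ⟨j, hj⟩ := hdv
  have htj : t = (F1.map List.length).sum + 7 * (F.length + 1) + P.length + j := by
    rw [hDc, hj, ht, ← mul_add] at hcardn
    exact Nat.eq_of_mul_eq_mul_left (by omega) hcardn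
  have hje : ∃ j2, j = 2 * j2 := by
    rw [Nat.even_iff] at hF1e
    exact ⟨j / 2, by omega⟩
  obtain ⟨j2, hj2⟩ := hje
  obtain ⟨f, hf⟩ := exists_mt (q := j * (m'+1)) Lf (by rw [hj]; ring)
  obtain ⟨L, hL1, hL2⟩ := pair_up j2 (chop j (m'+1) f) (by simp [chop, hj2]) (by rw [vs_chop, hf]; exact hLfn)
  rw [vs_chop, hf] at hL1
  have hLlen : (L.length : ℝ) ≤ β1 * n := by
    have h1 : (L.length : ℝ) ≤ Lf.card := by
      have : L.length ≤ Lf.card := by rw [hL2, hj, hj2]; nlinarith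
      exact_mod_cast this
    have h2 : (Lf.card : ℝ) = n - D.card := by rw [hcardn]; push_cast; ring
    have h3 : ((F1.map vs).sum.card + (vs P).card : ℝ) ≤ D.card := by
      rw [hD, Multiset.card_add, Multiset.card_add]; push_cast
      have : (0:ℝ) ≤ (s + X).card := by positivity
      linarith
    have h4 : ((F.map vs).sum.card : ℝ) ≤ (F1.map vs).sum.card + (m'+1 : ℕ) := by exact_mod_cast hF1card
    have h5 : γ3 * n ≤ β1/4 * n := by gcongr; rw [hγ3]; exact min_le_right _ _
    rw [Multiset.card_add, Multiset.card_add] at hF3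
    push_cast at hF3 h4 hn5
    linarith
  obtain ⟨P', hP'1, hP'2⟩ := hPabs L hLlen
  obtain ⟨P1', hP1'1, hP1'2⟩ := hrep (P' :: F1) (List.Forall₂.cons hP'1 (List.forall₂_same.2 (fun Q hQ => Rep.refl (hF1c Q hQ).2)))
  refine ⟨P1' ++ K, x0, head?_glue (hP1'1.2.1.trans hx0), ?_, ?_⟩
  · rw [List.append_assoc]
    exact glue hP1'1.1 (hP1'1.2.2.trans hy0) (by simp) rfl hK
  · rw [vs_append, hP1'2, List.map_cons, List.sum_cons, hP'2, hL1, hLf, hD, hKs]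
    abel

end HC
end

section
open Finset
open scoped Classical
namespace HC

lemma pr_incl_excl {α : Type*} [Fintype α] (p q : α → Prop) :
    pr (fun a => p a ∨ q a) + pr (fun a => p a ∧ q a) = pr p + pr q := by
  unfold pr
  rw [← add_div, ← add_div]
  congr 1
  have := Finset.card_union_add_card_inter (Finset.univ.filter p) (Finset.univ.filter q)
  rw [← Finset.filter_or, ← Finset.filter_and] at this
  exact_mod_cast (by convert this)

lemma pr_split {α : Type*} [Fintype α] (p q : α → Prop) :
    pr (fun a => p a ∧ ¬ q a) = pr p - pr (fun a => q a ∧ p a) := by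
  have := pr_incl_excl (fun a => p a ∧ ¬ q a) (fun a => q a ∧ p a)
  have h1 : pr (fun a => (p a ∧ ¬ q a) ∨ (q a ∧ p a)) = pr p := pr_congr fun a => by tauto
  have h2 : pr (fun a => (p a ∧ ¬ q a) ∧ (q a ∧ p a)) = 0 := by
    rw [pr_congr (q := fun _ => False) (fun z => by tauto), pr_false]
  linarith

lemma pr_inter_ge {α : Type*} [Fintype α] (p q r : α → Prop) :
    pr (fun a => p a ∧ r a) + pr (fun a => q a ∧ r a) - pr r ≤ pr (fun a => p a ∧ q a) := by
  have h := pr_incl_excl (fun a => p a ∧ r a) (fun a => q a ∧ r a)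
  have h1 : pr (fun a => (p a ∧ r a) ∨ (q a ∧ r a)) ≤ pr r := pr_mono fun a => by tauto
  have h2 : pr (fun a => (p a ∧ r a) ∧ (q a ∧ r a)) ≤ pr (fun a => p a ∧ q a) := pr_mono fun a => by tauto
  linarith

section
variable {Ω : Type} [Fintype Ω]

def Nr (A : Ω → Ω → Prop) (c : ℝ) (x y : Ω) : Prop := c ≤ pr (fun z => A x z ∧ A z y)

lemma nr3 {A : Ω → Ω → Prop} {c : ℝ} {x y : Ω} {D1 D2 D3 : Ω → Prop} {η : ℝ} (hη : 0 ≤ η)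
    (h1 : η ≤ pr D1) (h2 : ∀ a1 a3, D1 a1 → D3 a3 → η ≤ pr (fun a2 => D2 a2 ∧ Nr A c a1 a2 ∧ Nr A c a2 a3)) (h3 : η ≤ pr D3)
    (hx : ∀ a, D1 a → Nr A c x a) (hy : ∀ a, D3 a → Nr A c a y) :
    η * (η * η) ≤ pr (fun a : Ω × (Ω × Ω) => Nr A c x a.1 ∧ Nr A c a.1 a.2.1 ∧ Nr A c a.2.1 a.2.2 ∧ Nr A c a.2.2 y) := by
  have h := pr_prod_ge (p := D1) (q := fun a1 (b : Ω × Ω) => Nr A c a1 b.1 ∧ Nr A c b.1 b.2 ∧ Nr A c b.2 y) (b := η * η) (by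
    intro a1 ha1
    have := pr_prod_ge (p := D3) (q := fun a3 a2 => D2 a2 ∧ Nr A c a1 a2 ∧ Nr A c a2 a3) (b := η) (fun a3 ha3 => h2 a1 a3 ha1 ha3)
    rw [pr_swap (fun (a2 a3 : Ω) => Nr A c a1 a2 ∧ Nr A c a2 a3 ∧ Nr A c a3 y)]
    refine le_trans (mul_le_mul_of_nonneg_right h3 hη) (this.trans (pr_mono ?_))
    rintro ⟨a3, a2⟩ ⟨h4, _, h5, h6⟩
    exact ⟨h5, h6, hy _ h4⟩)
  refine le_trans (mul_le_mul_of_nonneg_right h1 (by positivity)) (h.trans (pr_mono ?_))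
  rintro ⟨a, b⟩ ⟨h4, h5⟩
  exact ⟨hx _ h4, h5⟩

lemma dich (δ : ℝ) (hδ : 0 < δ) : ∃ c η : ℝ, 0 < c ∧ 0 < η ∧ ∀ (Ω : Type) [Fintype Ω] [Nonempty Ω] (A : Ω → Ω → Prop) (I : Ω → Prop),
    (∀ x y, A x y → A y x) → pr (fun x => ¬ I x) ≤ c → (∀ x, I x → 1/2 - c ≤ pr (A x)) →
    (∀ x y, I x → I y → η ≤ pr (fun a : Ω × (Ω × Ω) => Nr A c x a.1 ∧ Nr A c a.1 a.2.1 ∧ Nr A c a.2.1 a.2.2 ∧ Nr A c a.2.2 y)) ∨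
    ∃ χ ψ : Ω → Prop, pr (fun z : Ω × Ω => ¬ (A z.1 z.2 ↔ (χ z.1 ↔ ψ z.2))) ≤ δ ∧ pr ψ ≤ 1/2 + δ ∧ 1/2 - δ ≤ pr ψ := by
  obtain ⟨c, hc⟩ : ∃ c, c = min δ 1 / 1000 := ⟨_, rfl⟩
  have hc0 : 0 < c := by rw [hc]; positivity
  have hc1 : c ≤ 1/1000 := by rw [hc]; have := min_le_right δ 1; linarith
  have hcδ : 1000 * c ≤ δ := by rw [hc]; have := min_le_left δ 1; linarith
  refine ⟨c, c * (c * c), hc0, by positivity, ?_⟩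
  intro Ω _ _ A I hs hI hd
  have nrs : ∀ x y, Nr A c x y → Nr A c y x := by
    intro x y h
    refine le_trans h (pr_mono fun z hz => ⟨hs _ _ hz.2, hs _ _ hz.1⟩)
  by_cases hcase : ∀ u, I u → pr (fun w => ¬ Nr A c u w) < 1/4
  · left
    intro x y hx hy
    have key : ∀ u, I u → 3/4 ≤ pr (fun w => Nr A c u w) := by
      intro u hu
      have h1 := hcase u hu
      rw [pr_not] at h1; linarith
    have key2 : ∀ u, I u → c ≤ pr (fun w => Nr A c u w ∧ I w) := by
      intro u hu
      have h1 := key u hu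
      have h2 := pr_and_not_ge (fun w => Nr A c u w) (fun w => ¬ I w)
      simp only [not_not] at h2
      linarith
    refine nr3 (D1 := fun a => Nr A c x a ∧ I a) (D3 := fun a => Nr A c y a ∧ I a) (D2 := fun _ => True) hc0.le (key2 x hx) ?_ (key2 y hy)
      (fun a h => h.1) (fun a h => nrs _ _ h.1)
    intro a1 a3 h1 h3
    have h4 := pr_and_ge (fun w => Nr A c a1 w) (fun w => Nr A c a3 w)
    have h5 := key a1 h1.2
    have h6 := key a3 h3.2
    refine le_trans ?_ (pr_mono (p := fun w => Nr A c a1 w ∧ Nr A c a3 w) fun w hw => ⟨trivial, hw.1, nrs _ _ hw.2⟩)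
    linarith
  · push_neg at hcase
    obtain ⟨u, hu, hu4⟩ := hcase
    have hB : 1/5 ≤ pr (fun w => ¬ Nr A c u w ∧ I w) := by
      have h2 := pr_and_not_ge (fun w => ¬ Nr A c u w) (fun w => ¬ I w)
      simp only [not_not] at h2
      linarith
    obtain ⟨b, hbu, hb⟩ := exists_of_pr_pos (lt_of_lt_of_le (by norm_num) hB)
    obtain ⟨fu, hfu⟩ : ∃ fu : Ω → ℝ, ∀ w, fu w = pr (fun z => A w z ∧ A u z) := ⟨_, fun _ => rfl⟩
    obtain ⟨fb, hfb⟩ : ∃ fb : Ω → ℝ, ∀ w, fb w = pr (fun z => A w z ∧ A b z) := ⟨_, fun _ => rfl⟩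
    have hnu : ∀ w, Nr A c u w ↔ c ≤ fu w := by
      intro w
      rw [hfu]
      unfold Nr
      rw [pr_congr (q := fun z => A w z ∧ A u z)]
      intro z; exact ⟨fun h => ⟨hs _ _ h.2, h.1⟩, fun h => ⟨h.2, hs _ _ h.1⟩⟩
    have hov : pr (fun z => A u z ∧ A b z) < c := by
      have := hbu
      unfold Nr at this
      push_neg at this
      refine lt_of_le_of_lt (pr_mono fun z hz => ⟨hz.1, hs _ _ hz.2⟩) this
    have hdu := hd u hu
    have hdb := hd b hb
    have hie := pr_incl_excl (A u) (A b)
    have hor1 := pr_le_one (fun z => A u z ∨ A b z)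
    have hu2 : pr (A u) ≤ 1/2 + 2*c := by linarith
    have hb2 : pr (A b) ≤ 1/2 + 2*c := by linarith
    have hout : pr (fun z => ¬ (A u z ∨ A b z)) ≤ 3*c := by
      rw [pr_not]; linarith
    have hsum : ∀ w, I w → 1/2 - 4*c ≤ fu w + fb w := by
      intro w hw
      have h1 := hd w hw
      have h2 : pr (A w) ≤ pr (fun z => ((A w z ∧ A u z) ∨ (A w z ∧ A b z)) ∨ ¬ (A u z ∨ A b z)) := pr_mono fun z => by tauto
      have h3 := pr_or_le (fun z => (A w z ∧ A u z) ∨ (A w z ∧ A b z)) (fun z => ¬ (A u z ∨ A b z))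
      have h4 := pr_or_le (fun z => A w z ∧ A u z) (fun z => A w z ∧ A b z)
      rw [hfu, hfb]; linarith
    have nru : ∀ w1 w2, 1/2 + 3*c ≤ fu w1 + fu w2 → Nr A c w1 w2 := by
      intro w1 w2 h
      have h1 := pr_inter_ge (A w1) (A w2) (A u)
      rw [hfu, hfu] at h
      refine le_trans ?_ (pr_mono (p := fun z => A w1 z ∧ A w2 z) fun z hz => ⟨hz.1, hs _ _ hz.2⟩)
      linarith
    have nrb : ∀ w1 w2, 1/2 + 3*c ≤ fb w1 + fb w2 → Nr A c w1 w2 := by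
      intro w1 w2 h
      have h1 := pr_inter_ge (A w1) (A w2) (A b)
      rw [hfb, hfb] at h
      refine le_trans ?_ (pr_mono (p := fun z => A w1 z ∧ A w2 z) fun z hz => ⟨hz.1, hs _ _ hz.2⟩)
      linarith
    by_cases hC : c ≤ pr (fun w => I w ∧ 100 * c ≤ fu w ∧ 100 * c ≤ fb w)
    · left
      intro x y hx hy
      have hBf : ∀ w, (¬ Nr A c u w ∧ I w) → 1/2 - 5*c ≤ fb w := by
        intro w hw
        have h1 := hsum w hw.2
        have h2 := hw.1
        rw [hnu] at h2; push_neg at h2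
        linarith
      have key : ∀ x, I x → ∃ D : Ω → Prop, c ≤ pr D ∧ (∀ a, D a → Nr A c x a) ∧ ∀ a, D a → 10 * c ≤ fb a := by
        intro x hx
        by_cases h : 10 * c ≤ fb x
        · refine ⟨fun w => ¬ Nr A c u w ∧ I w, by linarith, ?_, ?_⟩
          · intro a ha
            have := hBf a ha
            apply nrb; linarith
          · intro a ha
            have := hBf a ha
            linarith
        · push_neg at h
          refine ⟨_, hC, ?_, ?_⟩
          · intro a ha
            have := hsum x hx
            apply nru; linarith [ha.2.1]
          · intro a ha
            linarith [ha.2.2]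
      obtain ⟨D1, h11, h12, h13⟩ := key x hx
      obtain ⟨D3, h31, h32, h33⟩ := key y hy
      refine nr3 (D1 := D1) (D3 := D3) (D2 := fun w => ¬ Nr A c u w ∧ I w) hc0.le h11 ?_ h31 h12 (fun a ha => nrs _ _ (h32 a ha))
      intro a1 a3 h1 h3
      refine le_trans (le_trans (by linarith) hB) (pr_mono ?_)
      intro w hw
      have := hBf w hw
      refine ⟨hw, nrb _ _ ?_, nrb _ _ ?_⟩
      · linarith [h13 a1 h1]
      · linarith [h33 a3 h3]
    · right
      push_neg at hC
      refine ⟨fun w => fb w < 100 * c, A u, ?_, by linarith, by linarith⟩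
      have hT : ∀ w, (I w ∧ ¬ (100 * c ≤ fu w ∧ 100 * c ≤ fb w)) → pr (fun z => ¬ (A w z ↔ (fb w < 100 * c ↔ A u z))) ≤ 300 * c := by
        intro w hw
        have hsw := hsum w hw.1
        by_cases h : fb w < 100 * c
        · have e1 : pr (fun z => ¬ (A w z ↔ (fb w < 100 * c ↔ A u z))) ≤ pr (fun z => ((A w z ∧ A b z) ∨ ¬ (A u z ∨ A b z)) ∨ (A u z ∧ ¬ (A w z ∧ A u z))) :=
            pr_mono fun z => by simp only [h, true_iff]; tauto
          have e2 := pr_or_le (fun z => (A w z ∧ A b z) ∨ ¬ (A u z ∨ A b z)) (fun z => A u z ∧ ¬ (A w z ∧ A u z))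
          have e3 := pr_or_le (fun z => A w z ∧ A b z) (fun z => ¬ (A u z ∨ A b z))
          have e4 : pr (fun z => A u z ∧ ¬ (A w z ∧ A u z)) = pr (A u) - fu w := by
            rw [pr_split (A u) (fun z => A w z ∧ A u z), hfu]
            congr 1; exact pr_congr fun z => by tauto
          rw [← hfb] at e3
          linarith
        · have hfw : fu w < 100 * c := by
            by_contra! h2
            exact hw.2 ⟨h2, not_lt.1 h⟩
          have e1 : pr (fun z => ¬ (A w z ↔ (fb w < 100 * c ↔ A u z))) ≤ pr (fun z => ((A w z ∧ A u z) ∨ ¬ (A u z ∨ A b z)) ∨ (A b z ∧ ¬ (A w z ∧ A b z))) :=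
            pr_mono fun z => by simp only [h, false_iff]; tauto
          have e2 := pr_or_le (fun z => (A w z ∧ A u z) ∨ ¬ (A u z ∨ A b z)) (fun z => A b z ∧ ¬ (A w z ∧ A b z))
          have e3 := pr_or_le (fun z => A w z ∧ A u z) (fun z => ¬ (A u z ∨ A b z))
          have e4 : pr (fun z => A b z ∧ ¬ (A w z ∧ A b z)) = pr (A b) - fb w := by
            rw [pr_split (A b) (fun z => A w z ∧ A b z), hfb]
            congr 1; exact pr_congr fun z => by tauto
          rw [← hfu] at e3
          linarith
      have h1 := pr_prod_le (α := Ω) (q := fun w z => (I w ∧ ¬ (100 * c ≤ fu w ∧ 100 * c ≤ fb w)) ∧ ¬ (A w z ↔ (fb w < 100 * c ↔ A u z))) (b := 300 * c) (by linarith) (by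
        intro w
        by_cases hw : I w ∧ ¬ (100 * c ≤ fu w ∧ 100 * c ≤ fb w)
        · exact (pr_mono fun z hz => hz.2).trans (hT w hw)
        · rw [pr_congr (q := fun _ => False) (fun z => by tauto), pr_false]; linarith)
      have h2 := pr_or_le (fun z : Ω × Ω => (I z.1 ∧ ¬ (100 * c ≤ fu z.1 ∧ 100 * c ≤ fb z.1)) ∧ ¬ (A z.1 z.2 ↔ (fb z.1 < 100 * c ↔ A u z.2)))
        (fun z : Ω × Ω => ¬ I z.1 ∨ (I z.1 ∧ 100 * c ≤ fu z.1 ∧ 100 * c ≤ fb z.1))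
      have h3 : pr (fun z : Ω × Ω => ¬ I z.1 ∨ (I z.1 ∧ 100 * c ≤ fu z.1 ∧ 100 * c ≤ fb z.1)) ≤ 2 * c := by
        rw [pr_fst (β := Ω) (fun w => ¬ I w ∨ (I w ∧ 100 * c ≤ fu w ∧ 100 * c ≤ fb w))]
        have := pr_or_le (fun w => ¬ I w) (fun w => I w ∧ 100 * c ≤ fu w ∧ 100 * c ≤ fb w)
        linarith
      refine le_trans (pr_mono ?_) (h2.trans (by linarith))
      intro z hz
      tauto
end
end HC
end

section
open Finset
open scoped Classical
namespace HC

noncomputable def cl {V : Type} (A : V → Prop) (s : Multiset V) : ZMod 2 := (s.countP A : ZMod 2)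

section
variable {V : Type} {A : V → Prop}
@[simp] lemma cl_add (s t : Multiset V) : cl A (s + t) = cl A s + cl A t := by
  unfold cl; rw [Multiset.countP_add]; push_cast; rfl
@[simp] lemma cl_zero : cl A (0 : Multiset V) = 0 := by simp [cl]
lemma cl_singleton (v : V) : cl A {v} = if A v then 1 else 0 := by
  unfold cl
  rw [← Multiset.cons_zero, Multiset.countP_cons]
  split_ifs <;> simp
lemma cl_mt [Fintype V] {ι : Type} [Fintype ι] (g : ι → V) : cl A (mt g) = ∑ i, if A (g i) then 1 else 0 := by
  unfold cl mt
  rw [Multiset.countP_map, Finset.sum_boole]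
  rfl
lemma zmod2 (a : ZMod 2) : a = 0 ∨ a = 1 := by revert a; decide
lemma zmod2_add_self (a : ZMod 2) : a + a = 0 := by revert a; decide
lemma zmod2_ite (a : ZMod 2) : a = if a = 1 then 1 else 0 := by revert a; decide
end

lemma exists_le_avg {α β : Type} [Fintype α] [Fintype β] [Nonempty α] (q : α → β → Prop) :
    ∃ a, pr (q a) ≤ pr (fun z : α × β => q z.1 z.2) := by
  by_contra! h
  have h1 : ∑ a : α, pr (fun z : α × β => q z.1 z.2) < ∑ a, pr (q a) :=
    Finset.sum_lt_sum_of_nonempty Finset.univ_nonempty (fun a _ => h a)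
  have h2 := pr_prod q
  have h3 : (0:ℝ) < Fintype.card α := by positivity
  rw [Finset.sum_const, h2, nsmul_eq_mul, Finset.card_univ] at h1
  rw [mul_div_cancel₀ _ h3.ne'] at h1
  exact lt_irrefl _ h1

lemma pr_marg {ι V : Type} [Fintype ι] [DecidableEq ι] [Fintype V] [Nonempty V] (i : ι) (P : V → Prop) :
    pr (fun g : ι → V => P (g i)) = pr P := by
  have h := pr_equiv (Equiv.funSplitAt i V) (fun z => P z.1)
  rw [pr_fst P] at h
  rw [← h]
  rfl

lemma pr_marg2 {ι V : Type} [Fintype ι] [DecidableEq ι] [Fintype V] [Nonempty V] (i j : ι) (hij : j ≠ i) (P : V → V → Prop) :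
    pr (fun g : ι → V => P (g i) (g j)) = pr (fun z : V × V => P z.1 z.2) := by
  have h := pr_equiv (Equiv.funSplitAt i V) (fun z => P z.1 (z.2 ⟨j, hij⟩))
  rw [pr_prod (fun (v : V) (r : {j // j ≠ i} → V) => P v (r ⟨j, hij⟩))] at h
  rw [pr_prod P]
  have h2 : ∀ v, pr (fun (r : {j // j ≠ i} → V) => P v (r ⟨j, hij⟩)) = pr (P v) := fun v => pr_marg (⟨j, hij⟩ : {j // j ≠ i}) (P v)
  rw [Finset.sum_congr rfl (fun v _ => h2 v)] at h
  rw [← h]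
  rfl

def mix {ι V : Type} [DecidableEq ι] (S : Finset ι) (g g' : ι → V) : ι → V := fun i => if i ∈ S then g i else g' i

lemma pr_mix {ι V : Type} [Fintype ι] [DecidableEq ι] [Fintype V] [Nonempty V] (S : Finset ι) (P : (ι → V) → Prop) :
    pr (fun z : (ι → V) × (ι → V) => P (mix S z.1 z.2)) = pr P := by
  let e : (ι → V) × (ι → V) ≃ (ι → V) × (ι → V) :=
    { toFun := fun z => (mix S z.1 z.2, mix S z.2 z.1)
      invFun := fun z => (mix S z.1 z.2, mix S z.2 z.1)
      left_inv := by
        rintro ⟨g, g'⟩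
        ext i <;> simp only [mix] <;> split_ifs <;> rfl
      right_inv := by
        rintro ⟨g, g'⟩
        ext i <;> simp only [mix] <;> split_ifs <;> rfl }
  have := pr_equiv e (fun z => P z.1)
  rw [pr_fst P] at this
  exact this

lemma affine {ι : Type} [DecidableEq ι] (f : Finset ι → ZMod 2)
    (h : ∀ (S : Finset ι) (i j : ι), i ≠ j → i ∉ S → j ∉ S → f (insert i (insert j S)) + f (insert i S) + f (insert j S) + f S = 0) :
    ∀ S, f S = f ∅ + ∑ i ∈ S, (f {i} + f ∅) := by
  have h1 : ∀ S : Finset ι, ∀ i ∉ S, f (insert i S) = f S + (f {i} + f ∅) := by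
    intro S
    induction S using Finset.induction_on with
    | empty =>
      intro i _
      rw [LawfulSingleton.insert_empty_eq]
      generalize f {i} = a; generalize f ∅ = b; revert a b; decide
    | insert j T hj ih =>
      intro i hi
      simp only [Finset.mem_insert, not_or] at hi
      have h2 := h T i j hi.1 hi.2 hj
      have h3 := ih i hi.2
      revert h2 h3
      generalize f (insert i (insert j T)) = a; generalize f (insert j T) = b
      generalize f (insert i T) = c; generalize f T = d; generalize f {i} + f ∅ = e
      revert a b c d e; decide
  intro S
  induction S using Finset.induction_on with
  | empty => simp
  | insert i S hi ih => rw [h1 S i hi, Finset.sum_insert hi, ih]; ring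

lemma exists_perm (m : ℕ) (hm : 0 < m) (i j : Fin m ⊕ Fin m) (hij : i ≠ j) :
    ∃ (π : Equiv.Perm (Fin m ⊕ Fin m)) (a b : Fin m), π (Sum.inl a) = i ∧ π (Sum.inr b) = j := by
  refine ⟨(Equiv.swap (Sum.inl ⟨0,hm⟩) i) * (Equiv.swap (Sum.inr ⟨0,hm⟩) (Equiv.swap (Sum.inl ⟨0,hm⟩) i j)), ⟨0,hm⟩, ⟨0,hm⟩, ?_, ?_⟩
  · rw [Equiv.Perm.mul_apply, Equiv.swap_apply_of_ne_of_ne (a := Sum.inr (⟨0,hm⟩ : Fin m)) (x := Sum.inl (⟨0,hm⟩ : Fin m)) (by simp), Equiv.swap_apply_left]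
    intro h
    have := congrArg (Equiv.swap (Sum.inl ⟨0,hm⟩) i) h
    rw [Equiv.swap_apply_self, Equiv.swap_apply_left] at this
    exact hij this
  · rw [Equiv.Perm.mul_apply, Equiv.swap_apply_left, Equiv.swap_apply_self]

noncomputable def hv {V : Type} [Fintype V] {ι : Type} [Fintype ι] (Ed : Multiset V → Prop) (g : ι → V) : ZMod 2 := if Ed (mt g) then 1 else 0

lemma hv_perm {V : Type} [Fintype V] {ι : Type} [Fintype ι] (Ed : Multiset V → Prop) (g : ι → V) (π : Equiv.Perm ι) :
    hv Ed (fun i => g (π i)) = hv Ed g := by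
  unfold hv; rw [mt_comp_equiv]

def okp {V : Type} [Fintype V] {m : ℕ} (Ed : Multiset V → Prop) (χ ψ : (Fin m → V) → Prop) (π : Equiv.Perm (Fin m ⊕ Fin m))
    (z : Fin m ⊕ Fin m → V) : Prop := Ed (mt z) ↔ (χ (fun a => z (π (Sum.inl a))) ↔ ψ (fun a => z (π (Sum.inr a))))

lemma second_diff {V : Type} [Fintype V] {m : ℕ} (hm : 0 < m) (Ed : Multiset V → Prop) (χ ψ : (Fin m → V) → Prop)
    (g g' : Fin m ⊕ Fin m → V) (hok : ∀ π S, okp Ed χ ψ π (mix S g g')) (S : Finset (Fin m ⊕ Fin m)) (i j : Fin m ⊕ Fin m)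
    (hij : i ≠ j) : hv Ed (mix (insert i (insert j S)) g g') + hv Ed (mix (insert i S) g g') + hv Ed (mix (insert j S) g g')
      + hv Ed (mix S g g') = 0 := by
  obtain ⟨π, a, b, ha, hb⟩ := exists_perm m hm i j hij
  have hl : ∀ c, π (Sum.inl c) ≠ j := by
    intro c h; rw [← hb] at h; simpa using π.injective h
  have hr : ∀ c, π (Sum.inr c) ≠ i := by
    intro c h; rw [← ha] at h; simpa using π.injective h
  have e1 := hok π (insert i (insert j S))
  have e2 := hok π (insert i S)
  have e3 := hok π (insert j S)
  have e4 := hok π S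
  unfold okp at e1 e2 e3 e4
  have q1 : ∀ T : Finset (Fin m ⊕ Fin m), (fun a => mix (insert j T) g g' (π (Sum.inl a))) = (fun a => mix T g g' (π (Sum.inl a))) := by
    intro T; funext c; simp [mix, hl]
  have q2 : ∀ T : Finset (Fin m ⊕ Fin m), (fun a => mix (insert i T) g g' (π (Sum.inr a))) = (fun a => mix T g g' (π (Sum.inr a))) := by
    intro T; funext c; simp [mix, hr]
  rw [q2] at e1 e2
  rw [Finset.insert_comm, q1] at e1
  rw [q1] at e3
  unfold hv
  rw [Finset.insert_comm i j S]
  simp only [e1, e2, e3, e4]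
  generalize χ _ = x1; generalize χ _ = x2; generalize ψ _ = y1; generalize ψ _ = y2
  by_cases x1 <;> by_cases x2 <;> by_cases y1 <;> by_cases y2 <;> simp [*] <;> decide

noncomputable def KK (m : ℕ) : ℝ := Fintype.card (Equiv.Perm (Fin m ⊕ Fin m) × Finset (Fin m ⊕ Fin m))

lemma pr_bad {V : Type} [Fintype V] [Nonempty V] {m : ℕ} (Ed : Multiset V → Prop) (χ ψ : (Fin m → V) → Prop) (δ : ℝ)
    (hst : pr (fun z : (Fin m → V) × (Fin m → V) => ¬ (Adj Ed z.1 z.2 ↔ (χ z.1 ↔ ψ z.2))) ≤ δ) :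
    pr (fun z : (Fin m ⊕ Fin m → V) × (Fin m ⊕ Fin m → V) => ∃ π S, ¬ okp Ed χ ψ π (mix S z.1 z.2)) ≤ KK m * δ := by
  have h := pr_le_sum (Finset.univ : Finset (Equiv.Perm (Fin m ⊕ Fin m) × Finset (Fin m ⊕ Fin m)))
    (fun j (z : (Fin m ⊕ Fin m → V) × (Fin m ⊕ Fin m → V)) => ¬ okp Ed χ ψ j.1 (mix j.2 z.1 z.2))
  refine le_trans (pr_mono ?_) (h.trans ?_)
  · rintro z ⟨π, S, h⟩; exact ⟨(π, S), Finset.mem_univ _, h⟩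
  · rw [KK, ← nsmul_eq_mul, ← Finset.card_univ]
    apply Finset.sum_le_card_nsmul
    rintro ⟨π, S⟩ _
    show pr (fun z : (Fin m ⊕ Fin m → V) × (Fin m ⊕ Fin m → V) => ¬ okp Ed χ ψ π (mix S z.1 z.2)) ≤ δ
    rw [pr_mix S (fun z => ¬ okp Ed χ ψ π z)]
    have e1 := pr_equiv (Equiv.arrowCongr π.symm (Equiv.refl V)) (fun z => ¬ okp Ed χ ψ 1 z)
    have e2 := pr_equiv (Equiv.sumArrowEquivProdArrow (Fin m) (Fin m) V) (fun z => ¬ (Adj Ed z.1 z.2 ↔ (χ z.1 ↔ ψ z.2)))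
    refine le_trans (le_of_eq ?_) hst
    rw [← e2]
    refine Eq.trans ?_ (e1.trans ?_)
    · refine pr_congr fun z => ?_
      unfold okp
      have : mt ((Equiv.arrowCongr π.symm (Equiv.refl V)) z) = mt z := mt_comp_equiv π z
      rw [this]; rfl
    · refine pr_congr fun z => ?_
      unfold okp Adj
      rw [← mt_sum]
      have : Sum.elim ((Equiv.sumArrowEquivProdArrow (Fin m) (Fin m) V) z).1 ((Equiv.sumArrowEquivProdArrow (Fin m) (Fin m) V) z).2 = z := by
        ext i; cases i <;> rfl
      rw [this]; rfl

lemma parity {V : Type} [Fintype V] [Nonempty V] {m : ℕ} (hm : 0 < m) (Ed : Multiset V → Prop) (χ ψ : (Fin m → V) → Prop) (δ : ℝ)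
    (hst : pr (fun z : (Fin m → V) × (Fin m → V) => ¬ (Adj Ed z.1 z.2 ↔ (χ z.1 ↔ ψ z.2))) ≤ δ) :
    ∃ (A : V → Prop) (p : ZMod 2), pr (fun g : Fin m ⊕ Fin m → V => ¬ (Ed (mt g) ↔ cl A (mt g) = p)) ≤ (1 + 4 * m) * (KK m * δ) := by
  have hb := pr_bad Ed χ ψ δ hst
  rw [pr_swap (fun g g' => ∃ π S, ¬ okp Ed χ ψ π (mix S g g'))] at hb
  obtain ⟨g', hg'⟩ := exists_le_avg (fun (g' g : Fin m ⊕ Fin m → V) => ∃ π S, ¬ okp Ed χ ψ π (mix S g g'))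
  replace hb := hg'.trans hb
  obtain ⟨K, hK⟩ : ∃ K, K = KK m * δ := ⟨_, rfl⟩
  rw [← hK] at hb ⊢
  obtain ⟨σ, hσ⟩ : ∃ σ : Fin m ⊕ Fin m → V → ZMod 2, σ = fun i v => hv Ed (mix {i} (fun _ => v) g') + hv Ed g' := ⟨_, rfl⟩
  have h1 : pr (fun g : Fin m ⊕ Fin m → V => hv Ed g ≠ hv Ed g' + ∑ i, σ i (g i)) ≤ K := by
    refine le_trans (pr_mono ?_) hb
    intro g hg
    by_contra! hno
    apply hg
    have h2 := affine (fun S => hv Ed (mix S g g')) (fun S i j hij _ _ => second_diff hm Ed χ ψ g g' hno S i j hij) Finset.univ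
    have e1 : mix Finset.univ g g' = g := by funext i; simp [mix]
    have e2 : mix ∅ g g' = g' := by funext i; simp [mix]
    rw [e1, e2] at h2
    rw [h2, hσ]
    congr 1
    refine Finset.sum_congr rfl fun i _ => ?_
    have : mix {i} g g' = mix {i} (fun _ => g i) g' := by
      funext j; simp only [mix, Finset.mem_singleton]; split_ifs with h <;> simp [*]
    simp only [this]
  generalize hv Ed g' = C at h1
  clear hσ
  let i0 : Fin m ⊕ Fin m := Sum.inl ⟨0, hm⟩
  have hK0 : 0 ≤ K := (pr_nonneg _).trans h1
  have h2 : ∀ i, ∃ e : ZMod 2, pr (fun v => σ i v + σ i0 v ≠ e) ≤ 2 * K := by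
    intro i
    by_cases hi : i = i0
    · refine ⟨0, ?_⟩
      rw [pr_congr (q := fun _ => False), pr_false]; · linarith
      intro v; rw [hi]; simp [zmod2_add_self]
    · have e1 : pr (fun g : Fin m ⊕ Fin m → V => σ i (g i) + σ i0 (g i) ≠ σ i (g i0) + σ i0 (g i0)) ≤ 2 * K := by
        have s1 := pr_equiv (Equiv.arrowCongr (Equiv.swap i i0) (Equiv.refl V)) (fun g : Fin m ⊕ Fin m → V => hv Ed g ≠ C + ∑ i, σ i (g i))
        have s2 := pr_or_le (fun g : Fin m ⊕ Fin m → V => hv Ed g ≠ C + ∑ i, σ i (g i))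
          (fun g => hv Ed ((Equiv.arrowCongr (Equiv.swap i i0) (Equiv.refl V)) g) ≠ C + ∑ j, σ j (((Equiv.arrowCongr (Equiv.swap i i0) (Equiv.refl V)) g) j))
        rw [s1] at s2
        refine le_trans (pr_mono ?_) (s2.trans (by linarith))
        intro g hg
        by_contra! hno
        apply hg
        have t0 : ∀ j, ((Equiv.arrowCongr (Equiv.swap i i0) (Equiv.refl V)) g) j = g (Equiv.swap i i0 j) := by
          intro j; simp [Equiv.arrowCongr]
        have t1 : hv Ed ((Equiv.arrowCongr (Equiv.swap i i0) (Equiv.refl V)) g) = hv Ed g := by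
          rw [← hv_perm Ed g (Equiv.swap i i0)]; rfl
        have t2 := hno.1.symm.trans (t1.symm.trans hno.2)
        simp only [t0] at t2
        have t3 := add_left_cancel t2
        have hmem : i0 ∈ Finset.univ.erase i := by simp [Ne.symm hi]
        rw [← Finset.add_sum_erase _ _ (Finset.mem_univ i), ← Finset.add_sum_erase _ _ hmem,
          ← Finset.add_sum_erase _ (fun j => σ j (g (Equiv.swap i i0 j))) (Finset.mem_univ i),
          ← Finset.add_sum_erase _ (fun j => σ j (g (Equiv.swap i i0 j))) hmem] at t3
        have t4 : ∑ x ∈ (Finset.univ.erase i).erase i0, σ x (g (Equiv.swap i i0 x)) = ∑ x ∈ (Finset.univ.erase i).erase i0, σ x (g x) := by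
          refine Finset.sum_congr rfl fun x hx => ?_
          simp only [Finset.mem_erase] at hx
          rw [Equiv.swap_apply_of_ne_of_ne hx.2.1 hx.1]
        rw [t4, Equiv.swap_apply_left, Equiv.swap_apply_right, ← add_assoc, ← add_assoc] at t3
        have t5 := add_right_cancel t3
        revert t5
        generalize σ i (g i) = a; generalize σ i0 (g i0) = b; generalize σ i (g i0) = c; generalize σ i0 (g i) = d
        revert a b c d; decide
      rw [pr_marg2 i i0 (Ne.symm hi) (fun v w => σ i v + σ i0 v ≠ σ i w + σ i0 w), pr_swap (fun v w => σ i v + σ i0 v ≠ σ i w + σ i0 w)] at e1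
      obtain ⟨w, hw⟩ := exists_le_avg (fun w v => σ i v + σ i0 v ≠ σ i w + σ i0 w)
      exact ⟨_, hw.trans e1⟩
  choose e he using h2
  refine ⟨fun v => σ i0 v = 1, 1 + C + ∑ i, e i, ?_⟩
  have h3 := pr_le_sum (Finset.univ : Finset (Fin m ⊕ Fin m)) (fun i (g : Fin m ⊕ Fin m → V) => σ i (g i) + σ i0 (g i) ≠ e i)
  have h4 : ∑ i : Fin m ⊕ Fin m, pr (fun g : Fin m ⊕ Fin m → V => σ i (g i) + σ i0 (g i) ≠ e i) ≤ 4 * m * K := by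
    have : ∑ i : Fin m ⊕ Fin m, pr (fun g : Fin m ⊕ Fin m → V => σ i (g i) + σ i0 (g i) ≠ e i) ≤ ∑ i : Fin m ⊕ Fin m, 2 * K := by
      refine Finset.sum_le_sum fun i _ => ?_
      rw [pr_marg i (fun v => σ i v + σ i0 v ≠ e i)]; exact he i
    refine this.trans (le_of_eq ?_)
    simp; ring
  have h5 := pr_or_le (fun g : Fin m ⊕ Fin m → V => hv Ed g ≠ C + ∑ i, σ i (g i)) (fun g => ∃ i ∈ (Finset.univ : Finset (Fin m ⊕ Fin m)), σ i (g i) + σ i0 (g i) ≠ e i)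
  refine le_trans (pr_mono ?_) (h5.trans (by linarith))
  intro g hg
  by_contra! hno
  apply hg
  have t1 : ∀ i, σ i (g i) = e i + (if σ i0 (g i) = 1 then 1 else 0) := by
    intro i
    rw [← zmod2_ite, ← hno.2 i (Finset.mem_univ _), add_assoc, zmod2_add_self, add_zero]
  have t2 := hno.1
  rw [Finset.sum_congr rfl (fun i _ => t1 i), Finset.sum_add_distrib, show (∑ x, if σ i0 (g x) = 1 then (1 : ZMod 2) else 0) = cl (fun v => σ i0 v = 1) (mt g) by rw [cl_mt]; congr!] at t2
  revert t2
  unfold hv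
  generalize cl (fun v => σ i0 v = 1) (mt g) = x; generalize ∑ i, e i = y
  intro t2
  clear hg hno t1 h5 h1
  split_ifs at t2 with h <;> simp only [h, true_iff, false_iff] <;> revert C x y <;> decide
end HC
end

section
open Finset
open scoped Classical
namespace HC

section
variable {V : Type} [Fintype V]

lemma cnt_prod (a b : ℕ) (P : Multiset V → Prop) :
    cnt V (a + b) P = pr (fun z : (Fin a → V) × (Fin b → V) => P (mt z.1 + mt z.2)) := by
  rw [← pr_equiv (Fin.appendEquiv a b).symm]
  unfold cnt
  refine pr_congr fun f => ?_
  have : mt ((Fin.appendEquiv a b).symm f).1 + mt ((Fin.appendEquiv a b).symm f).2 = mt f := by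
    rw [← mt_append]
    congr 1
    exact (Fin.appendEquiv a b).apply_symm_apply f
  rw [this]

lemma cnt_one (P : Multiset V → Prop) : cnt V 1 P = pr (fun v => P {v}) := by
  rw [← pr_equiv (Equiv.funUnique (Fin 1) V)]
  unfold cnt
  refine pr_congr fun f => ?_
  simp [mt]

lemma cnt_succ (a : ℕ) (P : Multiset V → Prop) :
    cnt V (a + 1) P = pr (fun z : (Fin a → V) × V => P (mt z.1 + {z.2})) := by
  rw [cnt_prod, pr_prod (fun (x : Fin a → V) (y : Fin 1 → V) => P (mt x + mt y)), pr_prod (fun (x : Fin a → V) v => P (mt x + {v}))]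
  congr 1
  refine Finset.sum_congr rfl fun x _ => ?_
  exact cnt_one (fun s => P (mt x + s))

lemma cnt_sum (m : ℕ) (P : Multiset V → Prop) :
    pr (fun g : Fin m ⊕ Fin m → V => P (mt g)) = cnt V (m + m) P := by
  rw [cnt_prod, ← pr_equiv (Equiv.sumArrowEquivProdArrow (Fin m) (Fin m) V)]
  refine pr_congr fun g => ?_
  rw [← mt_sum]
  have : Sum.elim ((Equiv.sumArrowEquivProdArrow (Fin m) (Fin m) V) g).1 ((Equiv.sumArrowEquivProdArrow (Fin m) (Fin m) V) g).2 = g := by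
    ext i; cases i <;> rfl
  rw [this]

lemma cnt_or_mono {q : ℕ} {P Q R : Multiset V → Prop} (h : ∀ s, s.card = q → P s → Q s ∨ R s) :
    cnt V q P ≤ cnt V q Q + cnt V q R := (cnt_mono h).trans (cnt_or_le _ _)

lemma cnt_mem [Nonempty V] (q : ℕ) (M : V → Prop) : cnt V q (fun s => ∃ v ∈ s, M v) ≤ q * pr M := by
  unfold cnt
  have h := pr_le_sum (Finset.univ : Finset (Fin q)) (fun i (g : Fin q → V) => M (g i))
  refine le_trans (pr_mono ?_) (h.trans ?_)
  · rintro g ⟨v, hv, hM⟩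
    rw [mem_mt] at hv
    obtain ⟨i, rfl⟩ := hv
    exact ⟨i, Finset.mem_univ _, hM⟩
  · rw [Finset.sum_congr rfl (fun i _ => pr_marg i M)]
    simp

lemma deg_lem [Nonempty V] {N : ℕ} {Ed : Multiset V → Prop} {d : ℝ} (hd1 : d ≤ 1)
    (hd : ∀ s : Multiset V, s.Nodup → s.card = N → d ≤ pr (fun v => Ed (s + {v})))
    (q : ℕ) (U : Multiset V) (hU : U.Nodup) (hq : q + U.card = N) :
    d - q * N / Fintype.card V ≤ cnt V (q + 1) (fun s => Ed (s + U)) := by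
  rw [cnt_succ]
  have h0 := cnt_hit q U hU
  have hq' : (q : ℝ) + U.card = N := by exact_mod_cast hq
  rw [hq'] at h0
  have h1 := pr_not (fun f : Fin q → V => ¬ (mt f + U).Nodup)
  simp only [not_not] at h1
  unfold cnt at h0
  have h2 := pr_prod_ge (p := fun f : Fin q → V => (mt f + U).Nodup) (q := fun f v => Ed (mt f + {v} + U)) (b := d) (by
    intro f hf
    have := hd _ hf (by simp [hq])
    refine this.trans (pr_mono fun v hv => ?_)
    rwa [add_right_comm])
  have h3 : pr (fun z : (Fin q → V) × V => (mt z.1 + U).Nodup ∧ Ed (mt z.1 + {z.2} + U)) ≤ pr (fun z : (Fin q → V) × V => Ed (mt z.1 + {z.2} + U)) :=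
    pr_mono fun z hz => hz.2
  refine le_trans ?_ (h2.trans h3)
  have h4 := pr_nonneg (fun f : Fin q → V => (mt f + U).Nodup)
  have h5 := pr_nonneg (fun f : Fin q → V => ¬ (mt f + U).Nodup)
  have h6 := pr_le_one (fun f : Fin q → V => (mt f + U).Nodup)
  by_cases hd0 : 0 ≤ d
  · nlinarith
  · push_neg at hd0
    nlinarith

end

structure EHyp {V : Type} [Fintype V] (m' : ℕ) (Ed : Multiset V → Prop) (A : V → Prop) (p : ZMod 2) (ε : ℝ) : Prop where
  e1 : cnt V ((m'+1)+(m'+1)) (fun s => ¬ (Ed s ↔ cl A s = p)) ≤ ε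
  e2 : 1/2 - ε ≤ pr A
  e2' : pr A ≤ 1/2 + ε
  e3 : ∀ v, 1/6 ≤ cnt V (2 * m' + 1) (fun s => Ed (s + {v}) ∧ cl A (s + {v}) = p)

lemma zA (x p : ZMod 2) : (x + 1 = p ∧ x + 0 ≠ p) ∨ (x + 1 ≠ p ∧ x + 0 = p) := by revert x p; decide
lemma zB (x p : ZMod 2) : x + 1 ≠ p → x + 0 = p := by revert x p; decide
lemma zC (x p : ZMod 2) : x + 0 ≠ p → x + 1 = p := by revert x p; decide

/-- size lemma -/
lemma size_lem {V : Type} [Fintype V] [Nonempty V] (q : ℕ) (Ed : Multiset V → Prop) (A : V → Prop) (p : ZMod 2) (δ : ℝ) (hδ : 0 < δ) (hδ1 : δ ≤ 1/4)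
    (h1 : cnt V (q+1) (fun s => ¬ (Ed s ↔ cl A s = p)) ≤ δ * δ)
    (hn : (q:ℝ) * q / Fintype.card V ≤ δ)
    (hd : ∀ s : Multiset V, s.Nodup → s.card = q → 1/2 - δ ≤ pr (fun v => Ed (s + {v})))
    (hden : cnt V (q+1) Ed ≤ 1/2 + δ) : 1/2 - 5 * δ ≤ pr A ∧ pr A ≤ 1/2 + 5 * δ := by
  rw [cnt_succ] at h1 hden
  have hnd := cnt_hit (V := V) q 0 (by simp)
  simp only [Multiset.card_zero, Nat.cast_zero, add_zero] at hnd
  unfold cnt at hnd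
  have hmk := pr_markov (fun (f : Fin q → V) v => ¬ (Ed (mt f + {v}) ↔ cl A (mt f + {v}) = p)) δ
  have hmk2 : pr (fun f : Fin q → V => δ ≤ pr (fun v => ¬ (Ed (mt f + {v}) ↔ cl A (mt f + {v}) = p))) ≤ δ := by
    have := hmk.trans h1
    exact le_of_mul_le_mul_right this hδ
  obtain ⟨T, hT⟩ : ∃ T : (Fin q → V) → Prop, T = fun f => (mt f).Nodup ∧ pr (fun v => ¬ (Ed (mt f + {v}) ↔ cl A (mt f + {v}) = p)) < δ := ⟨_, rfl⟩
  have hTp : 1 - 2 * δ ≤ pr T := by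
    have h2 := pr_or_le (fun f : Fin q → V => ¬ (mt f).Nodup) (fun f : Fin q → V => δ ≤ pr (fun v => ¬ (Ed (mt f + {v}) ↔ cl A (mt f + {v}) = p)))
    have h3 : pr (fun f => ¬ T f) ≤ 2 * δ := by
      refine le_trans (pr_mono ?_) (h2.trans (by linarith))
      intro f hf
      rw [hT] at hf
      by_contra hno
      rw [not_or, not_not, not_le] at hno
      exact hf ⟨hno.1, hno.2⟩
    rw [pr_not] at h3; linarith
  -- for f in T right extension density
  have key : ∀ (f : Fin q → V) (Q : V → Prop), T f → (∀ v, cl A (mt f + {v}) = p ↔ Q v) →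
      1/2 - 2 * δ ≤ pr Q ∧ pr Q - δ ≤ pr (fun v => Ed (mt f + {v})) := by
    intro f Q hf hQ
    rw [hT] at hf
    have h2 := hd (mt f) hf.1 (by simp)
    have h3 := hf.2
    simp only [hQ] at h3
    have h4 : pr (fun v => Ed (mt f + {v})) ≤ pr (fun v => Q v ∨ ¬ (Ed (mt f + {v}) ↔ Q v)) := pr_mono fun v => by tauto
    have h5 := pr_or_le Q (fun v => ¬ (Ed (mt f + {v}) ↔ Q v))
    have h6 : pr Q ≤ pr (fun v => Ed (mt f + {v}) ∨ ¬ (Ed (mt f + {v}) ↔ Q v)) := pr_mono fun v => by tauto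
    have h7 := pr_or_le (fun v => Ed (mt f + {v})) (fun v => ¬ (Ed (mt f + {v}) ↔ Q v))
    constructor <;> linarith
  have key2 : ∀ (Q : V → Prop), (∀ f, T f → ∀ v, cl A (mt f + {v}) = p ↔ Q v) → pr Q ≤ 1/2 + 5 * δ := by
    intro Q hQ
    have h2 := pr_prod_ge (p := T) (q := fun f v => Ed (mt f + {v})) (b := pr Q - δ) (fun f hf => (key f Q hf (hQ f hf)).2)
    have h3 : pr (fun z : (Fin q → V) × V => T z.1 ∧ Ed (mt z.1 + {z.2})) ≤ pr (fun z : (Fin q → V) × V => Ed (mt z.1 + {z.2})) :=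
      pr_mono fun z hz => hz.2
    have h4 := pr_le_one Q
    by_contra! hcon
    have h5 : (1 - 2 * δ) * (1/2 + 4 * δ) ≤ pr T * (pr Q - δ) := by
      apply mul_le_mul hTp (by linarith) (by linarith) (by linarith)
    nlinarith
  have hA : ∀ (f : Fin q → V), (∀ v, cl A (mt f + {v}) = p ↔ A v) ∨ (∀ v, cl A (mt f + {v}) = p ↔ ¬ A v) := by
    intro f
    simp only [cl_add, cl_singleton]
    generalize cl A (mt f) = x
    have : (x + 1 = p ∧ x + 0 ≠ p) ∨ (x + 1 ≠ p ∧ x + 0 = p) := zA x p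
    rcases this with h | h
    · left; intro v; split_ifs with hv <;> simp [hv, h.1, h.2] ; simpa using h.2
    · right; intro v; split_ifs with hv <;> simp only [hv, h.1, h.2] <;> simp
  have hnA := pr_not A
  constructor
  · by_cases hex : ∃ f, T f ∧ ∀ v, cl A (mt f + {v}) = p ↔ A v
    · obtain ⟨f, hf, hf2⟩ := hex
      linarith [(key f A hf hf2).1]
    · have := key2 (fun v => ¬ A v) (by
        intro f hf
        rcases hA f with h | h
        · exact absurd ⟨f, hf, h⟩ hex
        · exact h)
      linarith
  · by_cases hex : ∃ f, T f ∧ ∀ v, cl A (mt f + {v}) = p ↔ ¬ A v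
    · obtain ⟨f, hf, hf2⟩ := hex
      linarith [(key f _ hf hf2).1]
    · exact key2 A (by
        intro f hf
        rcases hA f with h | h
        · exact h
        · exact absurd ⟨f, hf, h⟩ hex)

lemma cl_congr {V : Type} {A B : V → Prop} {s : Multiset V} (h : ∀ v ∈ s, (A v ↔ B v)) : cl A s = cl B s := by
  unfold cl
  congr 1
  exact Multiset.countP_congr rfl (fun v hv => by simpa using h v hv)

set_option maxHeartbeats 1000000 in
lemma E_struct (m' : ℕ) (ε : ℝ) (hε : 0 < ε) : ∃ δ : ℝ, 0 < δ ∧ ∃ n0 : ℕ, ∀ (V : Type) [Fintype V], n0 ≤ Fintype.card V →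
    ∀ (Ed : Multiset V → Prop) (χ ψ : (Fin (m'+1) → V) → Prop),
    (∀ s : Multiset V, s.Nodup → s.card = 2 * m' + 1 → 1/2 - δ ≤ pr (fun v => Ed (s + {v}))) →
    pr (fun z : (Fin (m'+1) → V) × (Fin (m'+1) → V) => ¬ (Adj Ed z.1 z.2 ↔ (χ z.1 ↔ ψ z.2))) ≤ δ →
    pr ψ ≤ 1/2 + δ → 1/2 - δ ≤ pr ψ →
    ∃ A p, EHyp m' Ed A p ε := by
  obtain ⟨K, hK⟩ : ∃ K : ℝ, K = (1 + 4 * ((m'+1 : ℕ) : ℝ)) * KK (m'+1) := ⟨_, rfl⟩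
  have hK0 : 0 ≤ K := by rw [hK]; unfold KK; positivity
  obtain ⟨q, hq⟩ : ∃ q, q = 2 * m' + 1 := ⟨_, rfl⟩
  obtain ⟨δ0, hδ0⟩ : ∃ δ0 : ℝ, δ0 = min ε 1 / (1000 * (q + 1)) := ⟨_, rfl⟩
  have hdpos0 : 0 < δ0 := by rw [hδ0]; positivity
  have hδq : 1000 * (q + 1) * δ0 = min ε 1 := by rw [hδ0]; field_simp
  have hδε : 1000 * (q + 1) * δ0 ≤ ε := hδq.trans_le (min_le_left _ _)
  have hδ1 : 1000 * (q + 1) * δ0 ≤ 1 := hδq.trans_le (min_le_right _ _)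
  have hqd : 0 ≤ q * δ0 := by positivity
  have hsm : δ0 ≤ 1/1000 := by nlinarith
  refine ⟨min (δ0 / 4) (δ0 * δ0 / (K + 1)), by positivity, ⌈(q * q + 1) / δ0⌉₊ + 1, ?_⟩
  intro V _ hn Ed χ ψ hd hst hψ1 hψ2
  obtain ⟨δ, hδ⟩ : ∃ δ, δ = min (δ0 / 4) (δ0 * δ0 / (K + 1)) := ⟨_, rfl⟩
  rw [← hδ] at hd hst hψ1 hψ2
  have hδa : δ ≤ δ0 / 4 := hδ.trans_le (min_le_left _ _)
  have hδb : δ ≤ δ0 * δ0 / (K+1) := hδ.trans_le (min_le_right _ _)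
  have hV : 0 < Fintype.card V := by omega
  haveI : Nonempty V := Fintype.card_pos_iff.1 hV
  have hVr : (0:ℝ) < Fintype.card V := by exact_mod_cast hV
  have hn2 : (q * q + 1) / δ0 ≤ (Fintype.card V : ℝ) := by
    refine (Nat.le_ceil _).trans ?_
    exact_mod_cast (by omega : ⌈(q * q + 1 : ℝ) / δ0⌉₊ ≤ Fintype.card V)
  have hqn : (q:ℝ) * q / Fintype.card V ≤ δ0 := by
    rw [div_le_iff₀ hVr]
    rw [div_le_iff₀ hdpos0] at hn2
    linarith
  have hδnn : 0 ≤ δ := (pr_nonneg _).trans hst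
  obtain ⟨A0, p, hA0⟩ := parity (Nat.succ_pos m') Ed χ ψ δ hst
  rw [cnt_sum (m'+1) (fun s => ¬ (Ed s ↔ cl A0 s = p))] at hA0
  have hq2 : (m'+1) + (m'+1) = q + 1 := by omega
  have hA1 : cnt V (q+1) (fun s => ¬ (Ed s ↔ cl A0 s = p)) ≤ δ0 * δ0 := by
    rw [← hq2]
    refine hA0.trans ?_
    rw [← mul_assoc, ← hK]
    rw [le_div_iff₀ (by positivity)] at hδb
    nlinarith
  have hden : cnt V (q+1) Ed ≤ 1/2 + δ0 := by
    rw [← hq2, cnt_prod]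
    have h1 : pr (fun z : (Fin (m'+1) → V) × (Fin (m'+1) → V) => Ed (mt z.1 + mt z.2)) ≤
        pr (fun z : (Fin (m'+1) → V) × (Fin (m'+1) → V) => (χ z.1 ↔ ψ z.2) ∨ ¬ (Adj Ed z.1 z.2 ↔ (χ z.1 ↔ ψ z.2))) :=
      pr_mono fun z => by unfold Adj; tauto
    have h2 := pr_or_le (fun z : (Fin (m'+1) → V) × (Fin (m'+1) → V) => (χ z.1 ↔ ψ z.2)) (fun z => ¬ (Adj Ed z.1 z.2 ↔ (χ z.1 ↔ ψ z.2)))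
    have h3 := pr_prod_le (q := fun (x y : Fin (m'+1) → V) => χ x ↔ ψ y) (b := 1/2 + δ) (by positivity) (by
      intro x
      by_cases hx : χ x
      · simp only [hx, true_iff]; exact hψ1
      · simp only [hx, false_iff]; rw [pr_not]; linarith)
    linarith
  have hd' : ∀ s : Multiset V, s.Nodup → s.card = q → 1/2 - δ0 ≤ pr (fun v => Ed (s + {v})) := by
    intro s hs hc
    have := hd s hs (by omega)
    linarith
  obtain ⟨hs1, hs2⟩ := size_lem q Ed A0 p δ0 hdpos0 (by linarith) hA1 hqn hd' hden
  -- majority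
  obtain ⟨Mv, hMv⟩ : ∃ Mv : V → Prop, Mv = fun v => cnt V q (fun s => Ed (s + {v}) ∧ cl A0 (s + {v}) = p) < 1/5 := ⟨_, rfl⟩
  have hdv : ∀ v, 1/2 - 2 * δ0 ≤ cnt V q (fun s => Ed (s + {v})) := by
    intro v
    have := deg_lem (by linarith) hd' (2 * m') {v} (by simp) (by simp; omega)
    rw [← hq] at this
    refine le_trans ?_ this
    have h2 : ((2 * m' : ℕ) : ℝ) * q / Fintype.card V ≤ q * q / Fintype.card V := by
      gcongr; omega
    linarith
  have hW : ∀ v, Mv v → 1/5 ≤ cnt V q (fun s => Ed (s + {v}) ∧ cl A0 (s + {v}) ≠ p) := by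
    intro v hv
    rw [hMv] at hv
    have h1 := hdv v
    have h2 := cnt_or_mono (V := V) (q := q) (P := fun s => Ed (s + {v})) (Q := fun s => Ed (s + {v}) ∧ cl A0 (s + {v}) = p)
      (R := fun s => Ed (s + {v}) ∧ cl A0 (s + {v}) ≠ p) (fun s _ h => by tauto)
    linarith
  have hMp : pr Mv ≤ 5 * δ0 * δ0 := by
    have h1 := pr_markov (fun v (f : Fin q → V) => ¬ (Ed (mt f + {v}) ↔ cl A0 (mt f + {v}) = p)) (1/5)
    rw [cnt_succ, pr_swap (fun (f : Fin q → V) v => ¬ (Ed (mt f + {v}) ↔ cl A0 (mt f + {v}) = p))] at hA1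
    have h2 := h1.trans hA1
    have h3 : pr Mv ≤ pr (fun v => 1/5 ≤ pr (fun f : Fin q → V => ¬ (Ed (mt f + {v}) ↔ cl A0 (mt f + {v}) = p))) := by
      apply pr_mono
      intro v hv
      refine (hW v hv).trans (pr_mono fun f hf => by tauto)
    linarith
  have hMp2 : pr Mv ≤ δ0 := by nlinarith
  obtain ⟨A, hA⟩ : ∃ A : V → Prop, A = fun v => ¬ (A0 v ↔ Mv v) := ⟨_, rfl⟩
  have hclA : ∀ s : Multiset V, (¬ ∃ v ∈ s, Mv v) → cl A s = cl A0 s := by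
    intro s hs
    apply cl_congr
    intro v hv
    have : ¬ Mv v := fun h => hs ⟨v, hv, h⟩
    rw [hA]; simp only; tauto
  have hmem : ∀ r : ℕ, r ≤ q + 1 → cnt V r (fun s => ∃ v ∈ s, Mv v) ≤ (q + 1) * δ0 := by
    intro r hr
    refine (cnt_mem r Mv).trans ?_
    have : (r:ℝ) ≤ q + 1 := by exact_mod_cast hr
    exact mul_le_mul this hMp2 (pr_nonneg _) (by positivity)
  refine ⟨A, p, ?_, ?_, ?_, ?_⟩
  · rw [hq2]
    have := cnt_or_mono (V := V) (q := q+1) (P := fun s => ¬ (Ed s ↔ cl A s = p)) (Q := fun s => ¬ (Ed s ↔ cl A0 s = p)) (R := fun s => ∃ v ∈ s, Mv v) (by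
      intro s _ h
      by_cases h2 : ∃ v ∈ s, Mv v
      · exact Or.inr h2
      · left; rwa [← hclA s h2])
    have h2 := hmem (q+1) le_rfl
    nlinarith
  · have h1 : pr A0 ≤ pr (fun v => A v ∨ Mv v) := pr_mono fun v hv => by rw [hA]; tauto
    have h2 := pr_or_le A Mv
    nlinarith
  · have h1 : pr A ≤ pr (fun v => A0 v ∨ Mv v) := pr_mono fun v hv => by rw [hA] at hv; tauto
    have h2 := pr_or_le A0 Mv
    nlinarith
  · intro v
    rw [← hq]
    have h2 := hmem q (by omega)
    by_cases hv : Mv v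
    · have := cnt_or_mono (V := V) (q := q) (P := fun s => Ed (s + {v}) ∧ cl A0 (s + {v}) ≠ p) (Q := fun s => Ed (s + {v}) ∧ cl A (s + {v}) = p) (R := fun s => ∃ v ∈ s, Mv v) (by
        intro s _ h
        by_cases h2 : ∃ v ∈ s, Mv v
        · exact Or.inr h2
        · left
          refine ⟨h.1, ?_⟩
          have h3 := h.2
          rw [cl_add, cl_singleton] at h3 ⊢
          rw [hclA s h2]
          have : A v ↔ ¬ A0 v := by rw [hA]; simp only; tauto
          simp only [this]
          revert h3
          by_cases h0 : A0 v <;> simp only [h0, not_true, not_false_iff, if_true, if_false] <;> first | exact zB _ _ | exact zC _ _)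
      have h3 := hW v hv
      linarith
    · have := cnt_or_mono (V := V) (q := q) (P := fun s => Ed (s + {v}) ∧ cl A0 (s + {v}) = p) (Q := fun s => Ed (s + {v}) ∧ cl A (s + {v}) = p) (R := fun s => ∃ v ∈ s, Mv v) (by
        intro s _ h
        by_cases h2 : ∃ v ∈ s, Mv v
        · exact Or.inr h2
        · left
          refine ⟨h.1, ?_⟩
          have h3 := h.2
          rw [cl_add] at h3 ⊢
          rw [hclA s h2, hclA {v} (by simpa using hv)]; exact h3)
      have hv2 : 1/5 ≤ cnt V q (fun s => Ed (s + {v}) ∧ cl A0 (s + {v}) = p) := by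
        rw [hMv] at hv; exact not_lt.1 hv
      clear hclA hMv hW
      linarith
end HC
end

section
open Finset
open scoped Classical
namespace HC

def Gd {V : Type} [Fintype V] {m : ℕ} (Ed : Multiset V → Prop) (A : V → Prop) (p : ZMod 2) (θ : ℝ) (x : Fin m → V) : Prop :=
  pr (fun y : Fin m → V => ¬ (Adj Ed x y ↔ cl A (mt x) + cl A (mt y) = p)) ≤ θ

def Gu {V : Type} [Fintype V] (m' : ℕ) (Ed : Multiset V → Prop) (A : V → Prop) (p : ZMod 2) (θ : ℝ) (u : V) : Prop :=
  cnt V (2 * m' + 1) (fun s => ¬ (Ed (s + {u}) ↔ cl A (s + {u}) = p)) ≤ θ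

structure EG {V : Type} [Fintype V] (m' : ℕ) (Ed : Multiset V → Prop) (A : V → Prop) (p : ZMod 2) (θ : ℝ) : Prop where
  nd : ∀ s, Ed s → s.Nodup
  gt : pr (fun x : Fin (m'+1) → V => ¬ Gd Ed A p θ x) ≤ θ
  gu : pr (fun u : V => ¬ Gu m' Ed A p θ u) ≤ θ
  a1 : 49/100 ≤ pr A
  a2 : pr A ≤ 51/100
  e3 : ∀ v, 1/6 ≤ cnt V (2 * m' + 1) (fun s => Ed (s + {v}) ∧ cl A (s + {v}) = p)

lemma EG.ne {V : Type} [Fintype V] {m' : ℕ} {Ed : Multiset V → Prop} {A : V → Prop} {p : ZMod 2} {θ : ℝ}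
    (h : EG m' Ed A p θ) : Nonempty V := by
  have h1 := h.a1
  obtain ⟨v, _⟩ := exists_of_pr_pos (p := A) (by linarith)
  exact ⟨v⟩

lemma EHyp.toEG {V : Type} [Fintype V] {m' : ℕ} {Ed : Multiset V → Prop} {A : V → Prop} {p : ZMod 2} {θ : ℝ}
    (hθ : 0 < θ) (hθ1 : θ ≤ 1/100) (hnd : ∀ s, Ed s → s.Nodup) (h : EHyp m' Ed A p (θ * θ)) : EG m' Ed A p θ := by
  have hsq : θ * θ ≤ 1/100 := by nlinarith
  refine ⟨hnd, ?_, ?_, by linarith [h.e2], by linarith [h.e2'], h.e3⟩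
  · have h1 := h.e1
    rw [cnt_prod] at h1
    have h2 := pr_markov (fun (x y : Fin (m'+1) → V) => ¬ (Ed (mt x + mt y) ↔ cl A (mt x + mt y) = p)) θ
    have h3 := le_of_mul_le_mul_right (h2.trans h1) hθ
    refine le_trans (pr_mono ?_) h3
    intro x hx
    unfold Gd Adj at hx
    simp only [cl_add]
    exact (not_le.1 hx).le
  · have h1 := h.e1
    have e : (m'+1)+(m'+1) = (2 * m' + 1) + 1 := by ring
    rw [e, cnt_succ] at h1
    rw [pr_swap (fun (x : Fin (2*m'+1) → V) v => ¬ (Ed (mt x + {v}) ↔ cl A (mt x + {v}) = p))] at h1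
    have h2 := pr_markov (fun (v : V) (x : Fin (2*m'+1) → V) => ¬ (Ed (mt x + {v}) ↔ cl A (mt x + {v}) = p)) θ
    have h3 := le_of_mul_le_mul_right (h2.trans h1) hθ
    refine le_trans (pr_mono ?_) h3
    intro u hu
    exact (not_le.1 hu).le

lemma z1 (x p : ZMod 2) : x + (p + x) = p := by revert x p; decide
lemma z2 (x p : ZMod 2) : (p + x) + x = p := by revert x p; decide
lemma z3 (x p : ZMod 2) : p + (p + x) = x := by revert x p; decide
lemma z4 (x y p : ZMod 2) : x + y = p → y = p + x := by revert x p y; decide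

def AdjC {V : Type} [Fintype V] {m : ℕ} (Ed : Multiset V → Prop) (A : V → Prop) (p : ZMod 2) (x y : Fin m → V) : Prop :=
  Adj Ed x y ∧ cl A (mt x) + cl A (mt y) = p

def StC {V : Type} [Fintype V] {m : ℕ} (Ed : Multiset V → Prop) (A : V → Prop) (p : ZMod 2) (θ : ℝ) (a : ZMod 2) (x : Fin m → V) : Prop :=
  Gd Ed A p θ x ∧ cl A (mt x) = a

section
variable {V : Type} [Fintype V] {m' : ℕ} {Ed : Multiset V → Prop} {A : V → Prop} {p : ZMod 2} {θ : ℝ}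

lemma AdjC.symm {m : ℕ} {x y : Fin m → V} (h : AdjC Ed A p x y) : AdjC Ed A p y x :=
  ⟨h.1.symm, by rw [add_comm]; exact h.2⟩

lemma class_dens (h : EG m' Ed A p θ) (a : ZMod 2) : 49/100 ≤ pr (fun y : Fin (m'+1) → V => cl A (mt y) = a) := by
  haveI := h.ne
  have h1 : pr (fun y : Fin (m'+1) → V => cl A (mt y) = a) = cnt V (m'+1) (fun s => cl A s = a) := rfl
  rw [h1, cnt_succ]
  have h2 := pr_prod_ge (p := fun _ : Fin m' → V => True) (q := fun f v => cl A (mt f + {v}) = a) (b := 49/100) (by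
    intro f _
    have hn := pr_not A
    rcases zA (cl A (mt f)) a with hz | hz
    · refine h.a1.trans (pr_mono fun v hv => ?_)
      rw [cl_add, cl_singleton, if_pos hv]; exact hz.1
    · have : 49/100 ≤ pr (fun v => ¬ A v) := by rw [hn]; linarith [h.a2]
      refine this.trans (pr_mono fun v hv => ?_)
      rw [cl_add, cl_singleton, if_neg hv]; exact hz.2)
  rw [pr_true, one_mul] at h2
  exact h2.trans (pr_mono fun z hz => hz.2)

/-- the picking lemma -/
lemma pickA (h : EG m' Ed A p θ) (Q : (Fin (m'+1) → V) → Prop) (L : List (Fin (m'+1) → V))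
    (hL : ∀ z ∈ L, Gd Ed A p θ z) (hQ : ∀ z ∈ L, ∀ y, Q y → cl A (mt z) + cl A (mt y) = p) :
    pr Q - (L.length + 1) * θ ≤ pr (fun y => Q y ∧ Gd Ed A p θ y ∧ ∀ z ∈ L, AdjC Ed A p z y) := by
  induction L with
  | nil =>
    have h1 := pr_and_not_ge Q (fun y => ¬ Gd Ed A p θ y)
    have h2 := h.gt
    simp only [not_not] at h1
    simp
    linarith
  | cons z L ih =>
    have h1 := ih (fun z hz => hL z (by simp [hz])) (fun z hz => hQ z (by simp [hz]))
    have h2 := pr_and_not_ge (fun y => Q y ∧ Gd Ed A p θ y ∧ ∀ z ∈ L, AdjC Ed A p z y)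
      (fun y => ¬ (Adj Ed z y ↔ cl A (mt z) + cl A (mt y) = p))
    have h3 := hL z (by simp)
    unfold Gd at h3
    have h4 : pr (fun y => (Q y ∧ Gd Ed A p θ y ∧ ∀ z ∈ L, AdjC Ed A p z y) ∧ ¬¬ (Adj Ed z y ↔ cl A (mt z) + cl A (mt y) = p))
      ≤ pr (fun y => Q y ∧ Gd Ed A p θ y ∧ ∀ w ∈ z :: L, AdjC Ed A p w y) := by
      refine pr_mono ?_
      rintro y ⟨⟨q1, q2, q3⟩, q4⟩
      rw [not_not] at q4
      refine ⟨q1, q2, fun w hw => ?_⟩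
      rcases List.mem_cons.1 hw with rfl | hw
      · have := hQ w (by simp) y q1
        exact ⟨q4.2 this, this⟩
      · exact q3 w hw
    rw [List.length_cons]
    push_cast
    linarith

lemma pick_class (h : EG m' Ed A p θ) (hθ : θ ≤ 1/100) (a : ZMod 2) (L : List (Fin (m'+1) → V)) (hl : L.length ≤ 2)
    (hL : ∀ z ∈ L, StC Ed A p θ (p + a) z) :
    1/4 ≤ pr (fun y => StC Ed A p θ a y ∧ ∀ z ∈ L, AdjC Ed A p z y) := by
  have h1 := pickA h (fun y => cl A (mt y) = a) L (fun z hz => (hL z hz).1) (fun z hz y hy => by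
    rw [(hL z hz).2, hy]; exact z2 a p)
  have h2 := class_dens h a
  have hθ0 : 0 ≤ θ := (pr_nonneg _).trans h.gt
  have h3 : (L.length : ℝ) ≤ 2 := by exact_mod_cast hl
  have h4 : ((L.length : ℝ) + 1) * θ ≤ 3 * (1/100) := by gcongr; linarith
  refine le_trans ?_ (h1.trans (pr_mono ?_))
  · linarith
  · rintro y ⟨y1, y2, y3⟩; exact ⟨⟨y2, y1⟩, y3⟩

lemma E_conn (h : EG m' Ed A p θ) (hθ : θ ≤ 1/100) (a : ZMod 2) (y x : Fin (m'+1) → V)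
    (hy : StC Ed A p θ (p + a) y) (hx : StC Ed A p θ a x) :
    (1/4) * (1/4 : ℝ) ≤ cnt V ((m'+1) + (m'+1)) (ConnP (AdjC Ed A p) y x) := by
  refine cnt_pick (by norm_num) (pick_class h hθ a [y] (by simp) (by simpa using hy)) ?_
  rintro c1 ⟨hc1, hc1'⟩
  refine cnt_end (pick_class h hθ (p + a) [c1, x] (by simp) (by rw [z3]; simp [hc1, hx])) ?_
  rintro c2 ⟨hc2, hc2'⟩
  refine ⟨[c1, c2], ?_, by simp⟩
  simp at hc1' hc2'
  simp [hc1', hc2'.1, hc2'.2.symm]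

/-- splitting a non monochromatic multiset -/
lemma split_par (A : V → Prop) (a : ZMod 2) (hm : 1 ≤ m') (s : Multiset V) (hs : s.card = m' + (m'+1))
    (h1 : ∃ v ∈ s, A v) (h2 : ∃ v ∈ s, ¬ A v) : ∃ R X : Multiset V, R.card = m' ∧ X.card = m'+1 ∧ s = R + X ∧ cl A X = a := by
  obtain ⟨f, hf⟩ := exists_mt s hs
  obtain ⟨R, X, hR, hX, hRX⟩ : ∃ R X : Multiset V, R.card = m' ∧ X.card = m'+1 ∧ s = R + X := by
    refine ⟨mt (fun i => f (Fin.castAdd _ i)), mt (fun i => f (Fin.natAdd _ i)), by simp, by simp, ?_⟩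
    rw [← mt_append, ← hf, Fin.append_castAdd_natAdd]
  by_cases hc : cl A X = a
  · exact ⟨R, X, hR, hX, hRX, hc⟩
  obtain ⟨r, hr, y, hy, hry⟩ : ∃ r ∈ R, ∃ y ∈ X, ¬ (A r ↔ A y) := by
    by_contra hno
    push Not at hno
    obtain ⟨r, hr⟩ := Multiset.card_pos_iff_exists_mem.1 (show 0 < R.card by omega)
    obtain ⟨y, hy⟩ := Multiset.card_pos_iff_exists_mem.1 (show 0 < X.card by omega)
    have hall : ∀ v ∈ s, (A v ↔ A r) := by
      intro v hv
      rw [hRX] at hv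
      rcases Multiset.mem_add.1 hv with hv | hv
      · rw [hno v hv y hy, hno r hr y hy]
      · rw [hno r hr v hv]
    obtain ⟨v, hv, hv'⟩ := h1
    obtain ⟨w, hw, hw'⟩ := h2
    have := hall v hv
    have := hall w hw
    tauto
  obtain ⟨R', rfl⟩ := Multiset.exists_cons_of_mem hr
  obtain ⟨X', rfl⟩ := Multiset.exists_cons_of_mem hy
  refine ⟨y ::ₘ R', r ::ₘ X', by simpa using hR, by simpa using hX, ?_, ?_⟩
  · rw [hRX, Multiset.cons_add, Multiset.cons_add, Multiset.add_cons, Multiset.add_cons, Multiset.cons_swap]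
  · rw [← Multiset.singleton_add, cl_add, cl_singleton] at hc ⊢
    have hz : ∀ u b : ZMod 2, (1 + u ≠ b → 0 + u = b) ∧ (0 + u ≠ b → 1 + u = b) := by decide
    have := hz (cl A X') a
    by_cases A r <;> by_cases A y <;> simp_all

lemma link_split (h : EG m' Ed A p θ) (hm : 2 ≤ m') (a : ZMod 2) (v : V) :
    (1/50) / ((m' + (m'+1)).factorial : ℝ) ≤ pr (fun z : (Fin m' → V) × (Fin (m'+1) → V) =>
      Ed (mt z.1 + mt z.2 + {v}) ∧ cl A (mt z.1 + mt z.2 + {v}) = p ∧ cl A (mt z.2) = a) := by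
  haveI := h.ne
  have h1 := h.e3 v
  rw [show 2 * m' + 1 = m' + (m'+1) by ring] at h1
  have hmono : ∀ B : V → Prop, pr B ≤ 51/100 → cnt V (m' + (m'+1)) (fun s => ∀ v ∈ s, B v) ≤ 7/100 := by
    intro B hB
    have e1 : cnt V (m' + (m'+1)) (fun s => ∀ v ∈ s, B v) = pr (fun f : Fin (m' + (m'+1)) → V => ∀ i, B (f i)) := by
      refine pr_congr fun f => ?_
      simp [mem_mt]
    rw [e1, pr_all]
    calc (pr B)^(m' + (m'+1)) ≤ (51/100)^(m' + (m'+1)) := by gcongr; exact pr_nonneg _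
      _ ≤ (51/100)^5 := pow_le_pow_of_le_one (by norm_num) (by norm_num) (by omega)
      _ ≤ 7/100 := by norm_num
  have hA := hmono A h.a2
  have hB := hmono (fun v => ¬ A v) (by rw [pr_not]; linarith [h.a1])
  have h2 := cnt_or_mono (V := V) (q := m' + (m'+1)) (P := fun s => Ed (s + {v}) ∧ cl A (s + {v}) = p)
    (Q := fun s => (Ed (s + {v}) ∧ cl A (s + {v}) = p) ∧ (∃ v ∈ s, A v) ∧ (∃ v ∈ s, ¬ A v))
    (R := fun s => (∀ v ∈ s, A v) ∨ (∀ v ∈ s, ¬ A v)) (by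
      intro s _ hs
      by_cases q1 : ∃ v ∈ s, A v
      · by_cases q2 : ∃ v ∈ s, ¬ A v
        · exact Or.inl ⟨hs, q1, q2⟩
        · push Not at q2; exact Or.inr (Or.inl q2)
      · push Not at q1; exact Or.inr (Or.inr q1))
  have h3 := cnt_or_le (V := V) (q := m' + (m'+1)) (fun s => ∀ v ∈ s, A v) (fun s => ∀ v ∈ s, ¬ A v)
  have h4 : (1/50 : ℝ) ≤ cnt V (m' + (m'+1)) (fun s => (Ed (s + {v}) ∧ cl A (s + {v}) = p) ∧ (∃ v ∈ s, A v) ∧ (∃ v ∈ s, ¬ A v)) := by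
    linarith
  have h5 := cnt_perm (D := fun f : Fin (m' + (m'+1)) → V => 
      Ed (mt f + {v}) ∧ cl A (mt f + {v}) = p ∧ cl A (mt (fun i => f (Fin.natAdd m' i))) = a) h4 (by
    rintro s hs ⟨⟨s1, s2⟩, s3, s4⟩
    obtain ⟨R, X, hR, hX, rfl, hc⟩ := split_par A a (by omega) s hs s3 s4
    obtain ⟨f, rfl⟩ := exists_mt R hR
    obtain ⟨g, rfl⟩ := exists_mt X hX
    refine ⟨Fin.append f g, mt_append f g, ?_, ?_, ?_⟩
    · rwa [mt_append]
    · rwa [mt_append]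
    · simpa using hc)
  refine h5.trans ?_
  rw [← pr_equiv (Fin.appendEquiv m' (m'+1))]
  refine pr_mono ?_
  rintro ⟨f, g⟩ ⟨z1, z2, z3⟩
  have e : (Fin.appendEquiv m' (m'+1)) (f, g) = Fin.append f g := rfl
  rw [e, mt_append] at z1 z2
  refine ⟨z1, z2, ?_⟩
  rw [e] at z3
  simpa using z3

end
end HC
end

section
open Finset
open scoped Classical
namespace HC

noncomputable def k0 (m' : ℕ) : ℝ := (1/50) / ((m' + (m'+1)).factorial : ℝ)
lemma k0_pos (m' : ℕ) : 0 < k0 m' := by unfold k0; positivity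
noncomputable def k1 (m' : ℕ) : ℝ := (k0 m'/4) * ((k0 m'/4) * ((k0 m'/4) * (1/4)))
lemma k1_pos (m' : ℕ) : 0 < k1 m' := by have := k0_pos m'; unfold k1; positivity

section
variable {V : Type} [Fintype V] {m' : ℕ} {Ed : Multiset V → Prop} {A : V → Prop} {p : ZMod 2} {θ : ℝ}

lemma E_swap (h : EG m' Ed A p θ) (hm : 2 ≤ m') (hθ : θ ≤ 1/100) (hθ2 : θ ≤ k0 m' / 8) (a : ZMod 2) (w v : V)
    (hw : Gu m' Ed A p θ w) (hwv : A w ↔ A v) :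
    k1 m' ≤ cnt V (m' + ((m'+1) + ((m'+1) + (m'+1)))) (fun s =>
      ExP (m := m'+1) (AdjC Ed A p) (StC Ed A p θ a) (StC Ed A p θ (p + a)) {w} {v} (s + 0)) := by
  haveI := h.ne
  have hk0 := k0_pos m'
  have hcl : ∀ s : Multiset V, cl A (s + {w}) = cl A (s + {v}) := by
    intro s; rw [cl_add, cl_add, cl_singleton, cl_singleton]; simp [hwv]
  have l1 := link_split h hm a v
  have l2 := hw
  unfold Gu at l2
  rw [show 2 * m' + 1 = m' + (m'+1) by ring, cnt_prod] at l2
  have l3 := pr_snd (α := Fin m' → V) (fun x : Fin (m'+1) → V => ¬ Gd Ed A p θ x)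
  have l4 := h.gt
  obtain ⟨E, hE⟩ : ∃ E : (Fin m' → V) → (Fin (m'+1) → V) → Prop, E = fun R X =>
    Ed (mt R + mt X + {v}) ∧ Ed (mt R + mt X + {w}) ∧ cl A (mt R + mt X + {v}) = p ∧ cl A (mt X) = a ∧ Gd Ed A p θ X := ⟨_, rfl⟩
  have l5 : k0 m' / 2 ≤ pr (fun z : (Fin m' → V) × (Fin (m'+1) → V) => E z.1 z.2) := by
    have t1 := pr_and_not_ge (fun z : (Fin m' → V) × (Fin (m'+1) → V) =>
      Ed (mt z.1 + mt z.2 + {v}) ∧ cl A (mt z.1 + mt z.2 + {v}) = p ∧ cl A (mt z.2) = a)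
      (fun z => ¬ (Ed (mt z.1 + mt z.2 + {w}) ↔ cl A (mt z.1 + mt z.2 + {w}) = p) ∨ ¬ Gd Ed A p θ z.2)
    have t2 := pr_or_le (fun z : (Fin m' → V) × (Fin (m'+1) → V) => ¬ (Ed (mt z.1 + mt z.2 + {w}) ↔ cl A (mt z.1 + mt z.2 + {w}) = p)) (fun z => ¬ Gd Ed A p θ z.2)
    have t3 : k0 m' - 2 * θ ≤ _ := le_trans (by unfold k0 at *; linarith) t1
    refine le_trans (by linarith) (t3.trans (pr_mono ?_))
    rintro ⟨R, X⟩ ⟨⟨q1, q2, q3⟩, q4⟩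
    rw [not_or, not_not, not_not] at q4
    rw [hE]
    refine ⟨q1, q4.1.2 ?_, q2, q3, q4.2⟩
    rw [hcl]; exact q2
  have l6 := pr_avg E (s := k0 m' / 4) (by positivity)
  have l7 : k0 m' / 4 ≤ pr (fun R => k0 m' / 4 ≤ pr (E R)) := by linarith
  unfold k1
  refine cnt_pick (by positivity) l7 ?_
  intro R hR
  refine cnt_pick (by positivity) hR ?_
  intro X hX
  refine cnt_pick (by positivity) hR ?_
  intro X' hX'
  rw [hE] at hX hX'
  obtain ⟨x1, x2, x3, x4, x5⟩ := hX
  obtain ⟨y1, y2, y3, y4, y5⟩ := hX'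
  refine cnt_end (pick_class h hθ (p + a) [X'] (by simp) (by rw [z3]; simp [StC, y4, y5])) ?_
  rintro Z ⟨hZ, hZ'⟩
  simp at hZ'
  have e1 : ∀ (u : V) (Y : Fin (m'+1) → V), mt Y + mt (Fin.snoc R u : Fin (m'+1) → V) = mt R + mt Y + {u} := by
    intro u Y
    rw [mt_snoc]; abel
  have e2 : ∀ (u : V) (Y : Fin (m'+1) → V), mt (Fin.snoc R u : Fin (m'+1) → V) + mt Y = mt R + mt Y + {u} := by
    intro u Y
    rw [mt_snoc]; abel
  have f1 : ∀ (u : V) (Y : Fin (m'+1) → V), Ed (mt R + mt Y + {u}) → cl A (mt R + mt Y + {u}) = p → 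
      AdjC Ed A p Y (Fin.snoc R u) := by
    intro u Y h1 h2
    refine ⟨?_, ?_⟩
    · unfold Adj; rw [e1]; exact h1
    · rw [← cl_add, e1]; exact h2
  have a1 := f1 v X x1 x3
  have a2 := f1 w X x2 (by rw [hcl]; exact x3)
  have a3 := (f1 v X' y1 y3).symm
  have a4 := (f1 w X' y2 (by rw [hcl]; exact y3)).symm
  refine ⟨[X, Fin.snoc R w, X', Z], [X, Fin.snoc R v, X', Z], ⟨?_, ⟨X, rfl, x5, x4⟩, ⟨Z, rfl, hZ⟩⟩, ?_, ⟨?_, rfl, rfl⟩, ?_⟩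
  · simp [a2, a4, hZ']
  · simp [mt_snoc]; abel
  · simp [a1, a3, hZ']
  · simp [mt_snoc]; abel

noncomputable def k2 (m' : ℕ) : ℕ → ℝ
  | 0 => 1/4 * (1/4)
  | (j+1) => k1 m' * (k2 m' j * (1/4 * (1/4)))
lemma k2_pos (m' j : ℕ) : 0 < k2 m' j := by
  induction j with
  | zero => unfold k2; norm_num
  | succ j ih => have := k1_pos m'; unfold k2; positivity

lemma E_swaps (h : EG m' Ed A p θ) (hm : 2 ≤ m') (hθ : θ ≤ 1/100) (hθ2 : θ ≤ k0 m' / 8) (a : ZMod 2) (L : List (V × V))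
    (hL : ∀ z ∈ L, Gu m' Ed A p θ z.1 ∧ (A z.1 ↔ A z.2)) :
    k2 m' L.length ≤ cnt V (2 * (m'+1) + L.length * (5 + 6 * m')) (fun s =>
      ExP (m := m'+1) (AdjC Ed A p) (StC Ed A p θ a) (StC Ed A p θ (p + a)) (L.map Prod.fst : List V) (L.map Prod.snd : List V) (s + 0)) := by
  induction L with
  | nil =>
    rw [List.length_nil, zero_mul, add_zero, two_mul]
    unfold k2
    refine cnt_pick (by norm_num) (pick_class h hθ a [] (by simp) (by simp)) ?_
    rintro X ⟨hX, -⟩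
    refine cnt_end (pick_class h hθ (p + a) [X] (by simp) (by rw [z3]; simp [hX])) ?_
    rintro Z ⟨hZ, hZ'⟩
    simp at hZ'
    exact ⟨[X, Z], [X, Z], ⟨by simp [hZ'], ⟨X, rfl, hX⟩, ⟨Z, rfl, hZ⟩⟩, by simp, ⟨by simp [hZ'], rfl, rfl⟩, by simp⟩
  | cons z L ih =>
    have h1 := ih (fun z hz => hL z (by simp [hz]))
    have h2 := E_swap h hm hθ hθ2 a z.1 z.2 (hL z (by simp)).1 (hL z (by simp)).2
    have h3 := exp_prod (k1_pos m').le (k2_pos m' _).le (by norm_num) (fun y x hy hx => E_conn h hθ a y x hy hx) h2 h1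
    rw [List.length_cons, k2]
    have e : 2 * (m'+1) + (L.length + 1) * (5 + 6 * m') = m' + (m' + 1 + (m' + 1 + (m' + 1))) + (2 * (m' + 1) + L.length * (5 + 6 * m') + (m' + 1 + (m' + 1))) := by ring
    rw [e]
    refine h3.trans (cnt_mono ?_)
    intro s _ hs
    convert hs using 1
    · rw [List.map_cons, ← Multiset.cons_coe, Multiset.singleton_add]
    · rw [List.map_cons, ← Multiset.cons_coe, Multiset.singleton_add]
    · simp

lemma col_dens (h : EG m' Ed A p θ) (hθ : θ ≤ 1/100) (B : V → Prop) (hB : 49/100 ≤ pr B) :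
    1/4 ≤ pr (fun v => Gu m' Ed A p θ v ∧ B v) := by
  have h1 := pr_and_not_ge B (fun v => ¬ Gu m' Ed A p θ v)
  have h2 := h.gu
  refine le_trans (by linarith) (h1.trans (pr_mono ?_))
  rintro v ⟨v1, v2⟩
  exact ⟨not_not.1 v2, v1⟩

lemma pr_pi {q : ℕ} (P : Fin q → V → Prop) (c : ℝ) (hc : 0 ≤ c) (hP : ∀ i, c ≤ pr (P i)) :
    c ^ q ≤ pr (fun f : Fin q → V => ∀ i, P i (f i)) := by
  unfold pr at *
  have : (Finset.univ.filter (fun f : Fin q → V => ∀ i, P i (f i))) =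
      Fintype.piFinset (fun i => Finset.univ.filter (P i)) := by
    ext f; simp [Fintype.mem_piFinset]
  have h2 := congrArg Finset.card this
  rw [Fintype.card_piFinset] at h2
  have h3 : ((Finset.univ.filter (fun f : Fin q → V => ∀ i, P i (f i))).card : ℝ) = ∏ i, ((Finset.univ.filter (P i)).card : ℝ) := by
    exact_mod_cast h2
  refine le_trans (?_ : _ ≤ (∏ i, ((Finset.univ.filter (P i)).card : ℝ)) / (Fintype.card (Fin q → V) : ℝ)) (le_of_eq ?_)
  swap
  · rw [← h3]; congr
  rw [Fintype.card_fun, Fintype.card_fin]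
  push_cast
  have e : ((Fintype.card V : ℝ)) ^ q = ∏ _i : Fin q, (Fintype.card V : ℝ) := by simp
  have e2 : c ^ q = ∏ _i : Fin q, c := by simp
  rw [e, ← Finset.prod_div_distrib, e2]
  refine Finset.prod_le_prod (fun i _ => hc) (fun i _ => ?_)
  exact hP i

lemma same_dens (h : EG m' Ed A p θ) (hθ : θ ≤ 1/100) (M : Fin (m'+1) → V) :
    (1/4 : ℝ)^(m'+1) ≤ pr (fun Y : Fin (m'+1) → V => ∀ i, Gu m' Ed A p θ (Y i) ∧ (A (Y i) ↔ A (M i))) := by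
  haveI := h.ne
  refine pr_pi (fun i v => Gu m' Ed A p θ v ∧ (A v ↔ A (M i))) _ (by norm_num) ?_
  intro i
  apply col_dens h hθ
  by_cases hM : A (M i)
  · simp only [hM, iff_true]; exact h.a1
  · simp only [hM, iff_false]; rw [pr_not]; linarith [h.a2]

lemma same_cl (Y M : Fin (m'+1) → V) (h : ∀ i, (A (Y i) ↔ A (M i))) : cl A (mt Y) = cl A (mt M) := by
  rw [cl_mt, cl_mt]
  refine Finset.sum_congr rfl fun i _ => ?_
  simp [h i]

noncomputable def k3 (m' : ℕ) : ℝ := ((1/4 : ℝ)^(m'+1)/2) * (((1/4 : ℝ)^(m'+1)/2) * (1/4 * (1/4 * (k2 m' (2 * (m'+1)) * (1/4*(1/4))))))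
lemma k3_pos (m' : ℕ) : 0 < k3 m' := by have := k2_pos m' (2 * (m'+1)); unfold k3; positivity

/-- absorbers, extremal case -/
lemma E_abs (h : EG m' Ed A p θ) (hm : 2 ≤ m') (hθ : θ ≤ 1/100) (hθ2 : θ ≤ k0 m' / 8) (hθ3 : 3 * θ ≤ (1/4 : ℝ)^(m'+1)/2) (a : ZMod 2)
    (M1 M2 : Fin (m'+1) → V) (hM1 : cl A (mt M1) = p + a) (hM2 : cl A (mt M2) = a) :
    k3 m' ≤ cnt V ((12 * m' + 18) * (m'+1)) (AbsP (m := m'+1) (AdjC Ed A p) (StC Ed A p θ a) (StC Ed A p θ (p + a)) (mt M1 + mt M2)) := by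
  have hθ0 : 0 ≤ θ := (pr_nonneg _).trans h.gt
  have e : (12 * m' + 18) * (m'+1) = (m'+1) + ((m'+1) + ((m'+1) + ((m'+1) + ((2 * (m'+1) + (2 * (m'+1)) * (5 + 6 * m')) + ((m'+1) + (m'+1)))))) := by ring
  rw [e, k3]
  have hk := k2_pos m' (2 * (m'+1))
  have p1 := pickA h (fun Y : Fin (m'+1) → V => ∀ i, Gu m' Ed A p θ (Y i) ∧ (A (Y i) ↔ A (M1 i))) [] (by simp) (by simp)
  simp only [List.length_nil, Nat.cast_zero, zero_add, one_mul] at p1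
  have q1 := same_dens h hθ M1
  have q2 := same_dens h hθ M2
  refine cnt_pick (by positivity) (le_trans (by linarith) p1) ?_
  rintro Y1 ⟨hY1, gY1, -⟩
  have cY1 : cl A (mt Y1) = p + a := (same_cl Y1 M1 fun i => (hY1 i).2).trans hM1
  have p2 := pickA h (fun Y : Fin (m'+1) → V => ∀ i, Gu m' Ed A p θ (Y i) ∧ (A (Y i) ↔ A (M2 i))) [Y1] (by simp [gY1]) (by
    intro z hz y hy
    rw [List.mem_singleton] at hz; subst hz
    rw [cY1, (same_cl y M2 fun i => (hy i).2).trans hM2, z2])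
  simp only [List.length_singleton, Nat.cast_one] at p2
  refine cnt_pick (by positivity) (le_trans (by linarith) p2) ?_
  rintro Y2 ⟨hY2, gY2, aY2⟩
  simp at aY2
  have cY2 : cl A (mt Y2) = a := (same_cl Y2 M2 fun i => (hY2 i).2).trans hM2
  refine cnt_pick (by positivity) (pick_class h hθ a [Y1] (by simp) (by simp [StC, gY1, cY1])) ?_
  rintro Z ⟨hZ, aZ⟩
  simp at aZ
  refine cnt_pick (by positivity) (pick_class h hθ (p + a) [Y2, Z] (by simp) (by rw [z3]; simp [StC, gY2, cY2]; exact hZ)) ?_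
  rintro Z' ⟨hZ', aZ'⟩
  simp at aZ'
  obtain ⟨L, hL⟩ : ∃ L : List (V × V), L = List.ofFn (fun i => (Y1 i, M1 i)) ++ List.ofFn (fun i => (Y2 i, M2 i)) := ⟨_, rfl⟩
  have hLl : L.length = 2 * (m'+1) := by rw [hL]; simp; ring
  have hs := E_swaps h hm hθ hθ2 a L (by
    intro z hz
    rw [hL, List.mem_append, List.mem_ofFn, List.mem_ofFn] at hz
    rcases hz with ⟨i, rfl⟩ | ⟨i, rfl⟩
    · exact hY1 i
    · exact hY2 i)
  have mtof : ∀ f : Fin (m'+1) → V, ((List.ofFn f : List V) : Multiset V) = mt f := by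
    intro f
    unfold mt
    rw [List.ofFn_eq_map]
    rfl
  have hfst : ((L.map Prod.fst : List V) : Multiset V) = mt Y1 + mt Y2 := by
    rw [hL, List.map_append, List.map_ofFn, List.map_ofFn, ← Multiset.coe_add, mtof, mtof]; rfl
  have hsnd : ((L.map Prod.snd : List V) : Multiset V) = mt M1 + mt M2 := by
    rw [hL, List.map_append, List.map_ofFn, List.map_ofFn, ← Multiset.coe_add, mtof, mtof]; rfl
  rw [hLl, hfst, hsnd] at hs
  refine cnt_bind (by positivity) hs ?_
  rintro s1 ⟨Q1, Q1', ⟨g1, ⟨x1, hx1, sx1⟩, ⟨y1, hy1, ey1⟩⟩, v1, r1, v1'⟩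
  refine (E_conn h hθ a Z' x1 hZ' sx1).trans (cnt_mono ?_)
  rintro s3 _ ⟨K, hK, rfl⟩
  have hZZ : List.IsChain (AdjC Ed A p) [Z, Z'] := by simp [aZ']
  have hZZ' : List.IsChain (AdjC Ed A p) [Z, Y1, Y2, Z'] := by simp [aZ.symm, aY2, aZ']
  refine ⟨[Z, Z'] ++ (K ++ Q1), [Z, Y1, Y2, Z'] ++ (K ++ Q1'), ⟨glue hZZ rfl g1 hx1 hK, ⟨Z, rfl, hZ⟩,
    ⟨y1, getLast?_glue (getLast?_glue hy1), ey1⟩⟩, ?_, ⟨glue hZZ' rfl r1.1 (r1.2.1.trans hx1) hK, rfl, ?_⟩, ?_⟩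
  · simp [v1]; abel
  · rw [getLast?_glue (getLast?_glue (r1.2.2.trans hy1)), getLast?_glue (getLast?_glue hy1)]
  · simp [v1']; abel

end
end HC
end

section
open Finset
open scoped Classical
namespace HC

section
variable {V : Type} [Fintype V] {m' : ℕ} {Ed : Multiset V → Prop} {A : V → Prop} {p : ZMod 2} {θ : ℝ}

lemma pr_mem_countP (B : V → Prop) (R : Multiset V) (hR : R.Nodup) (ρ : ℝ) (hV : 0 < Fintype.card V) (h : ρ * Fintype.card V ≤ R.countP B) :
    ρ ≤ pr (fun v => v ∈ R ∧ B v) := by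
  unfold pr
  rw [le_div_iff₀ (by exact_mod_cast hV)]
  refine h.trans ?_
  have : (Finset.univ.filter (fun v => v ∈ R ∧ B v)) = (R.filter B).toFinset := by
    ext v; simp
  have h2 : (R.filter B).toFinset.card = R.countP B := by
    rw [Multiset.toFinset_card_of_nodup (hR.filter _), Multiset.countP_eq_card_filter]
  rw [← h2]
  apply le_of_eq
  congr 2
  ext v; simp

lemma countP_step (j : ℕ) {m : ℕ} (hj : j ≤ m) (y : Fin m → V) (h : ∀ i : Fin m, (A (y i) ↔ i.1 < j)) : (mt y).countP A = j := by
  unfold mt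
  rw [Multiset.countP_map]
  have h1 : Finset.univ.val.filter (fun a => A (y a)) = (Finset.univ.filter (fun i : Fin m => i.1 < j)).val := by
    rw [Finset.filter_val]
    exact Multiset.filter_congr fun i _ => h i
  rw [h1, Finset.card_val]
  have h2 : (Finset.univ.filter (fun i : Fin m => i.1 < j)).card = (Finset.range j).card := by
    apply Finset.card_bij (fun i _ => i.1)
    · intro i hi; simpa using hi
    · intro i _ i' _ h; exact Fin.ext h
    · intro b hb
      rw [Finset.mem_range] at hb
      exact ⟨⟨b, by omega⟩, by simpa using hb, rfl⟩
  rw [h2, Finset.card_range]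

lemma step (h : EG m' Ed A p θ) (R : Multiset V) (hR : R.Nodup) (ρ : ℝ) (hρ : 0 ≤ ρ)
    (hA : ρ * Fintype.card V ≤ R.countP A) (hB : ρ * Fintype.card V ≤ R.countP (fun v => ¬ A v)) (hθ : 3 * θ < ρ ^ (m'+1))
    (a : ZMod 2) (L : List (Fin (m'+1) → V)) (hl : L.length ≤ 2) (hne : L ≠ [])
    (hL : ∀ z ∈ L, StC Ed A p θ (p + a) z) (j : ℕ) (hj : j ≤ m'+1) (hja : (j : ZMod 2) = a) :
    ∃ c, StC Ed A p θ a c ∧ (∀ z ∈ L, AdjC Ed A p z c) ∧ mt c ≤ R ∧ (mt c).countP A = j := by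
  haveI := h.ne
  have hθ0 : 0 ≤ θ := (pr_nonneg _).trans h.gt
  have hV : 0 < Fintype.card V := Fintype.card_pos
  have h1 := pr_pi (V := V) (q := m'+1) (fun i v => v ∈ R ∧ (A v ↔ i.1 < j)) ρ hρ (by
    intro i
    by_cases hi : i.1 < j
    · simp only [hi, iff_true]; exact pr_mem_countP A R hR ρ hV hA
    · simp only [hi, iff_false]; exact pr_mem_countP (fun v => ¬ A v) R hR ρ hV (by convert hB))
  have hcl : ∀ y : Fin (m'+1) → V, (∀ i, y i ∈ R ∧ (A (y i) ↔ i.1 < j)) → (mt y).countP A = j :=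
    fun y hy => countP_step j hj y fun i => (hy i).2
  have h2 := pickA h (fun y => ∀ i, y i ∈ R ∧ (A (y i) ↔ i.1 < j)) L (fun z hz => (hL z hz).1) (by
    intro z hz y hy
    rw [(hL z hz).2]
    have : cl A (mt y) = a := by unfold cl; rw [hcl y hy, hja]
    rw [this, z2])
  have h3 : ((L.length : ℝ) + 1) * θ ≤ 3 * θ := by
    have : (L.length : ℝ) ≤ 2 := by exact_mod_cast hl
    gcongr; linarith
  obtain ⟨c, c1, c2, c3⟩ := exists_of_pr_pos (lt_of_lt_of_le (by linarith) h2)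
  refine ⟨c, ⟨c2, by unfold cl; rw [hcl c c1, hja]⟩, c3, ?_, hcl c c1⟩
  obtain ⟨z, hz⟩ := List.exists_mem_of_ne_nil L hne
  have hn : (mt c).Nodup := (adj_nodup h.nd (c3 z hz).1).2
  rw [Multiset.le_iff_subset hn]
  intro v hv
  rw [mem_mt] at hv
  obtain ⟨i, rfl⟩ := hv
  exact (c1 i).1

def Inv (A : V → Prop) (R : Multiset V) : Prop := R.Nodup ∧ R.card ≤ 3 * R.countP A ∧ R.card ≤ 3 * R.countP (fun v => ¬ A v)

lemma par_choice (q : ℕ) (a : ZMod 2) : ∃ j, (j = q + 1 ∨ j = q) ∧ (j : ZMod 2) = a := by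
  have hz : ∀ x b : ZMod 2, x + 1 = b ∨ x = b := by decide
  rcases hz (q : ZMod 2) a with h | h
  · exact ⟨q + 1, Or.inl rfl, by push_cast; exact h⟩
  · exact ⟨q, Or.inr rfl, h⟩

lemma stepI (h : EG m' Ed A p θ) (hm : 2 ≤ m') (R : Multiset V) (hR : Inv A R) (ρ : ℝ) (hρ : 0 ≤ ρ)
    (hRc : ρ * Fintype.card V ≤ R.card) (hR4 : 4 * (m'+1) ≤ R.card) (hθ : 3 * θ < (ρ/3) ^ (m'+1))
    (a : ZMod 2) (L : List (Fin (m'+1) → V)) (hl : L.length ≤ 2) (hne : L ≠ [])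
    (hL : ∀ z ∈ L, StC Ed A p θ (p + a) z) :
    ∃ c R', StC Ed A p θ a c ∧ (∀ z ∈ L, AdjC Ed A p z c) ∧ mt c + R' = R ∧ Inv A R' := by
  obtain ⟨h1, h2, h3⟩ := hR
  have h2' : (R.card : ℝ) ≤ 3 * R.countP A := by exact_mod_cast h2
  have h3' : (R.card : ℝ) ≤ 3 * R.countP (fun v => ¬ A v) := by exact_mod_cast h3
  have hsum := Multiset.card_eq_countP_add_countP A R
  obtain ⟨j, hj1, hj2, hj3⟩ : ∃ j : ℕ, j ≤ m'+1 ∧ (j : ZMod 2) = a ∧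
      ((R.countP (fun v => ¬ A v) ≤ R.countP A ∧ m' ≤ j) ∨ (R.countP A ≤ R.countP (fun v => ¬ A v) ∧ j ≤ 1)) := by
    rcases le_total (R.countP (fun v => ¬ A v)) (R.countP A) with hle | hle
    · obtain ⟨j, hj, hja⟩ := par_choice m' a
      exact ⟨j, by omega, hja, Or.inl ⟨hle, by omega⟩⟩
    · obtain ⟨j, hj, hja⟩ := par_choice 0 a
      exact ⟨j, by omega, hja, Or.inr ⟨hle, by omega⟩⟩
  obtain ⟨c, c1, c2, c3, c4⟩ := step h R h1 (ρ/3) (by positivity) (by linarith) (by linarith) hθ a L hl hne hL j hj1 hj2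
  obtain ⟨R', rfl⟩ := Multiset.le_iff_exists_add.1 c3
  refine ⟨c, R', c1, c2, rfl, (Multiset.nodup_add.1 h1).2.1, ?_, ?_⟩
  all_goals
    have q1 := Multiset.card_eq_countP_add_countP A (mt c)
    have q3 : (mt c).card = m'+1 := by simp
    rw [Multiset.countP_add] at h2 h3 hj3
    rw [Multiset.countP_add] at hj3
    rw [Multiset.countP_add, Multiset.countP_add] at hsum
    rw [Multiset.card_add] at h2 h3 hR4 hsum
    omega

lemma greedy (h : EG m' Ed A p θ) (hm : 2 ≤ m') (ρ : ℝ) (hρ : 0 ≤ ρ) (hn : (4 * (m'+1) : ℕ) ≤ ρ * Fintype.card V)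
    (hθ : 3 * θ < (ρ/3) ^ (m'+1)) (a : ZMod 2) (s : ℕ) : ∀ (R : Multiset V) (y : Fin (m'+1) → V), Inv A R → StC Ed A p θ (p + a) y →
    ρ * Fintype.card V + (2 * (m'+1) * s : ℕ) ≤ R.card →
    ∃ Q R' y', Q.length = 2 * s ∧ List.IsChain (AdjC Ed A p) (y :: Q) ∧ (y :: Q).getLast? = some y' ∧ StC Ed A p θ (p + a) y' ∧
      vs Q + R' = R ∧ Inv A R' := by
  induction s with
  | zero =>
    intro R y hR hy _
    exact ⟨[], R, y, by simp, by simp, by simp, hy, by simp, hR⟩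
  | succ s ih =>
    intro R y hR hy hc
    have hc' : ρ * Fintype.card V + (2 * (m'+1) : ℕ) + (2 * (m'+1) * s : ℕ) ≤ R.card := by
      refine le_trans (le_of_eq ?_) hc
      push_cast; ring
    have hs0 : (0:ℝ) ≤ (2 * (m'+1) * s : ℕ) := by positivity
    have hm0 : (0:ℝ) ≤ (2 * (m'+1) : ℕ) := by positivity
    obtain ⟨c, R1, c1, c2, rfl, c4⟩ := stepI h hm R hR ρ hρ (by linarith) (by
      have : ((4 * (m'+1) : ℕ) : ℝ) ≤ R.card := by push_cast; push_cast at hn hc'; linarith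
      exact_mod_cast this) hθ a [y] (by simp) (by simp) (by simpa using hy)
    rw [Multiset.card_add, card_mt, Fintype.card_fin] at hc'
    have e0 : (0:ℝ) ≤ (m' : ℝ) := by positivity
    push_cast at hc' hn hs0
    obtain ⟨d, R2, d1, d2, rfl, d4⟩ := stepI h hm R1 c4 ρ hρ (by linarith) (by
      have : ((4 * (m'+1) : ℕ) : ℝ) ≤ R1.card := by push_cast; linarith
      exact_mod_cast this) hθ (p + a) [c] (by simp) (by simp) (by rw [z3]; simpa using c1)
    rw [Multiset.card_add, card_mt, Fintype.card_fin] at hc'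
    push_cast at hc'
    obtain ⟨Q, R', y', q1, q2, q3, q4, q5, q6⟩ := ih R2 d d4 d1 (by push_cast; linarith)
    simp at c2 d2
    refine ⟨c :: d :: Q, R', y', by simp [q1]; ring, ?_, ?_, q4, ?_, q6⟩
    · rw [List.isChain_cons_cons, List.isChain_cons_cons]
      exact ⟨c2, d2, q2⟩
    · rw [List.getLast?_cons_cons, List.getLast?_cons_cons]; exact q3
    · rw [vs_cons, vs_cons, ← q5]; abel

lemma chain_cl {m : ℕ} (k : ℕ) : ∀ l : List (Fin m → V), List.IsChain (AdjC Ed A p) l → l.length = 2 * k → cl A (vs l) = k • p := by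
  induction k with
  | zero => 
    intro l _ hl
    have : l = [] := List.length_eq_zero_iff.1 (by omega)
    subst this; simp
  | succ k ih =>
    intro l hc hl
    match l, hl with
    | [], hl => simp at hl
    | [_], hl => simp at hl; omega
    | x :: y :: l, hl =>
      have h1 := ih l (hc.tail.tail) (by simp at hl; omega)
      rw [vs_cons, vs_cons, cl_add, cl_add, h1, ← add_assoc, (List.isChain_cons_cons.1 hc).1.2, add_smul, one_smul, add_comm]

lemma exists_sub (W : Multiset V) (j : ℕ) (hj : j ≤ W.card) : ∃ S ≤ W, S.card = j := by
  refine ⟨(W.toList.take j : List V), ?_, ?_⟩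
  · conv_rhs => rw [← Multiset.coe_toList W]
    exact Multiset.coe_le.2 (List.take_sublist _ _).subperm
  · simp [hj]

lemma pick1 (hm : 1 ≤ m') (W : Multiset V) (s : ℕ) (hs : 1 ≤ s) (hW : W.card = (m'+1) * (s+1)) (hA : s ≤ W.countP A)
    (hB : s ≤ W.countP (fun v => ¬ A v)) (b : ZMod 2) :
    ∃ (c : Fin (m'+1) → V) (W' : Multiset V), mt c + W' = W ∧ cl A (mt c) = b ∧ W'.card = (m'+1) * s ∧ s ≤ W'.countP A + 1 ∧ s ≤ W'.countP (fun v => ¬ A v) + 1 := by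
  have hsum := Multiset.card_eq_countP_add_countP A W
  obtain ⟨s, rfl⟩ : ∃ s', s = s' + 1 := ⟨s - 1, by omega⟩
  obtain ⟨q, rfl⟩ : ∃ q, m' = q + 1 := ⟨m' - 1, by omega⟩
  have hqs : (q+1+1) * (s + 1 + 1) = q * s + 2 * q + 2 * s + 4 := by ring
  have hqs0 : 0 ≤ q * s := Nat.zero_le _
  obtain ⟨j, hj1, hj2, hj3⟩ : ∃ j : ℕ, j ≤ q+1+1 ∧ (j : ZMod 2) = b ∧
      ((W.countP (fun v => ¬ A v) ≤ W.countP A ∧ q+1 ≤ j) ∨ (W.countP A ≤ W.countP (fun v => ¬ A v) ∧ j ≤ 1)) := by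
    rcases le_total (W.countP (fun v => ¬ A v)) (W.countP A) with hle | hle
    · obtain ⟨j, hj, hja⟩ := par_choice (q+1) b
      exact ⟨j, by omega, hja, Or.inl ⟨hle, by omega⟩⟩
    · obtain ⟨j, hj, hja⟩ := par_choice 0 b
      exact ⟨j, by omega, hja, Or.inr ⟨hle, by omega⟩⟩
  rw [hqs] at hW
  obtain ⟨S, hS, hSc⟩ := exists_sub (W.filter A) j (by rw [← Multiset.countP_eq_card_filter]; omega)
  obtain ⟨S', hS', hSc'⟩ := exists_sub (W.filter (fun v => ¬ A v)) (q+1+1-j) (by rw [← Multiset.countP_eq_card_filter]; omega)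
  have hle : S + S' ≤ W := by
    rw [← Multiset.filter_add_not A W]
    exact add_le_add hS hS'
  obtain ⟨c, hc⟩ := exists_mt (q := q+1+1) (S + S') (by rw [Multiset.card_add, hSc, hSc']; omega)
  obtain ⟨W', rfl⟩ := Multiset.le_iff_exists_add.1 hle
  have cS : S.countP A = j := by
    rw [← hSc, Multiset.countP_eq_card]
    intro v hv; exact (Multiset.mem_filter.1 (Multiset.mem_of_le hS hv)).2
  have cS' : S'.countP A = 0 := by
    rw [Multiset.countP_eq_zero]
    intro v hv; exact (Multiset.mem_filter.1 (Multiset.mem_of_le hS' hv)).2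
  have tS := Multiset.card_eq_countP_add_countP A S
  have tS' := Multiset.card_eq_countP_add_countP A S'
  refine ⟨c, W', by rw [hc], ?_, ?_, ?_, ?_⟩
  · rw [hc]; unfold cl; rw [Multiset.countP_add, cS, cS', add_zero, hj2]
  · rw [Multiset.card_add, Multiset.card_add] at hW
    have : (q+1+1) * (s + 1) = q * s + q + 2 * s + 2 := by ring
    omega
  all_goals
    rw [Multiset.countP_add, Multiset.countP_add] at hA hB hj3 
    rw [Multiset.countP_add, Multiset.countP_add] at hj3
    rw [Multiset.countP_add, Multiset.countP_add, Multiset.countP_add, Multiset.countP_add] at hsum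
    rw [Multiset.card_add, Multiset.card_add] at hsum hW
    omega

abbrev ETask (V : Type) [Fintype V] (m : ℕ) (A : V → Prop) (p a : ZMod 2) : Type :=
  {z : (Fin m → V) × (Fin m → V) // cl A (mt z.1) = p + a ∧ cl A (mt z.2) = a}


def etk {m : ℕ} {A : V → Prop} {p a : ZMod 2} (i : ETask V m A p a) : Multiset V := mt i.1.1 + mt i.1.2

lemma card_ETask (m : ℕ) (A : V → Prop) (p a : ZMod 2) : Fintype.card (ETask V m A p a) ≤ (Fintype.card V) ^ (2 * m) := by
  have : Fintype.card (ETask V m A p a) ≤ Fintype.card ((Fin m → V) × (Fin m → V)) :=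
    Fintype.card_le_of_injective (fun i => i.1) Subtype.val_injective
  refine this.trans ?_
  simp [two_mul, pow_add]

lemma esplit (hm : 1 ≤ m') (a : ZMod 2) (j : ℕ) : ∀ W : Multiset V, W.card = (m'+1) * (2 * j) → cl A W = j • p → 
    2 * j ≤ W.countP A + 1 → 2 * j ≤ W.countP (fun v => ¬ A v) + 1 →
    ∃ L : List (ETask V (m'+1) A p a), (L.map etk).sum = W ∧ L.length = j := by
  induction j with
  | zero =>
    intro W hW _ _ _
    have : W = 0 := by simpa using hW
    exact ⟨[], by simp [this], by simp⟩
  | succ j ih =>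
    intro W hW hcl hA hB
    obtain ⟨c, W1, rfl, hc, hW1, hA1, hB1⟩ := pick1 (A := A) hm W (2*j+1) (by omega) (by rw [hW]; ring) (by omega) (by omega) (p + a)
    rcases Nat.eq_zero_or_pos j with rfl | hj
    · obtain ⟨d, rfl⟩ := exists_mt (q := m'+1) W1 (by rw [hW1]; ring)
      have hd : cl A (mt d) = a := by
        rw [cl_add, hc] at hcl
        simp at hcl
        have hz : ∀ p a x : ZMod 2, p + a + x = p → x = a := by decide
        exact hz _ _ _ hcl
      exact ⟨[⟨(c, d), hc, hd⟩], by simp [etk], rfl⟩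
    · obtain ⟨d, W2, rfl, hd, hW2, hA2, hB2⟩ := pick1 (A := A) hm W1 (2*j) (by omega) (by rw [hW1]) (by omega) (by omega) a
      obtain ⟨L, hL, hLl⟩ := ih W2 hW2 (by
        rw [cl_add, cl_add, hc, hd, add_smul, one_smul] at hcl
        have hz : ∀ p a x y : ZMod 2, p + a + (a + x) = y + p → x = y := by decide
        exact hz _ _ _ _ hcl) hA2 hB2
      exact ⟨⟨(c, d), hc, hd⟩ :: L, by simp [etk, hL]; abel, by simp [hLl]⟩

end
end HC
end

section
open Finset
open scoped Classical
namespace HC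

section
variable {V : Type} [Fintype V] {m' : ℕ} {Ed : Multiset V → Prop} {A : V → Prop} {p : ZMod 2} {θ : ℝ}

lemma E_fill (h : EG m' Ed A p θ) (hm : 2 ≤ m') (ρ : ℝ) (hρ : 0 ≤ ρ) (hn : (4 * (m'+1) : ℕ) ≤ ρ * Fintype.card V)
    (hθ : 3 * θ < (ρ/3) ^ (m'+1)) (a : ZMod 2) (R : Multiset V) (y f0 : Fin (m'+1) → V) (hR : Inv A R)
    (hy : StC Ed A p θ (p + a) y) (hf : StC Ed A p θ a f0) (hc : ρ * Fintype.card V + (2 * (m'+1) : ℕ) ≤ R.card) :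
    ∃ Q W s, Q.length = 2 * s ∧ List.IsChain (AdjC Ed A p) (y :: (Q ++ [f0])) ∧ vs Q + W = R ∧ Inv A W ∧ (W.card : ℝ) ≤ 2 * (ρ * Fintype.card V) := by
  obtain ⟨X, hX⟩ : ∃ X : ℝ, X = ((R.card : ℝ) - ρ * Fintype.card V - (2 * (m'+1) : ℕ)) := ⟨_, rfl⟩
  obtain ⟨D, hD⟩ : ∃ D : ℝ, D = (2 * (m'+1) : ℕ) := ⟨_, rfl⟩
  have hD0 : 0 < D := by rw [hD]; positivity
  have hX0 : 0 ≤ X := by linarith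
  obtain ⟨s, hs⟩ : ∃ s, s = ⌊X / D⌋₊ := ⟨_, rfl⟩
  have s1 : (s : ℝ) * D ≤ X := by
    rw [← le_div_iff₀ hD0, hs]; exact Nat.floor_le (by positivity)
  have s2 : X < (s + 1) * D := by
    rw [← div_lt_iff₀ hD0, hs]; exact Nat.lt_floor_add_one _
  have e1 : ((2 * (m'+1) * s : ℕ) : ℝ) = s * D := by rw [hD]; push_cast; ring
  obtain ⟨Q, R1, y', q1, q2, q3, q4, rfl, q6⟩ := greedy h hm ρ hρ hn hθ a s R y hR hy (by rw [e1]; linarith)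
  have hcQ : ((vs Q).card : ℝ) = s * D := by rw [card_vs, q1, hD]; push_cast; ring
  rw [Multiset.card_add] at hX
  push_cast [hcQ] at hX
  push_cast at hD hn
  have hR1 : ρ * Fintype.card V + D ≤ R1.card := by linarith
  obtain ⟨d, R2, d1, d2, rfl, d4⟩ := stepI h hm R1 q6 ρ hρ (by linarith) (by
      have : ((4 * (m'+1) : ℕ) : ℝ) ≤ R1.card := by push_cast; linarith
      exact_mod_cast this) hθ a [y'] (by simp) (by simp) (by simpa using q4)
  rw [Multiset.card_add, card_mt, Fintype.card_fin] at hR1 hX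
  push_cast at hR1 hX
  have hm0 : (0:ℝ) ≤ m' := by positivity
  obtain ⟨e, R3, e1, e2, rfl, e4⟩ := stepI h hm R2 d4 ρ hρ (by linarith) (by
      have : ((4 * (m'+1) : ℕ) : ℝ) ≤ R2.card := by push_cast; linarith
      exact_mod_cast this) hθ (p + a) [d, f0] (by simp) (by simp) (by rw [z3]; simp [d1, hf])
  rw [Multiset.card_add, card_mt, Fintype.card_fin] at hX
  push_cast at hX
  refine ⟨Q ++ [d, e], R3, s + 1, by simp [q1]; ring, ?_, by simp; abel, e4, by linarith⟩
  simp at d2 e2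
  have hch := glue (Q1 := y :: Q) (Q2 := [f0]) (C := [d, e]) (x := f0) q2 q3 (by simp) (by simp) (by simp [d2, e2.1, e2.2.symm])
  simpa using hch

end

lemma E_final (m' : ℕ) (hm : 2 ≤ m') : ∃ θ0 : ℝ, 0 < θ0 ∧ θ0 ≤ 1/100 ∧ ∃ n0 : ℕ, ∀ (V : Type) [Fintype V], n0 ≤ Fintype.card V →
    ∀ (Ed : Multiset V → Prop) (A : V → Prop) (p : ZMod 2) (θ : ℝ), θ ≤ θ0 → EG m' Ed A p θ →
    ∀ (a : ZMod 2) (F : List (Fin (m'+1) → V)) (f0 f1 : Fin (m'+1) → V) (j : ℕ), List.IsChain (Adj Ed) F → (vs F).Nodup → F.length ≤ 10 →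
      F.head? = some f0 → StC Ed A p θ a f0 → F.getLast? = some f1 → StC Ed A p θ (p + a) f1 →
      Fintype.card V = (m'+1) * (F.length + 2 * j) → cl A (Finset.univ.val : Multiset V) = cl A (vs F) + j • p → HamCyc (m'+1) Ed := by
  obtain ⟨c, hc, hc1, hc2⟩ : ∃ c : ℝ, 0 < c ∧ c ≤ k3 m' ∧ c ≤ 1/16 :=
    ⟨min (k3 m') (1/16), lt_min (k3_pos m') (by norm_num), min_le_left _ _, min_le_right _ _⟩
  have hM0 : (0:ℝ) < (m' + 1 : ℕ) := by positivity
  obtain ⟨β, hβ, n1, hAL⟩ := AL' (m'+1) (12 * m' + 18) ((m'+1) + (m'+1)) (2 * (m'+1)) (by omega) (by omega) c (1 / (100 * (m'+1 : ℕ))) hc (by positivity)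
  obtain ⟨ρ, hρ, hρ1, hρ2⟩ : ∃ ρ : ℝ, 0 < ρ ∧ ρ ≤ β ∧ ρ ≤ 1/100 :=
    ⟨min β (1/100), lt_min hβ (by norm_num), min_le_left _ _, min_le_right _ _⟩
  obtain ⟨θ0, hθ0, t1, t2, t3, t4⟩ : ∃ θ0 : ℝ, 0 < θ0 ∧ θ0 ≤ 1/100 ∧ θ0 ≤ k0 m' / 8 ∧ 3 * θ0 ≤ (1/4 : ℝ)^(m'+1)/2 ∧ 3 * θ0 < (ρ/3)^(m'+1) := by
    have := k0_pos m'
    have b1 : (0:ℝ) < (1/4 : ℝ)^(m'+1)/6 := by positivity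
    have b2 : (0:ℝ) < (ρ/3)^(m'+1)/4 := by positivity
    refine ⟨min (1/100) (min (k0 m'/8) (min ((1/4 : ℝ)^(m'+1)/6) ((ρ/3)^(m'+1)/4))), by positivity, min_le_left _ _, ?_, ?_, ?_⟩
    · exact (min_le_right _ _).trans (min_le_left _ _)
    · have := ((min_le_right (1/100) (min (k0 m'/8) (min ((1/4 : ℝ)^(m'+1)/6) ((ρ/3)^(m'+1)/4)))).trans (min_le_right _ _)).trans (min_le_left _ _)
      linarith
    · have := ((min_le_right (1/100) (min (k0 m'/8) (min ((1/4 : ℝ)^(m'+1)/6) ((ρ/3)^(m'+1)/4)))).trans (min_le_right _ _)).trans (min_le_right _ _)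
      linarith
  refine ⟨θ0, hθ0, t1, n1 + ⌈(10 * (m'+1 : ℕ) / ρ : ℝ)⌉₊ + 1000 * ((m'+1) * (m'+1)), ?_⟩
  intro V _ hV Ed A p θ hθ hEG a F f0 f1 j hF hFn hF10 hf0 hf0' hf1 hf1' hcard hcl
  have hne := hEG.ne
  obtain ⟨n, hn⟩ : ∃ n : ℝ, n = Fintype.card V := ⟨_, rfl⟩
  obtain ⟨M, hM⟩ : ∃ M : ℝ, M = (m' + 1 : ℕ) := ⟨_, rfl⟩
  have hM3 : 3 ≤ M := by rw [hM]; exact_mod_cast (by omega : 3 ≤ m' + 1)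
  have hn2 : 1000 * (M * M) ≤ n := by
    have h0 : 1000 * ((m'+1) * (m'+1)) ≤ Fintype.card V := le_trans (Nat.le_add_left _ _) hV
    have h0' := (Nat.cast_le (α := ℝ)).2 h0
    rw [hn, hM]
    push_cast at h0' ⊢; linarith
  have hn3 : 10 * M ≤ ρ * n := by
    have : (10 * M / ρ : ℝ) ≤ n := by
      rw [hn, hM]
      exact (Nat.le_ceil _).trans ((Nat.cast_le (α := ℝ)).2 (by omega))
    rwa [div_le_iff₀ hρ, mul_comm n] at this
  have hn0 : 0 < n := by nlinarith
  have hFc : ((vs F).card : ℝ) ≤ 10 * M := by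
    rw [card_vs, hM, mul_comm]; exact_mod_cast Nat.mul_le_mul_right _ hF10
  have hθ1 : θ ≤ 1/100 := hθ.trans t1
  haveI : Nonempty (ETask V (m'+1) A p a) := by
    obtain ⟨x, hx⟩ := exists_of_pr_pos (lt_of_lt_of_le (by norm_num) (class_dens hEG (p + a)))
    obtain ⟨y, hy⟩ := exists_of_pr_pos (lt_of_lt_of_le (by norm_num) (class_dens hEG a))
    exact ⟨⟨(x, y), hx, hy⟩⟩
  obtain ⟨P, ⟨hPc, ⟨x0, hx0, hx0'⟩, ⟨y0, hy0, hy0'⟩⟩, hPF, hPs, ⟨N, hN⟩, hPabs⟩ := hAL V (by omega) (AdjC Ed A p) (StC Ed A p θ a) (StC Ed A p θ (p + a))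
    (fun y x hy hx => by
      have := E_conn hEG hθ1 a y x hy hx
      linarith) (ETask V (m'+1) A p a) (card_ETask _ _ _ _) etk
    (fun i => hc1.trans (E_abs hEG hm hθ1 (hθ.trans t2) (by linarith) a i.1.1 i.1.2 i.2.1 i.2.2))
    (vs F) hFn (by rw [← hn]; nlinarith)
  rw [← hM, ← hn] at hPs
  have hPs' : M * (vs P).card ≤ n / 100 := by
    have := mul_le_mul_of_nonneg_left hPs (by linarith : 0 ≤ M)
    refine this.trans (le_of_eq ?_)
    field_simp
  have hcon := E_conn hEG hθ1 a f1 x0 hf1' hx0'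
  obtain ⟨S, hSc, ⟨C, hC, rfl⟩, hSn⟩ := exists_of_cnt (vs P + vs F) hPF hcon (by
    rw [Multiset.card_add, ← hn]
    push_cast
    have : ((m' : ℝ) + 1) = M := by rw [hM]; push_cast; ring
    rw [this]
    nlinarith)
  have hCl : C.length = 2 * 1 := by
    rw [card_vs] at hSc
    have : (m'+1) * C.length = (m'+1) * 2 := by rw [hSc]; ring
    exact Nat.eq_of_mul_eq_mul_left (by omega) this
  obtain ⟨R, hR⟩ : ∃ R : Multiset V, (vs C + (vs P + vs F)) + R = Finset.univ.val := by
    obtain ⟨R, hR⟩ := Multiset.le_iff_exists_add.1 ((Multiset.le_iff_subset hSn).2 (fun v _ => Finset.mem_univ v) : vs C + (vs P + vs F) ≤ Finset.univ.val)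
    exact ⟨R, hR.symm⟩
  have hRn : R.Nodup := by
    have : (Finset.univ.val : Multiset V).Nodup := Finset.univ.nodup
    rw [← hR] at this
    exact (Multiset.nodup_add.1 this).2.1
  have cR := congrArg Multiset.card hR
  have cA := congrArg (Multiset.countP A) hR
  have cB := congrArg (Multiset.countP (fun v => ¬ A v)) hR
  have uA : pr A * n = (Multiset.countP A (Finset.univ.val : Multiset V) : ℝ) := by
    unfold pr; rw [hn, Multiset.countP_eq_card_filter]
    rw [div_mul_cancel₀ _ (by rw [← hn]; exact hn0.ne')]
    rfl
  have usum := Multiset.card_eq_countP_add_countP A (Finset.univ.val : Multiset V)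
  have ucard : (Finset.univ.val : Multiset V).card = Fintype.card V := rfl
  rw [Multiset.countP_add] at cA cB
  rw [Multiset.card_add] at cR
  have lA : Multiset.countP A (vs C + (vs P + vs F)) ≤ (vs C + (vs P + vs F)).card := Multiset.countP_le_card _ _
  have lB : Multiset.countP (fun v => ¬ A v) (vs C + (vs P + vs F)) ≤ (vs C + (vs P + vs F)).card := Multiset.countP_le_card _ _
  have hsmall : ((vs C + (vs P + vs F)).card : ℝ) ≤ n / 50 := by
    rw [Multiset.card_add, Multiset.card_add, card_vs, hCl]
    push_cast
    have : ((m' : ℝ) + 1) = M := by rw [hM]; push_cast; ring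
    rw [this]
    nlinarith
  obtain ⟨Z, hZ⟩ : ∃ Z, Z = vs C + (vs P + vs F) := ⟨_, rfl⟩
  rw [← hZ] at cR cA cB lA lB hsmall
  have cR' : (Z.card : ℝ) + R.card = n := by rw [hn, ← ucard, ← cR]; push_cast; ring
  have cA' : (Z.countP A : ℝ) + R.countP A = pr A * n := by rw [uA, ← cA]; push_cast; ring
  have cB' : (Z.countP (fun v => ¬ A v) : ℝ) + R.countP (fun v => ¬ A v) = n - pr A * n := by
    rw [uA, hn, ← ucard, usum, ← cB, ← cA]; push_cast; ring
  have lA' : (Z.countP A : ℝ) ≤ Z.card := by exact_mod_cast lA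
  have lB' : (Z.countP (fun v => ¬ A v) : ℝ) ≤ Z.card := by exact_mod_cast lB
  have pA1 : 49/100 * n ≤ pr A * n := mul_le_mul_of_nonneg_right hEG.a1 hn0.le
  have pA2 : pr A * n ≤ 51/100 * n := mul_le_mul_of_nonneg_right hEG.a2 hn0.le
  have z0 : (0:ℝ) ≤ Z.card := by positivity
  have hInv : Inv A R := by
    refine ⟨hRn, ?_, ?_⟩
    · have : (R.card : ℝ) ≤ 3 * R.countP A := by linarith
      exact_mod_cast this
    · have : (R.card : ℝ) ≤ 3 * R.countP (fun v => ¬ A v) := by linarith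
      exact_mod_cast this
  have hρn : ρ * n ≤ 1/100 * n := mul_le_mul_of_nonneg_right hρ2 hn0.le
  have hMe : (m' : ℝ) + 1 = M := by rw [hM]; push_cast; ring
  obtain ⟨Q, W, s, q1, q2, rfl, q4, q5⟩ := E_fill hEG hm ρ hρ.le (by push_cast; rw [← hn, hMe]; linarith) (by linarith) a R y0 f0 hInv hy0' hf0' (by
    push_cast; rw [← hn, hMe]; linarith)
  rw [← hn] at q5
  subst hZ
  -- parity
  obtain ⟨lp, hlp, hlp'⟩ : ∃ lp : ℕ, P.length = 2 * lp ∧ lp + 1 = N * (6 * m' + 10) := by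
    rw [card_vs] at hN
    have h1 : (m'+1) * (P.length + 2) = (m'+1) * (2 * (N * (6 * m' + 10))) := by
      calc (m'+1) * (P.length + 2) = (m'+1) * P.length + ((m'+1) + (m'+1)) := by ring
        _ = _ := by rw [hN]; ring
    have h2 := Nat.eq_of_mul_eq_mul_left (by omega) h1
    exact ⟨P.length / 2, by omega, by omega⟩
  have hWc : 2 + 2 * lp + 2 * s ≤ 2 * j ∧ W.card = (m'+1) * (2 * (j - 1 - lp - s)) := by
    rw [ucard, hcard] at cR
    rw [Multiset.card_add, Multiset.card_add, Multiset.card_add, card_vs, card_vs, card_vs, card_vs, hCl, hlp, q1] at cR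
    have h1 : (m'+1) * (2 + 2 * lp + 2 * s) + W.card = (m'+1) * (2 * j) := by
      have : (m'+1) * F.length + ((m'+1) * (2 + 2 * lp + 2 * s) + W.card) = (m'+1) * F.length + (m'+1) * (2 * j) := by
        rw [← mul_add, ← cR]; ring
      exact Nat.add_left_cancel this
    have h2 : 2 + 2 * lp + 2 * s ≤ 2 * j := by
      have h4 : (m'+1) * (2 + 2 * lp + 2 * s) ≤ (m'+1) * (2 * j) := by omega
      exact Nat.le_of_mul_le_mul_left h4 (by omega)
    refine ⟨h2, ?_⟩
    have h3 : 2 * j = (2 + 2 * lp + 2 * s) + 2 * (j - 1 - lp - s) := by omega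
    rw [h3, mul_add (m'+1) (2 + 2 * lp + 2 * s)] at h1
    exact Nat.add_left_cancel h1
  obtain ⟨jW, hjW⟩ : ∃ jW, jW = j - 1 - lp - s := ⟨_, rfl⟩
  have hj : j = 1 + lp + s + jW := by omega
  rw [← hjW] at hWc
  have hCc : List.IsChain (AdjC Ed A p) C := (hC.tail).left_of_append
  have hQc : List.IsChain (AdjC Ed A p) Q := (q2.tail).left_of_append
  have hclW : cl A W = jW • p := by
    rw [← hR] at hcl
    simp only [cl_add] at hcl
    rw [chain_cl 1 C hCc hCl, chain_cl lp P hPc hlp, chain_cl s Q hQc q1, hj] at hcl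
    simp only [add_smul] at hcl
    have hz : ∀ a b c d e w : ZMod 2, a + (b + c) + (d + w) = c + (a + b + d + e) → w = e := by decide
    exact hz _ _ _ _ _ _ hcl
  have hWm : 3 * (2 * jW) ≤ W.card := by
    rw [hWc.2]; exact Nat.mul_le_mul_right _ (by omega)
  obtain ⟨L, hL, hLl⟩ := esplit (A := A) (by omega) a jW W hWc.2 hclW (by have := q4.2.1; omega) (by have := q4.2.2; omega)
  obtain ⟨P', ⟨hP1, hP2, hP3⟩, hP4⟩ := hPabs L (by
    rw [hLl, ← hn]
    have h1 : (3 * (2 * jW) : ℝ) ≤ W.card := by exact_mod_cast hWm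
    have h2 : ρ * n ≤ β * n := mul_le_mul_of_nonneg_right hρ1 hn0.le
    have h3 : 0 < ρ * n := by positivity
    linarith)
  rw [hL] at hP4
  have hadj : ∀ x y : Fin (m'+1) → V, AdjC Ed A p x y → Adj Ed x y := fun _ _ h => h.1
  have g1 := glue (hF) hf1 (hP1.imp hadj) (hP2.trans hx0) (hC.imp hadj)
  have g2 := glue (Q2 := [f0]) g1 (getLast?_glue (getLast?_glue (hP3.trans hy0))) (by simp) (by simp) (q2.imp hadj)
  refine ⟨F ++ (C ++ P') ++ Q, f0, ?_, ?_, ?_⟩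
  · rw [List.append_assoc]; exact head?_glue hf0
  · simpa only [List.append_assoc] using g2
  · rw [← hR]
    simp only [vs_append, hP4]
    abel

end HC
end

section
open Finset
open scoped Classical
namespace HC

def Clo {V : Type} [Fintype V] (m' : ℕ) (Ed : Multiset V → Prop) (A : V → Prop) (p : ZMod 2) (θ : ℝ) : Prop :=
    ∀ (a : ZMod 2) (F : List (Fin (m'+1) → V)) (f0 f1 : Fin (m'+1) → V) (j : ℕ), List.IsChain (Adj Ed) F → (vs F).Nodup → F.length ≤ 10 →
      F.head? = some f0 → StC Ed A p θ a f0 → F.getLast? = some f1 → StC Ed A p θ (p + a) f1 →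
      Fintype.card V = (m'+1) * (F.length + 2 * j) → cl A (Finset.univ.val : Multiset V) = cl A (vs F) + j • p → HamCyc (m'+1) Ed

def HWp {V : Type} (m' : ℕ) (Ed : Multiset V → Prop) (A : V → Prop) (p : ZMod 2) : Prop :=
    ∀ S : Multiset V, S.Nodup → S.card = 2 * m' + 1 → 2 * m' ≤ S.countP A → cl A S + 1 = p → ∃ v, ¬ A v ∧ Ed (S + {v})

structure FX {V : Type} [Fintype V] (m' : ℕ) (Ed : Multiset V → Prop) (A : V → Prop) (p : ZMod 2) (θ c : ℝ) : Prop where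
  hm : 2 ≤ m'
  eg : EG m' Ed A p θ
  t1 : θ ≤ 1/100
  c0 : 0 < c
  c4 : c ≤ 1/20
  tc : θ ≤ c / 2
  nb : 100 * ((m'+1 : ℕ) : ℝ)^2 ≤ c * Fintype.card V
  A1 : 1/2 - θ ≤ pr A
  A2 : pr A ≤ 1/2 + θ
  deg : ∀ M : Fin (m'+1) → V, (mt M).Nodup → 1/2 - θ ≤ pr (fun y : Fin (m'+1) → V => Adj Ed M y)
  clo : Clo m' Ed A p θ

section
variable {V : Type} [Fintype V] {m' : ℕ} {Ed : Multiset V → Prop} {A : V → Prop} {p : ZMod 2} {θ c : ℝ}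

lemma FX.pickU (h : FX m' Ed A p θ c) (Q : (Fin (m'+1) → V) → Prop) (hQ : c ≤ pr Q) (U : Multiset V) (hU : U.Nodup) (hUc : U.card ≤ 20 * (m'+1)) :
    ∃ y, Q y ∧ Gd Ed A p θ y ∧ (mt y + U).Nodup := by
  have h1 := pr_and_not_ge Q (fun y => ¬ Gd Ed A p θ y)
  have h2 := h.eg.gt
  have h3 : c / 2 ≤ pr (fun y => Q y ∧ ¬ ¬ Gd Ed A p θ y) := by linarith [h.tc]
  have h4 := h3.trans (cnt_base _)
  have hM : (0:ℝ) < ((m'+1 : ℕ) : ℝ) := by positivity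
  obtain ⟨s, _, ⟨y, rfl, hy⟩, hs⟩ := exists_of_cnt U hU h4 (by
    have h5 : (U.card : ℝ) ≤ 20 * ((m'+1 : ℕ) : ℝ) := by exact_mod_cast hUc
    have := h.nb
    nlinarith)
  exact ⟨y, hy.1, not_not.1 hy.2, hs⟩

lemma FX.pick (h : FX m' Ed A p θ c) (a : ZMod 2) (L : List (Fin (m'+1) → V)) (hl : L.length ≤ 2)
    (hL : ∀ z ∈ L, StC Ed A p θ (p + a) z) (U : Multiset V) (hU : U.Nodup) (hUc : U.card ≤ 20 * (m'+1)) :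
    ∃ y, StC Ed A p θ a y ∧ (∀ z ∈ L, AdjC Ed A p z y) ∧ (mt y + U).Nodup := by
  obtain ⟨y, h1, h2, h3⟩ := h.pickU _ ((by linarith [h.c4] : c ≤ 1/4).trans (pick_class h.eg h.t1 a L hl hL)) U hU hUc
  exact ⟨y, h1.1, h1.2, h3⟩

/-- `p = 0`, odd number of tuples -/
lemma FX.odd0 (h : FX m' Ed A p θ c) (hp : p = 0) (j : ℕ) (ht : Fintype.card V = (m'+1) * (1 + 2 * j)) : HamCyc (m'+1) Ed := by
  subst hp
  obtain ⟨g, g1, -, g2⟩ := h.pick (cl A (Finset.univ.val : Multiset V)) [] (by simp) (by simp) 0 (by simp) (by simp)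
  refine h.clo (cl A (Finset.univ.val : Multiset V)) [g] g g j (by simp) (by simpa using g2) (by simp) (by simp) g1 (by simp) (by simpa using g1) (by simpa using ht) ?_
  simp [g1.2]

lemma FX.triv (h : FX m' Ed A p θ c) (j : ℕ) (ht : Fintype.card V = (m'+1) * (2 + 2 * j)) (hA : cl A (Finset.univ.val : Multiset V) = (j + 1) • p) : HamCyc (m'+1) Ed := by
  obtain ⟨g, g1, -, g2⟩ := h.pick 0 [] (by simp) (by simp) 0 (by simp) (by simp)
  obtain ⟨g', g1', ga, g2'⟩ := h.pick (p + 0) [g] (by simp) (by rw [z3]; simpa using g1) (mt g) (by simpa using g2) (by simp)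
  simp at ga
  refine h.clo 0 [g, g'] g g' j (by simpa using ga.1) (by simpa [add_comm] using g2') (by simp) (by simp) g1 (by simp) g1' (by simpa using ht) ?_
  rw [hA]
  simp only [vs_cons, vs_nil, cl_add, cl_zero, g1.2, g1'.2, add_smul, one_smul]
  ring

lemma FX.fixM (h : FX m' Ed A p θ c) (j : ℕ) (ht : Fintype.card V = (m'+1) * (4 + 2 * j)) (hA : cl A (Finset.univ.val : Multiset V) = j • p + 1)
    (M : Fin (m'+1) → V) (hM : c ≤ pr (fun y : Fin (m'+1) → V => Adj Ed M y ∧ cl A (mt M) + cl A (mt y) = p + 1)) : HamCyc (m'+1) Ed := by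
  have hMn : (mt M).Nodup := by
    obtain ⟨y, hy, -⟩ := exists_of_pr_pos (lt_of_lt_of_le h.c0 hM)
    exact (adj_nodup h.eg.nd hy).1
  obtain ⟨g1, ⟨a1, b1⟩, d1, n1⟩ := h.pickU _ hM (mt M) hMn (by simp)
  obtain ⟨g2, ⟨a2, b2⟩, d2, n2⟩ := h.pickU _ hM (mt g1 + mt M) n1 (by simp; omega)
  obtain ⟨q, hq⟩ : ∃ q, q = cl A (mt M) := ⟨_, rfl⟩
  rw [← hq] at b1 b2
  have hz : ∀ q p x : ZMod 2, q + x = p + 1 → x = p + (q + 1) := by decide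
  have s1 : StC Ed A p θ (p + (q + 1)) g1 := ⟨d1, hz _ _ _ b1⟩
  have s2 : StC Ed A p θ (p + (q + 1)) g2 := ⟨d2, hz _ _ _ b2⟩
  obtain ⟨g3, s3, a3, n3⟩ := h.pick (q+1) [g2] (by simp) (by simpa using s2) (mt g2 + (mt g1 + mt M)) n2 (by simp; omega)
  simp at a3
  refine h.clo (p + (q + 1)) [g1, M, g2, g3] g1 g3 j ?_ ?_ (by simp) (by simp) s1 (by simp) (by rw [z3]; exact s3) (by simpa using ht) ?_
  · simp [a1.symm, a2, a3.1]
  · have : vs [g1, M, g2, g3] = mt g3 + (mt g2 + (mt g1 + mt M)) := by simp; abel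
    rw [this]; exact n3
  · rw [hA]
    simp only [vs_cons, vs_nil, cl_add, cl_zero, s1.2, s2.2, s3.2, ← hq]
    have hz : ∀ p q x : ZMod 2, x + 1 = p + (q + 1) + (q + (p + (q + 1) + (q + 1 + 0))) + x := by decide
    exact hz _ _ _

lemma FX.class_up (h : FX m' Ed A p θ c) (a : ZMod 2) : pr (fun y : Fin (m'+1) → V => cl A (mt y) = a) ≤ 1/2 + θ := by
  haveI := h.eg.ne
  have h1 : pr (fun y : Fin (m'+1) → V => cl A (mt y) = a) = cnt V (m'+1) (fun s => cl A s = a) := rfl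
  rw [h1, cnt_succ]
  have hθ0 : 0 ≤ θ := (pr_nonneg _).trans h.eg.gt
  refine pr_prod_le (q := fun (f : Fin m' → V) v => cl A (mt f + {v}) = a) (by linarith) ?_
  intro f
  have hn := pr_not A
  have hz : ∀ x a : ZMod 2, x ≠ a → x + 1 ≠ a → False := by decide
  by_cases hf : cl A (mt f) = a
  · refine le_trans (pr_mono fun v hv => ?_) (show pr (fun v => ¬ A v) ≤ _ by rw [hn]; linarith [h.A1])
    intro hA
    rw [cl_add, cl_singleton, if_pos hA, hf] at hv
    simp at hv
  · refine le_trans (pr_mono fun v hv => ?_) h.A2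
    by_contra hA
    rw [cl_add, cl_singleton, if_neg hA, add_zero] at hv
    exact hf hv

lemma FX.pure (h : FX m' Ed A p θ c) (M : Fin (m'+1) → V) (hM : (mt M).Nodup)
    (hp : pr (fun y : Fin (m'+1) → V => Adj Ed M y ∧ cl A (mt M) + cl A (mt y) = p + 1) < c) :
    1/2 - θ - c ≤ pr (fun y => AdjC Ed A p M y) := by
  have h1 := h.deg M hM
  have h2 : pr (fun y : Fin (m'+1) → V => Adj Ed M y) ≤ pr (fun y : Fin (m'+1) → V => AdjC Ed A p M y ∨ (Adj Ed M y ∧ cl A (mt M) + cl A (mt y) = p + 1)) := by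
    refine pr_mono fun y hy => ?_
    have hz : ∀ x p : ZMod 2, x = p ∨ x = p + 1 := by decide
    rcases hz (cl A (mt M) + cl A (mt y)) p with hz | hz
    · exact Or.inl ⟨hy, hz⟩
    · exact Or.inr ⟨hy, hz⟩
  have h3 := pr_or_le (fun y : Fin (m'+1) → V => AdjC Ed A p M y) (fun y : Fin (m'+1) → V => (Adj Ed M y ∧ cl A (mt M) + cl A (mt y) = p + 1))
  linarith

lemma FX.fix2 (h : FX m' Ed A p θ c) (j : ℕ) (ht : Fintype.card V = (m'+1) * (8 + 2 * j)) (hA : cl A (Finset.univ.val : Multiset V) = j • p + 1)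
    (hp : ∀ M : Fin (m'+1) → V, pr (fun y : Fin (m'+1) → V => Adj Ed M y ∧ cl A (mt M) + cl A (mt y) = p + 1) < c)
    (α : ZMod 2) (X1 Y1 X2 Y2 : Fin (m'+1) → V) (hn : (mt X1 + mt Y1 + (mt X2 + mt Y2)).Nodup) (e1 : Ed (mt X1 + mt Y1)) (e2 : Ed (mt X2 + mt Y2))
    (x1 : cl A (mt X1) = α) (y1 : cl A (mt Y1) = p + 1 + α) (x2 : cl A (mt X2) = α) (y2 : cl A (mt Y2) = p + 1 + α) : HamCyc (m'+1) Ed := by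
  have hθ := h.t1
  have hc4 := h.c4
  have hn1 := Multiset.nodup_add.1 (Multiset.nodup_add.1 hn).1
  have hn2 := Multiset.nodup_add.1 (Multiset.nodup_add.1 hn).2.1
  obtain ⟨g0, a0, d0, n0⟩ := h.pickU (fun y => AdjC Ed A p X1 y) (by linarith [h.pure X1 hn1.1 (hp _)]) _ hn (by simp; omega)
  obtain ⟨g', a1, d1, n1⟩ := h.pickU (fun y => AdjC Ed A p X2 y) (by linarith [h.pure X2 hn2.1 (hp _)]) _ n0 (by simp; omega)
  have hcm : c ≤ pr (fun y => AdjC Ed A p Y1 y ∧ AdjC Ed A p Y2 y) := by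
    have q1 := h.pure Y1 hn1.2.1 (hp _)
    have q2 := h.pure Y2 hn2.2.1 (hp _)
    have q3 := h.class_up (1 + α)
    have q4 := pr_incl_excl (fun y => AdjC Ed A p Y1 y) (fun y => AdjC Ed A p Y2 y)
    have q5 : pr (fun y => AdjC Ed A p Y1 y ∨ AdjC Ed A p Y2 y) ≤ pr (fun y : Fin (m'+1) → V => cl A (mt y) = 1 + α) := by
      refine pr_mono fun y hy => ?_
      have hz : ∀ p α x : ZMod 2, p + 1 + α + x = p → x = 1 + α := by decide
      rcases hy with hy | hy
      · have := hy.2; rw [y1] at this; exact hz _ _ _ this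
      · have := hy.2; rw [y2] at this; exact hz _ _ _ this
    linarith
  obtain ⟨g, a2, d2, n2⟩ := h.pickU _ hcm _ n1 (by simp; omega)
  have s0 : StC Ed A p θ (p + α) g0 := ⟨d0, z4 _ _ _ (by rw [← x1]; exact a0.2)⟩
  have s1 : StC Ed A p θ (p + α) g' := ⟨d1, z4 _ _ _ (by rw [← x2]; exact a1.2)⟩
  have s2 := a2.1.2
  rw [y1] at s2
  obtain ⟨g_two, s3, a3, n3⟩ := h.pick α [g'] (by simp) (by simpa using s1) _ n2 (by simp; omega)
  simp at a3
  refine h.clo (p + α) [g0, X1, Y1, g, Y2, X2, g', g_two] g0 g_two j ?_ ?_ (by simp) (by simp) s0 (by simp) (by rw [z3]; exact s3) (by simpa using ht) ?_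
  · have e2' : Adj Ed Y2 X2 := by unfold Adj; rw [add_comm]; exact e2
    have e1' : Adj Ed X1 Y1 := e1
    simp [a0.1.symm, a1.1, a2.1.1, a2.2.1.symm, a3.1, e1', e2']
  · have : vs [g0, X1, Y1, g, Y2, X2, g', g_two] = mt g_two + (mt g + (mt g' + (mt g0 + (mt X1 + mt Y1 + (mt X2 + mt Y2))))) := by simp; abel
    rw [this]; exact n3
  · rw [hA]
    simp only [vs_cons, vs_nil, cl_add, cl_zero, s0.2, s1.2, s3.2, x1, x2, y1, y2]
    have hz : ∀ p α x y : ZMod 2, p + 1 + α + x = p → y + 1 = p + α + (α + (p + 1 + α + (x + (p + 1 + α + (α + (p + α + (α + 0))))))) + y := by decide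
    exact hz _ _ _ _ s2

end
end HC
end

section
open Finset
open scoped Classical
namespace HC

section
variable {V : Type} [Fintype V] {m' : ℕ} {Ed : Multiset V → Prop} {A : V → Prop} {p : ZMod 2} {θ c : ℝ}

lemma wsplit (hm : 2 ≤ m') (S : Multiset V) (v : V) (hS : S.card = 2 * m' + 1) (hSA : 2 * m' ≤ S.countP A) (hv : ¬ A v) (hcl : cl A S + 1 = p) (α : ZMod 2) :
    ∃ X Y : Fin (m'+1) → V, mt X + mt Y = S + {v} ∧ cl A (mt X) = α ∧ cl A (mt Y) = p + 1 + α := by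
  obtain ⟨w, hw, hwA⟩ := Multiset.countP_pos.1 (by omega : 0 < S.countP A)
  obtain ⟨S', rfl⟩ := Multiset.exists_cons_of_mem hw
  rw [Multiset.countP_cons_of_pos _ hwA] at hSA
  rw [Multiset.card_cons] at hS
  obtain ⟨w', hw', hwA'⟩ := Multiset.countP_pos.1 (by omega : 0 < S'.countP A)
  obtain ⟨R, X, hR, hX, hRX, hclX⟩ := split_par A α (by omega : 1 ≤ m') (S' + {v}) (by rw [Multiset.card_add, Multiset.card_singleton]; omega)
    ⟨w', by simp [hw'], hwA'⟩ ⟨v, by simp, hv⟩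
  obtain ⟨x, hx⟩ := exists_mt X hX
  obtain ⟨y, hy⟩ := exists_mt (q := m'+1) (R + {w}) (by simp [hR])
  have e : mt x + mt y = w ::ₘ S' + {v} := by
    rw [hx, hy, ← Multiset.singleton_add w S', add_assoc {w} S', hRX]; abel
  refine ⟨x, y, e, by rw [hx, hclX], ?_⟩
  have h1 := congrArg (cl A) e
  rw [cl_add, cl_add, cl_singleton, if_neg hv, hx, hclX] at h1
  have hz : ∀ α y s p : ZMod 2, α + y = s + 0 → s + 1 = p → y = p + 1 + α := by decide
  exact hz _ _ _ _ h1 hcl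

lemma pat_dens (h : EG m' Ed A p θ) : (49/100 : ℝ)^(2 * m' + 1) ≤ cnt V (2 * m' + 1) (fun s => 2 * m' ≤ s.countP A ∧ cl A s + 1 = p) := by
  haveI := h.ne
  have hz : ∀ x : ZMod 2, 2 * x + 1 + 1 = 0 ∧ 2 * x + 1 = 1 := by decide
  obtain ⟨jj, h1, h2, h3⟩ : ∃ jj : ℕ, jj ≤ 2 * m' + 1 ∧ 2 * m' ≤ jj ∧ (jj : ZMod 2) + 1 = p := by
    have hp : ∀ p : ZMod 2, p = 0 ∨ p = 1 := by decide
    rcases hp p with rfl | rfl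
    · exact ⟨2 * m' + 1, le_rfl, by omega, by push_cast; exact (hz _).1⟩
    · exact ⟨2 * m', by omega, by omega, by push_cast; exact (hz _).2⟩
  have h4 := pr_pi (V := V) (q := 2 * m' + 1) (fun i v => (A v ↔ i.1 < jj)) (49/100) (by norm_num) (by
    intro i
    by_cases hi : i.1 < jj
    · simp only [hi, iff_true]; exact h.a1
    · simp only [hi, iff_false]
      rw [pr_not]; linarith [h.a2])
  refine h4.trans (pr_mono fun f hf => ?_)
  have := countP_step jj h1 f hf
  refine ⟨by rw [this]; exact h2, ?_⟩
  unfold cl; rw [this]; exact h3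

lemma pr_le_both {α β : Type} [Fintype α] [Fintype β] (R : α × β → Prop) {b : ℝ} (hb : 0 ≤ b)
    (h : ∀ a, pr (fun y => R (a, y)) ≤ b) : pr R ≤ b := pr_prod_le (q := fun a y => R (a, y)) hb h

lemma two_aux0 (P : Multiset V → Prop) (hc0 : 0 ≤ c) (h : ∀ x : Fin m' → V, pr (fun y : Fin (m'+1) → V => P (mt x + mt y)) ≤ c) :
  cnt V (2 * m' + 1) P ≤ c := by
  rw [show 2 * m' + 1 = m' + (m' + 1) by ring, cnt_prod]
  exact pr_le_both _ hc0 h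
lemma two_aux (hc0 : 0 ≤ c) 
    (hp : ∀ M : Fin (m'+1) → V, pr (fun y : Fin (m'+1) → V => Adj Ed M y ∧ cl A (mt M) + cl A (mt y) = p + 1) < c) (u : V) :
    cnt V (2 * m' + 1) (fun s => Ed (s + {u}) ∧ cl A (s + {u}) = p + 1) ≤ c := by
  refine two_aux0 _ hc0 ?_
  intro x
  refine le_trans (pr_mono fun y hy => ?_) (hp (Fin.snoc x u : Fin (m'+1) → V)).le
  have e : mt (Fin.snoc x u : Fin (m'+1) → V) + mt y = mt x + mt y + {u} := by rw [mt_snoc, add_right_comm]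
  unfold Adj
  rw [← cl_add, e]
  exact hy

lemma cnt_le_sum {q : ℕ} (T : Finset V) (P : V → Multiset V → Prop) : cnt V q (fun s => ∃ u ∈ T, P u s) ≤ ∑ u ∈ T, cnt V q (P u) :=
  pr_le_sum T (fun u (f : Fin q → V) => P u (mt f))

lemma sum_le_mul (e : Multiset V) (hen : e.Nodup) (f : V → ℝ) (c : ℝ) (h : ∀ u, f u ≤ c) : ∑ u ∈ e.toFinset, f u ≤ e.card * c := by
  have b6 := Finset.sum_le_card_nsmul e.toFinset f c (fun u _ => h u)
  rw [Multiset.toFinset_card_of_nodup hen, nsmul_eq_mul] at b6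
  exact b6

lemma two_t1 (hc0 : 0 ≤ c) 
    (hp : ∀ M : Fin (m'+1) → V, pr (fun y : Fin (m'+1) → V => Adj Ed M y ∧ cl A (mt M) + cl A (mt y) = p + 1) < c) :
   ∀ u,  cnt V (2 * m' + 1) (fun s => Ed (s + {u}) ∧ cl A (s + {u}) = p + 1) ≤ c := two_aux hc0 hp

lemma two_t2 (hc0 : 0 ≤ c)  (e : Multiset V) (hen : e.Nodup) 
   (h : ∀ u : V,  cnt V (2 * m' + 1) (fun s => Ed (s + {u}) ∧ cl A (s + {u}) = p + 1) ≤ c) : ∑ u ∈ e.toFinset, cnt V (2 * m' + 1) (fun s => Ed (s + {u}) ∧ cl A (s + {u}) = p + 1) ≤ e.card * c := by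
  exact sum_le_mul e hen _ c h
lemma two_t3 (hc0 : 0 ≤ c)  (e : Multiset V) (hen : e.Nodup) 
   (h : ∀ u : V,  cnt V (2 * m' + 1) (fun s => Ed (s + {u}) ∧ cl A (s + {u}) = p + 1) ≤ c) : cnt V (2 * m' + 1) (fun s => ∃ u ∈ e.toFinset, Ed (s + {u}) ∧ cl A (s + {u}) = p + 1) ≤ e.card * c := by
  exact (cnt_le_sum _ _).trans (sum_le_mul e hen _ c h)

lemma two_sum (hc0 : 0 ≤ c) 
    (hp : ∀ M : Fin (m'+1) → V, pr (fun y : Fin (m'+1) → V => Adj Ed M y ∧ cl A (mt M) + cl A (mt y) = p + 1) < c) (e : Multiset V) (hen : e.Nodup) (P : Multiset V → Prop)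
    (key : ∀ s : Multiset V, s.card = 2 * m' + 1 → P s → (s + e).Nodup → ∃ u ∈ e.toFinset, Ed (s + {u}) ∧ cl A (s + {u}) = p + 1) :
    cnt V (2 * m' + 1) P ≤ e.card * c + ((2 * m' + 1 : ℕ) : ℝ) * ((2 * m' + 1 : ℕ) + e.card) / Fintype.card V := by
  have b1 := cnt_hit (2 * m' + 1) e hen
  have b2 : cnt V (2 * m' + 1) P ≤
      cnt V (2 * m' + 1) (fun s => ∃ u ∈ e.toFinset, Ed (s + {u}) ∧ cl A (s + {u}) = p + 1) + cnt V (2 * m' + 1) (fun s => ¬ (s + e).Nodup) := by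
    refine cnt_or_mono fun s hs h1 => ?_
    by_cases h2 : (s + e).Nodup
    · exact Or.inl (key s hs h1 h2)
    · exact Or.inr h2
  exact b2.trans (add_le_add (two_t3 hc0 e hen (two_t1 hc0 hp)) b1)

set_option maxHeartbeats 1000000 in
lemma FX.two (h : FX m' Ed A p θ c) (HW : HWp m' Ed A p) (hck : c * (8 * (m'+1 : ℕ)) ≤ (49/100 : ℝ)^(2 * m' + 1))
    (hp : ∀ M : Fin (m'+1) → V, pr (fun y : Fin (m'+1) → V => Adj Ed M y ∧ cl A (mt M) + cl A (mt y) = p + 1) < c) (α : ZMod 2) :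
    ∃ X1 Y1 X2 Y2 : Fin (m'+1) → V, (mt X1 + mt Y1 + (mt X2 + mt Y2)).Nodup ∧ Ed (mt X1 + mt Y1) ∧ Ed (mt X2 + mt Y2) ∧
      cl A (mt X1) = α ∧ cl A (mt Y1) = p + 1 + α ∧ cl A (mt X2) = α ∧ cl A (mt Y2) = p + 1 + α := by
  have hm := h.hm
  haveI := h.eg.ne
  obtain ⟨κ, hκ⟩ : ∃ κ : ℝ, κ = (49/100 : ℝ)^(2 * m' + 1) := ⟨_, rfl⟩
  have hpat := pat_dens h.eg
  rw [← hκ] at hpat hck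
  obtain ⟨M, hM⟩ : ∃ M : ℝ, M = (m'+1 : ℕ) := ⟨_, rfl⟩
  obtain ⟨n, hn⟩ : ∃ n : ℝ, n = Fintype.card V := ⟨_, rfl⟩
  have hM3 : 3 ≤ M := by rw [hM]; exact_mod_cast (by omega : 3 ≤ m' + 1)
  have hMe : (m' : ℝ) = M - 1 := by rw [hM]; push_cast; ring
  have hnb := h.nb
  have hc0 := h.c0
  rw [← hM, ← hn] at hnb
  rw [← hM] at hck
  have hn0 : 0 < n := by rw [hn]; exact_mod_cast Fintype.card_pos
  have hκn : 100 * M^2 * 8 ≤ κ * n := by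
    have : c * (8 * M) * n ≤ κ * n := mul_le_mul_of_nonneg_right hck hn0.le
    nlinarith [mul_pos hc0 hn0]
  obtain ⟨S, hS, ⟨hS1, hS2⟩, hSn⟩ := exists_of_cnt 0 (by simp) hpat (by
    push_cast [Multiset.card_zero]; rw [← hn, hMe]; nlinarith)
  rw [add_zero] at hSn
  obtain ⟨v, hv, hvE⟩ := HW S hSn hS hS1 hS2
  have hen := h.eg.nd _ hvE
  obtain ⟨e, he⟩ : ∃ e, e = S + {v} := ⟨_, rfl⟩
  obtain ⟨X1, Y1, w1, w2, w3⟩ := wsplit hm S v hS hS1 hv hS2 α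
  rw [← he] at hen w1 hvE
  have hec : e.card = 2 * m' + 2 := by rw [he, Multiset.card_add, hS, Multiset.card_singleton]
  by_contra hcon
  have key : ∀ s : Multiset V, s.card = 2 * m' + 1 → (2 * m' ≤ s.countP A ∧ cl A s + 1 = p) → (s + e).Nodup →
      ∃ u ∈ e.toFinset, Ed (s + {u}) ∧ cl A (s + {u}) = p + 1 := by
    rintro s hs ⟨hs1, hs2⟩ hse
    obtain ⟨u, hu, huE⟩ := HW s (Multiset.nodup_add.1 hse).1 hs hs1 hs2
    refine ⟨u, ?_, huE, ?_⟩
    · rw [Multiset.mem_toFinset]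
      by_contra hue
      obtain ⟨X2, Y2, w4, w5, w6⟩ := wsplit hm s u hs hs1 hu hs2 α
      refine hcon ⟨X1, Y1, X2, Y2, ?_, by rw [w1]; exact hvE, by rw [w4]; exact huE, w2, w3, w5, w6⟩
      rw [w1, w4]
      have hun := h.eg.nd _ huE
      rw [Multiset.nodup_add] at hse hun ⊢
      refine ⟨hen, h.eg.nd _ huE, ?_⟩
      rw [Multiset.disjoint_add_right]
      exact ⟨hse.2.2.symm, by rw [Multiset.disjoint_singleton]; exact hue⟩
    · rw [cl_add, cl_singleton, if_neg hu, ← hs2]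
      have hz : ∀ x : ZMod 2, x + 0 = x + 1 + 1 := by decide
      exact hz _
  have b1 := two_sum hc0.le hp e hen _ key
  have b1' : (((2 * m' + 1 : ℕ) : ℝ) * ((2 * m' + 1 : ℕ) + e.card)) / Fintype.card V ≤ κ / 4 := by
    rw [← hn, div_le_iff₀ hn0, hec]; push_cast; rw [hMe]; nlinarith
  have b7 : ((2 * m' + 2 : ℕ) : ℝ) * c = 2 * (c * M) := by push_cast; rw [hMe]; ring
  rw [← hec] at b7
  rw [b7] at b1
  have hcM : 0 < c * M := mul_pos hc0 (by linarith)
  linarith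

lemma FX.even (h : FX m' Ed A p θ c) (HW : HWp m' Ed A p) (hck : c * (8 * (m'+1 : ℕ)) ≤ (49/100 : ℝ)^(2 * m' + 1))
    (j : ℕ) (ht : Fintype.card V = (m'+1) * (8 + 2 * j)) (hA : cl A (Finset.univ.val : Multiset V) = j • p + 1) : HamCyc (m'+1) Ed := by
  by_cases hM : ∃ M : Fin (m'+1) → V, c ≤ pr (fun y : Fin (m'+1) → V => Adj Ed M y ∧ cl A (mt M) + cl A (mt y) = p + 1)
  · obtain ⟨M, hM⟩ := hM
    refine h.fixM (j + 2) (by rw [ht]; ring) ?_ M hM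
    rw [hA, add_smul]
    have hz : ∀ x p : ZMod 2, x + 1 = x + 2 • p + 1 := by decide
    exact hz _ _
  · have hp := fun M : Fin (m'+1) → V => not_le.1 (not_exists.1 hM M)
    obtain ⟨X1, Y1, X2, Y2, q1, q2, q3, q4, q5, q6, q7⟩ := h.two HW hck hp 0
    exact h.fix2 j ht hA hp 0 X1 Y1 X2 Y2 q1 q2 q3 q4 q5 q6 q7

lemma FX.fixodd (h : FX m' Ed A p θ c) (hp : p = 1) (j : ℕ) (ht : Fintype.card V = (m'+1) * (5 + 2 * j)) (q : ZMod 2)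
    (hA : cl A (Finset.univ.val : Multiset V) = j • p + q) (X Y : Fin (m'+1) → V) (hE : Adj Ed X Y) (hX : cl A (mt X) = q) (hY : cl A (mt Y) = q)
    (dX : c ≤ pr (fun y => AdjC Ed A p X y)) (dY : c ≤ pr (fun y => AdjC Ed A p Y y)) : HamCyc (m'+1) Ed := by
  obtain ⟨g1, a1, d1, n1⟩ := h.pickU _ dX (mt X + mt Y) (h.eg.nd _ hE) (by simp; omega)
  obtain ⟨g, a2, d2, n2⟩ := h.pickU _ dY _ n1 (by simp; omega)
  have s1 : StC Ed A p θ (p + q) g1 := ⟨d1, z4 _ _ _ (by rw [← hX]; exact a1.2)⟩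
  have s2 : StC Ed A p θ (p + q) g := ⟨d2, z4 _ _ _ (by rw [← hY]; exact a2.2)⟩
  obtain ⟨g0, s0, a0, n0⟩ := h.pick q [g1] (by simp) (by simpa using s1) _ n2 (by simp; omega)
  simp at a0
  refine h.clo q [g0, g1, X, Y, g] g0 g j ?_ ?_ (by simp) (by simp) s0 (by simp) s2 (by simpa using ht) ?_
  · simp [a0.1.symm, a1.1.symm, a2.1, hE]
  · have : vs [g0, g1, X, Y, g] = mt g0 + (mt g + (mt g1 + (mt X + mt Y))) := by simp; abel
    rw [this]; exact n0
  · rw [hA]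
    simp only [vs_cons, vs_nil, cl_add, cl_zero, s0.2, s1.2, s2.2, hX, hY, hp]
    have hz : ∀ q x : ZMod 2, x + q = q + (1 + q + (q + (q + (1 + q + 0)))) + x := by decide
    exact hz _ _

end
end HC
end

section
open Finset
open scoped Classical
namespace HC

section
variable {V : Type} [Fintype V] {m' : ℕ} {Ed : Multiset V → Prop} {A : V → Prop} {p : ZMod 2} {θ c : ℝ}

lemma pr_snoc {q : ℕ} (P : (Fin (q+1) → V) → Prop) : pr (fun z : (Fin q → V) × V => P (Fin.snoc z.1 z.2)) = pr P :=
  pr_equiv ((Equiv.prodComm _ _).trans (Fin.snocEquiv (fun _ => V))) P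

lemma step_dens (h : EG m' Ed A p θ) (q jj : ℕ) (hj : jj ≤ q) : (49/100 : ℝ)^q ≤ pr (fun f : Fin q → V => (mt f).countP A = jj) := by
  haveI := h.ne
  have h4 := pr_pi (V := V) (q := q) (fun i v => (A v ↔ i.1 < jj)) (49/100) (by norm_num) (by
    intro i
    by_cases hi : i.1 < jj
    · simp only [hi, iff_true]; exact h.a1
    · simp only [hi, iff_false]
      rw [pr_not]; linarith [h.a2])
  exact h4.trans (pr_mono fun f hf => countP_step jj hj f hf)

lemma nodup_prod (hV : Nonempty V) : pr (fun z : (Fin m' → V) × (Fin (m'+1) → V) => ¬ (mt z.1 + mt z.2).Nodup) ≤ ((2 * m' + 1 : ℕ) : ℝ)^2 / Fintype.card V := by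
  have h1 := cnt_hit (V := V) (m' + (m' + 1)) 0 (by simp)
  rw [cnt_prod] at h1
  simp only [add_zero, Multiset.card_zero, Nat.cast_zero] at h1
  refine h1.trans (le_of_eq ?_)
  rw [sq]
  congr 1
  push_cast; ring

lemma odd_init (h : FX m' Ed A p θ c) (hck : c * (8 * (m'+1 : ℕ)) ≤ (49/100 : ℝ)^(2 * m' + 1)) (q : ZMod 2) :
    ∃ (R0 : Fin m' → V) (X : Fin (m'+1) → V), (mt R0 + mt X).countP A = 2 * m' ∧ cl A (mt X) = q ∧ cl A (mt R0) = q ∧ Gd Ed A p θ X ∧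
      pr (fun z => ¬ Gd Ed A p θ (Fin.snoc R0 z : Fin (m'+1) → V)) ≤ 1/5 ∧ (mt R0 + mt X).Nodup := by
  haveI := h.eg.ne
  have hm := h.hm
  obtain ⟨j0, j1, hj0, hj1, hjj, hjq⟩ : ∃ j0 j1 : ℕ, j0 ≤ m' ∧ j1 ≤ m' + 1 ∧ j0 + j1 = 2 * m' ∧ (j1 : ZMod 2) = q := by
    have hz : ∀ x q : ZMod 2, x = q ∨ x + 1 = q := by decide
    rcases hz (m' : ZMod 2) q with hq | hq
    · exact ⟨m', m', le_rfl, by omega, by omega, hq⟩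
    · exact ⟨m' - 1, m' + 1, by omega, by omega, by omega, by push_cast; exact hq⟩
  have hjq0 : (j0 : ZMod 2) = q := by
    have h1 : ((j0 + j1 : ℕ) : ZMod 2) = ((2 * m' : ℕ) : ZMod 2) := by rw [hjj]
    push_cast at h1
    rw [hjq] at h1
    have hz : ∀ x q y : ZMod 2, x + q = 2 * y → x = q := by decide
    exact hz _ _ _ h1
  have d0 := step_dens h.eg m' j0 hj0
  have d1 := step_dens h.eg (m'+1) j1 hj1
  have d2 := pr_prod_ge (p := fun f : Fin m' → V => (mt f).countP A = j0) (q := fun _ (f : Fin (m'+1) → V) => (mt f).countP A = j1) (b := (49/100 : ℝ)^(m'+1)) (fun _ _ => d1)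
  have d3 : (49/100 : ℝ)^(2 * m' + 1) ≤ pr (fun z : (Fin m' → V) × (Fin (m'+1) → V) => (mt z.1).countP A = j0 ∧ (mt z.2).countP A = j1) := by
    refine le_trans ?_ d2
    rw [show 2 * m' + 1 = m' + (m' + 1) by ring, pow_add]
    exact mul_le_mul_of_nonneg_right d0 (by positivity)
  have e1 : pr (fun z : (Fin m' → V) × (Fin (m'+1) → V) => ¬ Gd Ed A p θ z.2) ≤ θ := by
    rw [pr_snd (fun x : Fin (m'+1) → V => ¬ Gd Ed A p θ x)]; exact h.eg.gt
  have e2 : pr (fun z : (Fin m' → V) × (Fin (m'+1) → V) => 1/5 ≤ pr (fun v => ¬ Gd Ed A p θ (Fin.snoc z.1 v : Fin (m'+1) → V))) ≤ 5 * θ := by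
    rw [pr_fst (fun x : Fin m' → V => 1/5 ≤ pr (fun v => ¬ Gd Ed A p θ (Fin.snoc x v : Fin (m'+1) → V)))]
    have h1 := pr_markov (fun (x : Fin m' → V) v => ¬ Gd Ed A p θ (Fin.snoc x v : Fin (m'+1) → V)) (1/5)
    rw [pr_snoc (fun y : Fin (m'+1) → V => ¬ Gd Ed A p θ y)] at h1
    linarith [h.eg.gt]
  have e3 := nodup_prod (m' := m') h.eg.ne
  have e3' : ((2 * m' + 1 : ℕ) : ℝ)^2 / Fintype.card V ≤ c := by
    have hn0 : (0:ℝ) < Fintype.card V := by exact_mod_cast Fintype.card_pos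
    rw [div_le_iff₀ hn0]
    refine le_trans ?_ h.nb
    push_cast
    nlinarith [(Nat.cast_nonneg m' : (0:ℝ) ≤ m')]
  have f1 := pr_and_not_ge (fun z : (Fin m' → V) × (Fin (m'+1) → V) => (mt z.1).countP A = j0 ∧ (mt z.2).countP A = j1)
    (fun z => ¬ Gd Ed A p θ z.2 ∨ (1/5 ≤ pr (fun v => ¬ Gd Ed A p θ (Fin.snoc z.1 v : Fin (m'+1) → V)) ∨ ¬ (mt z.1 + mt z.2).Nodup))
  have f2 := pr_or_le (fun z : (Fin m' → V) × (Fin (m'+1) → V) => ¬ Gd Ed A p θ z.2) (fun z => (1/5 ≤ pr (fun v => ¬ Gd Ed A p θ (Fin.snoc z.1 v : Fin (m'+1) → V)) ∨ ¬ (mt z.1 + mt z.2).Nodup))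
  have f3 := pr_or_le (fun z : (Fin m' → V) × (Fin (m'+1) → V) => 1/5 ≤ pr (fun v => ¬ Gd Ed A p θ (Fin.snoc z.1 v : Fin (m'+1) → V))) (fun z => ¬ (mt z.1 + mt z.2).Nodup)
  have g1 : 24 * c ≤ c * (8 * (m'+1 : ℕ)) := by
    have h3 : (3:ℝ) ≤ ((m'+1 : ℕ) : ℝ) := by exact_mod_cast (by omega : 3 ≤ m' + 1)
    nlinarith [h.c0]
  have g2 : 0 < pr (fun z : (Fin m' → V) × (Fin (m'+1) → V) => ((mt z.1).countP A = j0 ∧ (mt z.2).countP A = j1) ∧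
     ¬ (¬ Gd Ed A p θ z.2 ∨ (1/5 ≤ pr (fun v => ¬ Gd Ed A p θ (Fin.snoc z.1 v : Fin (m'+1) → V)) ∨ ¬ (mt z.1 + mt z.2).Nodup))) := by
    have := h.tc
    have := h.c0
    linarith
  obtain ⟨⟨R0, X⟩, ⟨k1, k2⟩, k3⟩ := exists_of_pr_pos g2
  push Not at k3
  refine ⟨R0, X, ?_, ?_, ?_, k3.1, k3.2.1.le, k3.2.2⟩
  · rw [Multiset.countP_add, k1, k2, hjj]
  · unfold cl; rw [k2]; exact hjq
  · unfold cl; rw [k1]; exact hjq0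

lemma FX.gd_dens (h : FX m' Ed A p θ c) (X : Fin (m'+1) → V) (hX : Gd Ed A p θ X) : c ≤ pr (fun y => AdjC Ed A p X y) := by
  have h1 := class_dens h.eg (p + cl A (mt X))
  have h2 := pr_and_not_ge (fun y : Fin (m'+1) → V => cl A (mt y) = p + cl A (mt X)) (fun y : Fin (m'+1) → V => ¬ (Adj Ed X y ↔ cl A (mt X) + cl A (mt y) = p))
  have h3 : pr (fun y : Fin (m'+1) → V => ¬ (Adj Ed X y ↔ cl A (mt X) + cl A (mt y) = p)) ≤ θ := hX
  have h4 : pr (fun y : Fin (m'+1) → V => cl A (mt y) = p + cl A (mt X) ∧ ¬ ¬ (Adj Ed X y ↔ cl A (mt X) + cl A (mt y) = p)) ≤ pr (fun y => AdjC Ed A p X y) := by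
    refine pr_mono fun y hy => ?_
    have e : cl A (mt X) + cl A (mt y) = p := by rw [hy.1]; exact z1 _ _
    exact ⟨(not_not.1 hy.2).2 e, e⟩
  have := h.t1
  have := h.c4
  linarith

lemma FX.wrong_few (h : FX m' Ed A p θ c) (hp : p = 1) (q : ZMod 2) (Y : Fin (m'+1) → V) (hY : (mt Y).Nodup) (hq : cl A (mt Y) = q)
    (hd : pr (fun y => AdjC Ed A p Y y) < c) : pr (fun y : Fin (m'+1) → V => cl A (mt y) = q ∧ ¬ Adj Ed Y y) ≤ 2 * θ + c := by
  have h1 := h.deg Y hY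
  have h2 : pr (fun y : Fin (m'+1) → V => Adj Ed Y y) ≤ pr (fun y : Fin (m'+1) → V => AdjC Ed A p Y y ∨ (cl A (mt y) = q ∧ Adj Ed Y y)) := by
    refine pr_mono fun y hy => ?_
    have hz : ∀ q x : ZMod 2, q + x = 1 ∨ x = q := by decide
    rcases hz q (cl A (mt y)) with hz | hz
    · left; exact ⟨hy, by rw [hq, hp]; exact hz⟩
    · exact Or.inr ⟨hz, hy⟩
  have h3 := pr_or_le (fun y : Fin (m'+1) → V => AdjC Ed A p Y y) (fun y => (cl A (mt y) = q ∧ Adj Ed Y y))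
  have h4 := h.class_up q
  have h5 := pr_incl_excl (fun y : Fin (m'+1) → V => cl A (mt y) = q ∧ Adj Ed Y y) (fun y : Fin (m'+1) → V => cl A (mt y) = q ∧ ¬ Adj Ed Y y)
  have h6 : pr (fun y : Fin (m'+1) → V => (cl A (mt y) = q ∧ Adj Ed Y y) ∨ (cl A (mt y) = q ∧ ¬ Adj Ed Y y)) ≤ pr (fun y : Fin (m'+1) → V => cl A (mt y) = q) :=
    pr_mono fun y hy => by tauto
  have h7 : pr (fun y : Fin (m'+1) → V => (cl A (mt y) = q ∧ Adj Ed Y y) ∧ (cl A (mt y) = q ∧ ¬ Adj Ed Y y)) ≤ 0 := by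
    rw [← pr_false (α := Fin (m'+1) → V)]
    exact pr_mono fun y hy => by tauto
  linarith

lemma FX.noodd (h : FX m' Ed A p θ c) (HW : HWp m' Ed A p) (hck : c * (8 * (m'+1 : ℕ)) ≤ (49/100 : ℝ)^(2 * m' + 1))
    (hcf : 14 * c ≤ (1/50) / ((m' + (m'+1)).factorial : ℝ)) (hp : p = 1) (q : ZMod 2)
    (hN : ∀ X Y : Fin (m'+1) → V, Adj Ed X Y → cl A (mt X) = q → cl A (mt Y) = q → c ≤ pr (fun y => AdjC Ed A p X y) → pr (fun y => AdjC Ed A p Y y) < c) : False := by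
  haveI := h.eg.ne
  have hm := h.hm
  obtain ⟨R0, X, k1, k2, k3, k4, k5, k6⟩ := odd_init h hck q
  obtain ⟨w, hw, hwE⟩ := HW (mt R0 + mt X) k6 (by simp; omega) k1.ge (by
    rw [cl_add, k2, k3, hp]
    have hz : ∀ q : ZMod 2, q + q + 1 = 1 := by decide
    exact hz q)
  obtain ⟨Y0, hY0⟩ : ∃ Y0 : Fin (m'+1) → V, Y0 = Fin.snoc R0 w := ⟨_, rfl⟩
  have hY0m : mt Y0 = mt R0 + {w} := by rw [hY0, mt_snoc]
  have hclw : ∀ R : Multiset V, ∀ z, ¬ A z → cl A (R + {z}) = cl A R := by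
    intro R z hz; rw [cl_add, cl_singleton, if_neg hz, add_zero]
  have hY0c : cl A (mt Y0) = q := by rw [hY0m, hclw _ _ hw, k3]
  have hXY : Adj Ed X Y0 := by
    show Ed (mt X + mt Y0)
    rw [hY0m, ← add_assoc, add_comm (mt X)]; exact hwE
  have hYd := hN X Y0 hXY k2 hY0c (h.gd_dens X k4)
  have hYn : (mt Y0).Nodup := (Multiset.nodup_add.1 (h.eg.nd _ hXY)).2.1
  have hbad := h.wrong_few hp q Y0 hYn hY0c hYd
  rw [← pr_snoc] at hbad
  obtain ⟨Fail, hFail⟩ : ∃ Fail : (Fin m' → V) → Prop, Fail = fun R => cl A (mt R) = q ∧ ∀ z, ¬ A z → Gd Ed A p θ (Fin.snoc R0 z : Fin (m'+1) → V) → ¬ Adj Ed Y0 (Fin.snoc R z : Fin (m'+1) → V) := ⟨_, rfl⟩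
  have hgoodz : 1/4 ≤ pr (fun z => ¬ A z ∧ ¬ ¬ Gd Ed A p θ (Fin.snoc R0 z : Fin (m'+1) → V)) := by
    have h1 := pr_and_not_ge (fun z => ¬ A z) (fun z => ¬ Gd Ed A p θ (Fin.snoc R0 z : Fin (m'+1) → V))
    rw [pr_not] at h1
    linarith [h.eg.a2]
  have hF1 := pr_prod_ge (p := Fail) (q := fun _ z => ¬ A z ∧ ¬ ¬ Gd Ed A p θ (Fin.snoc R0 z : Fin (m'+1) → V)) (b := 1/4) (fun _ _ => hgoodz)
  have hF2 : pr (fun z : (Fin m' → V) × V => Fail z.1 ∧ ¬ A z.2 ∧ ¬ ¬ Gd Ed A p θ (Fin.snoc R0 z.2 : Fin (m'+1) → V)) ≤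
      pr (fun z : (Fin m' → V) × V => cl A (mt (Fin.snoc z.1 z.2 : Fin (m'+1) → V)) = q ∧ ¬ Adj Ed Y0 (Fin.snoc z.1 z.2)) := by
    refine pr_mono ?_
    rintro ⟨R, z⟩ ⟨a1, a2, a3⟩
    rw [hFail] at a1
    refine ⟨?_, a1.2 z a2 (not_not.1 a3)⟩
    rw [mt_snoc, hclw _ _ a2]; exact a1.1
  have hF : pr Fail ≤ 8 * θ + 4 * c := by linarith
  have hnf : ∀ R : Fin m' → V, ¬ Fail R → cl A (mt R) = q → pr (fun y => AdjC Ed A p (Fin.snoc R w : Fin (m'+1) → V) y) < c := by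
    intro R hR hRq
    rw [hFail] at hR
    push Not at hR
    obtain ⟨z, z1, z2, z3⟩ := hR hRq
    refine hN (Fin.snoc R0 z) (Fin.snoc R w) ?_ (by rw [mt_snoc, hclw _ _ z1]; exact k3) (by rw [mt_snoc, hclw _ _ hw]; exact hRq) (h.gd_dens _ z2)
    have e : mt (Fin.snoc R0 z : Fin (m'+1) → V) + mt (Fin.snoc R w : Fin (m'+1) → V) = mt Y0 + mt (Fin.snoc R z : Fin (m'+1) → V) := by
      rw [hY0m, mt_snoc, mt_snoc, mt_snoc]; abel
    show Ed _
    rw [e]; exact z3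
  have hL := link_split h.eg hm (1 + q) w
  have hL2 : pr (fun z : (Fin m' → V) × (Fin (m'+1) → V) => Ed (mt z.1 + mt z.2 + {w}) ∧ cl A (mt z.1 + mt z.2 + {w}) = p ∧ cl A (mt z.2) = 1 + q) ≤
      pr (fun z : (Fin m' → V) × (Fin (m'+1) → V) => Fail z.1 ∨ ((¬ Fail z.1 ∧ cl A (mt z.1) = q) ∧ AdjC Ed A p (Fin.snoc z.1 w : Fin (m'+1) → V) z.2)) := by
    refine pr_mono ?_
    rintro ⟨R, y⟩ ⟨a1, a2, a3⟩
    simp only at a1 a2 a3 ⊢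
    by_cases hf : Fail R
    · exact Or.inl hf
    · right
      have e : mt (Fin.snoc R w : Fin (m'+1) → V) + mt y = mt R + mt y + {w} := by rw [mt_snoc, add_right_comm]
      refine ⟨⟨hf, ?_⟩, ?_, ?_⟩
      · rw [hclw _ _ hw, cl_add, a3, hp] at a2
        have hz : ∀ x q : ZMod 2, x + (1 + q) = 1 → x = q := by decide
        exact hz _ _ a2
      · show Ed _
        rw [e]; exact a1
      · rw [← cl_add, e]; exact a2
  have hL3 := pr_or_le (fun z : (Fin m' → V) × (Fin (m'+1) → V) => Fail z.1) (fun z => ((¬ Fail z.1 ∧ cl A (mt z.1) = q) ∧ AdjC Ed A p (Fin.snoc z.1 w : Fin (m'+1) → V) z.2))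
  have hL4 := pr_prod_le' (p := fun R : Fin m' → V => ¬ Fail R ∧ cl A (mt R) = q) (q := fun R y => AdjC Ed A p (Fin.snoc R w : Fin (m'+1) → V) y) h.c0.le (fun R hR => (hnf R hR.1 hR.2).le)
  have hL5 : pr (fun R : Fin m' → V => ¬ Fail R ∧ cl A (mt R) = q) * c ≤ c := by
    have := pr_le_one (fun R : Fin m' → V => ¬ Fail R ∧ cl A (mt R) = q)
    nlinarith [h.c0]
  rw [pr_fst Fail] at hL3
  have := h.tc
  have := h.c0
  linarith

lemma FX.odd1 (h : FX m' Ed A p θ c) (HW : HWp m' Ed A p) (hck : c * (8 * (m'+1 : ℕ)) ≤ (49/100 : ℝ)^(2 * m' + 1))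
    (hcf : 14 * c ≤ (1/50) / ((m' + (m'+1)).factorial : ℝ)) (hp : p = 1) (j : ℕ) (ht : Fintype.card V = (m'+1) * (5 + 2 * j)) : HamCyc (m'+1) Ed := by
  obtain ⟨q, hq⟩ : ∃ q, cl A (Finset.univ.val : Multiset V) = j • p + q := ⟨j • p + cl A (Finset.univ.val : Multiset V), by
    have hz : ∀ x y : ZMod 2, y = x + (x + y) := by decide
    exact hz _ _⟩
  by_contra hno
  refine h.noodd HW hck hcf hp q fun X Y hE hX hY dX => ?_
  by_contra dY
  exact hno (h.fixodd hp j ht q hq X Y hE hX hY dX (not_lt.1 dY))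

end
end HC
end

section
open Finset
open scoped Classical
namespace HC

section
variable {V : Type} [Fintype V] {m' : ℕ} {Ed : Multiset V → Prop} {A : V → Prop} {p : ZMod 2} {θ c : ℝ}

lemma HW_of (hnd : ∀ s, Ed s → s.Nodup) (D : ℕ) (hD : ∀ s : Multiset V, s.Nodup → s.card = 2 * m' + 1 → D < (univ.filter (fun v => Ed (s + {v}))).card)
    (hj : ∀ j : ℕ, (j = 2 * m' ∨ j = 2 * m' + 1) → (j : ZMod 2) + 1 = p → (univ.filter A).card ≤ D + j) : HWp m' Ed A p := by
  intro S hS hSc hSA hcl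
  by_contra hno
  push Not at hno
  have h1 := hD S hS hSc
  have h2 : (S.toFinset.filter A).card = S.countP A := by
    rw [Multiset.countP_eq_card_filter, ← Multiset.toFinset_filter, Multiset.toFinset_card_of_nodup (hS.filter _)]
  have h3 : Disjoint (univ.filter (fun v => Ed (S + {v}))) (S.toFinset.filter A) := by
    rw [Finset.disjoint_left]
    intro v hv hv2
    rw [Finset.mem_filter] at hv hv2
    have := (Multiset.nodup_add.1 (hnd _ hv.2)).2.2
    rw [Multiset.disjoint_singleton] at this
    exact this (Multiset.mem_toFinset.1 hv2.1)
  have h4 : (univ.filter (fun v => Ed (S + {v}))) ∪ (S.toFinset.filter A) ⊆ univ.filter A := by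
    intro v hv
    rw [Finset.mem_union, Finset.mem_filter, Finset.mem_filter] at hv
    rw [Finset.mem_filter]
    refine ⟨Finset.mem_univ _, ?_⟩
    rcases hv with hv | hv
    · by_contra hA
      exact hno v hA hv.2
    · exact hv.2
  have h5 := Finset.card_le_card h4
  rw [Finset.card_union_of_disjoint h3, h2] at h5
  have h6 : S.countP A ≤ 2 * m' + 1 := hSc ▸ Multiset.countP_le_card _ _
  have h7 := hj (S.countP A) (by omega) hcl
  omega

lemma cl_univ : cl A (Finset.univ.val : Multiset V) = ((univ.filter A).card : ZMod 2) := by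
  unfold cl
  rw [Multiset.countP_eq_card_filter]
  rfl

lemma E_case (h : FX m' Ed A p θ c) (hck : c * (8 * (m'+1 : ℕ)) ≤ (49/100 : ℝ)^(2 * m' + 1))
    (hcf : 14 * c ≤ (1/50) / ((m' + (m'+1)).factorial : ℝ)) (n : ℕ) (hn : Fintype.card V = n) (hn8 : 8 * (m'+1) ≤ n) (hdv : (m'+1) ∣ n)
    (hA : 2 * (univ.filter A).card ≤ n)
    (hD : ∀ s : Multiset V, s.Nodup → s.card = 2 * m' + 1 → (if (2 * m' + 2) ∣ n ∧ Even (n / 2 - n / (2 * m' + 2)) then n / 2 - (2 * m' + 2) + 1 else n / 2 - (2 * m' + 2) + 2) < (univ.filter (fun v => Ed (s + {v}))).card) :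
    HamCyc (m'+1) Ed := by
  obtain ⟨a, ha⟩ : ∃ a, a = (univ.filter A).card := ⟨_, rfl⟩
  have hnd := h.eg.nd
  rw [← ha] at hA
  have hcl := cl_univ (A := A)
  rw [← ha] at hcl
  have hnk : 2 * m' + 2 ≤ n / 2 := by omega
  -- the exchange property
  have HW : (p = 1 → (2 * m' + 2) ∣ n → Even (n / 2 - n / (2 * m' + 2)) → a ≠ n / 2) → HWp m' Ed A p := by
    intro hx
    refine HW_of hnd _ hD ?_
    intro j hj hjp
    rw [← ha]
    have hz : ∀ x : ZMod 2, 2 * x + 1 = 1 ∧ 2 * x + 1 + 1 = 0 := by decide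
    rcases hj with rfl | rfl
    · push_cast at hjp
      have hp1 : p = 1 := by rw [← hjp]; exact (hz _).1
      split_ifs with hi
      · have := hx hp1 hi.1 hi.2
        omega
      · omega
    · split_ifs <;> omega
  obtain ⟨t, ht⟩ := hdv
  have ht8 : 8 ≤ t := by
    rw [ht, mul_comm] at hn8
    exact Nat.le_of_mul_le_mul_left hn8 (by omega)
  rcases Nat.even_or_odd t with hte | hto
  · obtain ⟨s, hs⟩ := hte
    obtain ⟨j, rfl⟩ : ∃ j, s = 4 + j := ⟨s - 4, by omega⟩
    have hcard : Fintype.card V = (m'+1) * (8 + 2 * j) := by rw [hn, ht, hs]; ring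
    have hz : ∀ x y : ZMod 2, x = y ∨ x = y + 1 := by decide
    have hz2 : ∀ x p : ZMod 2, x + 4 • p = x := by decide
    have hsm : (j + 3 + 1) • p = j • p := by rw [add_assoc, add_smul]; exact hz2 _ _
    rcases hz (cl A (Finset.univ.val : Multiset V)) (j • p) with hc | hc
    · exact h.triv (j + 3) (by rw [hcard]; ring) (by rw [hc, hsm])
    · refine h.even (HW ?_) hck j hcard hc
      intro hp1 _ hev hah
      have e1 : n / 2 = (m'+1) * (4 + j) := by rw [ht, hs]; rw [show (m'+1) * (4 + j + (4 + j)) = 2 * ((m'+1) * (4 + j)) by ring]; omega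
      have e2 : n / (2 * m' + 2) = 4 + j := by
        rw [ht, hs, show (m'+1) * (4 + j + (4 + j)) = (2 * m' + 2) * (4 + j) by ring]
        exact Nat.mul_div_cancel_left _ (by omega)
      rw [hcl, hah, hp1, e1] at hc
      rw [e1, e2, show (m'+1) * (4 + j) - (4 + j) = m' * (4 + j) by rw [add_mul, one_mul, Nat.add_sub_cancel]] at hev
      have hev2 : ((m' * (4 + j) : ℕ) : ZMod 2) = 0 := (ZMod.natCast_eq_zero_iff_even).2 hev
      push_cast at hc hev2
      rw [add_mul, hev2, nsmul_eq_mul] at hc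
      have hz3 : ∀ j : ZMod 2, 0 + 1 * (4 + j) = j * 1 + 1 → False := by decide
      exact hz3 _ hc
  · obtain ⟨s, hs⟩ := hto
    rcases zmod2 p with hp | hp
    · exact h.odd0 hp s (by rw [hn, ht, hs]; ring)
    · obtain ⟨j, rfl⟩ : ∃ j, s = 2 + j := ⟨s - 2, by omega⟩
      refine h.odd1 (HW ?_) hck hcf hp j (by rw [hn, ht, hs]; ring)
      intro _ hdvd
      exfalso
      rw [ht, show 2 * m' + 2 = (m'+1) * 2 by ring] at hdvd
      have := Nat.dvd_of_mul_dvd_mul_left (by omega) hdvd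
      omega

lemma cl_not (s : Multiset V) : cl (fun v => ¬ A v) s = (s.card : ZMod 2) + cl A s := by
  induction s using Multiset.induction_on with
  | empty => simp
  | cons a s ih =>
    rw [← Multiset.singleton_add, cl_add, cl_add, ih, cl_singleton, cl_singleton]
    have hz : ∀ x y : ZMod 2, 0 + (x + y) = 1 + x + (1 + y) ∧ 1 + (x + y) = 1 + x + (0 + y) := by decide
    by_cases ha : A a
    · simp only [ha, not_true_eq_false, if_false, if_true, Multiset.card_add, Multiset.card_singleton, Nat.cast_add, Nat.cast_one]; exact (hz _ _).1
    · simp only [ha, not_false_eq_true, if_false, if_true, Multiset.card_add, Multiset.card_singleton, Nat.cast_add, Nat.cast_one]; exact (hz _ _).2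

lemma cl_not2 (s : Multiset V) (hs : s.card = 2 * m' + 2) : cl (fun v => ¬ A v) s = cl A s := by
  rw [cl_not, hs]; push_cast
  have hz : ∀ x y : ZMod 2, 2 * x + 2 + y = y := by decide
  exact hz _ _

lemma Gd_not (x : Fin (m'+1) → V) : Gd Ed (fun v => ¬ A v) p θ x ↔ Gd Ed A p θ x := by
  unfold Gd
  have : (fun y : Fin (m'+1) → V => ¬ (Adj Ed x y ↔ cl (fun v => ¬ A v) (mt x) + cl (fun v => ¬ A v) (mt y) = p)) =
      (fun y : Fin (m'+1) → V => ¬ (Adj Ed x y ↔ cl A (mt x) + cl A (mt y) = p)) := by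
    funext y
    have e := cl_not2 (A := A) (m' := m') (mt x + mt y) (by rw [Multiset.card_add, card_mt, card_mt, Fintype.card_fin]; omega)
    rw [← cl_add, ← cl_add, e]
  rw [this]

lemma EG.compl (h : EG m' Ed A p θ) : EG m' Ed (fun v => ¬ A v) p θ := by
  haveI := h.ne
  refine ⟨h.nd, ?_, ?_, ?_, ?_, ?_⟩
  · simp only [Gd_not]; exact h.gt
  · have key : ∀ u, Gu m' Ed A p θ u → Gu m' Ed (fun v => ¬ A v) p θ u := by
      intro u hg
      unfold Gu at hg ⊢
      refine le_trans (cnt_mono ?_) hg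
      intro s hs hh
      have e := cl_not2 (A := A) (m' := m') (s + {u}) (by rw [Multiset.card_add, hs, Multiset.card_singleton])
      rw [e] at hh
      exact hh
    exact le_trans (pr_mono fun u hu hg => hu (key u hg)) h.gu
  · rw [pr_not]; linarith [h.a2]
  · rw [pr_not]; linarith [h.a1]
  · intro v
    refine (h.e3 v).trans (cnt_mono ?_)
    intro s hs hh
    have e := cl_not2 (A := A) (m' := m') (s + {v}) (by rw [Multiset.card_add, hs, Multiset.card_singleton])
    rw [e]
    exact hh

end
end HC
end

section
open Finset
open scoped Classical
namespace HC

lemma consts (m' : ℕ) : ∃ c : ℝ, 0 < c ∧ c ≤ 1/20 ∧ c * (8 * (m'+1 : ℕ)) ≤ (49/100 : ℝ)^(2 * m' + 1) ∧ 14 * c ≤ (1/50) / ((m' + (m'+1)).factorial : ℝ) := by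
  obtain ⟨κ, hκ⟩ : ∃ κ : ℝ, κ = (49/100 : ℝ)^(2 * m' + 1) := ⟨_, rfl⟩
  obtain ⟨φ, hφ⟩ : ∃ φ : ℝ, φ = (1/50) / ((m' + (m'+1)).factorial : ℝ) := ⟨_, rfl⟩
  obtain ⟨M, hM⟩ : ∃ M : ℝ, M = (m'+1 : ℕ) := ⟨_, rfl⟩
  have hκ0 : 0 < κ := by rw [hκ]; positivity
  have hφ0 : 0 < φ := by rw [hφ]; positivity
  have hM0 : 0 < M := by rw [hM]; positivity
  rw [← hκ, ← hφ, ← hM]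
  refine ⟨min (1/20) (min (κ / (8 * M)) (φ / 14)), by positivity, min_le_left _ _, ?_, ?_⟩
  · rw [← le_div_iff₀ (by positivity)]
    exact (min_le_right _ _).trans (min_le_left _ _)
  · have := (min_le_right (1/20) (min (κ / (8 * M)) (φ / 14))).trans (min_le_right _ _)
    linarith

lemma main_cyc (m' : ℕ) (hm : 2 ≤ m') : ∃ n0 : ℕ, ∀ n ≥ n0, (m'+1) ∣ n → ∀ (V : Type) [Fintype V], Fintype.card V = n →
    ∀ Ed : Multiset V → Prop, (∀ s, Ed s → s.Nodup) →
    (∀ s : Multiset V, s.Nodup → s.card = 2 * m' + 1 → (if (2 * m' + 2) ∣ n ∧ Even (n / 2 - n / (2 * m' + 2)) then n / 2 - (2 * m' + 2) + 1 else n / 2 - (2 * m' + 2) + 2) < (univ.filter (fun v => Ed (s + {v}))).card) →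
    HamCyc (m'+1) Ed := by
  obtain ⟨c, c0, c1, c2, c3⟩ := consts m'
  obtain ⟨θ0, t0, t1, n1, hE⟩ := E_final m' hm
  obtain ⟨θ, hθ0, hθ1, hθ2⟩ : ∃ θ : ℝ, 0 < θ ∧ θ ≤ θ0 ∧ θ ≤ c / 2 := ⟨min θ0 (c/2), by positivity, min_le_left _ _, min_le_right _ _⟩
  have hθ100 : θ ≤ 1/100 := hθ1.trans t1
  obtain ⟨δ, hδ, n2, hS⟩ := E_struct m' (θ * θ) (by positivity)
  obtain ⟨c', η, hc', hη, hdich⟩ := dich δ hδ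
  obtain ⟨n3, hN⟩ := N_final m' hm c' η hc' hη
  obtain ⟨ε, hε, e1, e2, e3, e4⟩ : ∃ ε : ℝ, 0 < ε ∧ 2 * ε ≤ δ ∧ 2 * ε ≤ c' ∧ 2 * ε ≤ θ ∧ ε ≤ 1/20 := by
    refine ⟨min (min δ c') (min θ (1/20)) / 2, by positivity, ?_, ?_, ?_, ?_⟩
    · have := (min_le_left (min δ c') (min θ (1/20))).trans (min_le_left _ _); linarith
    · have := (min_le_left (min δ c') (min θ (1/20))).trans (min_le_right _ _); linarith
    · have := (min_le_right (min δ c') (min θ (1/20))).trans (min_le_left _ _); linarith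
    · have := (min_le_right (min δ c') (min θ (1/20))).trans (min_le_right _ _); linarith
  obtain ⟨n4, hn4⟩ := exists_nat_ge (100 * (2 * (m'+1 : ℕ) : ℝ)^2 / ε)
  refine ⟨n1 + n2 + n3 + n4 + 8 * (m'+1), ?_⟩
  intro n hn hdv V _ hV Ed hnd hD
  obtain ⟨M, hM⟩ : ∃ M : ℝ, M = (m'+1 : ℕ) := ⟨_, rfl⟩
  have hM3 : 3 ≤ M := by rw [hM]; exact_mod_cast (by omega : 3 ≤ m' + 1)
  have hMe : (m' : ℝ) = M - 1 := by rw [hM]; push_cast; ring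
  have hnε : 100 * (2 * M)^2 ≤ ε * n := by
    have h1 : 100 * (2 * (m'+1 : ℕ) : ℝ)^2 / ε ≤ n := hn4.trans (Nat.cast_le.2 (by omega))
    rw [div_le_iff₀ hε, ← hM] at h1
    linarith
  have hn0 : (0:ℝ) < n := Nat.cast_pos.2 (by omega)
  haveI : Nonempty V := Fintype.card_pos_iff.1 (by omega)
  have hcod : ∀ s : Multiset V, s.Nodup → s.card = 2 * m' + 1 → 1/2 - ε ≤ pr (fun v => Ed (s + {v})) := by
    intro s hs hsc
    have h1 := hD s hs hsc
    unfold pr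
    rw [hV, le_div_iff₀ hn0]
    obtain ⟨N, hNN⟩ : ∃ N, N = (univ.filter (fun v => Ed (s + {v}))).card := ⟨_, rfl⟩
    rw [← hNN] at h1 ⊢
    have h2 : n ≤ 2 * N + 2 * (2 * m' + 2) := by split_ifs at h1 <;> omega
    have h3 : (n : ℝ) ≤ 2 * N + 2 * (2 * m' + 2) := by exact_mod_cast h2
    rw [hMe] at h3
    nlinarith
  have hdeg : ∀ x : Fin (m'+1) → V, (mt x).Nodup → 1/2 - 2 * ε ≤ pr (fun y : Fin (m'+1) → V => Adj Ed x y) := by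
    intro x hx
    have h1 := deg_lem (by linarith) hcod m' (mt x) hx (by rw [card_mt, Fintype.card_fin]; omega)
    have h2 : cnt V (m'+1) (fun s => Ed (s + mt x)) = pr (fun y : Fin (m'+1) → V => Adj Ed x y) := by
      refine pr_congr fun y => ?_
      show Ed (mt y + mt x) ↔ Ed (mt x + mt y)
      rw [add_comm (mt y)]
    rw [h2, hV] at h1
    have h3 : (m' : ℝ) * ((2 * m' + 1 : ℕ) : ℝ) / n ≤ ε := by
      rw [div_le_iff₀ hn0]; push_cast; rw [hMe]; nlinarith
    linarith
  have hinj : pr (fun x : Fin (m'+1) → V => ¬ (mt x).Nodup) ≤ c' := by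
    have h1 := cnt_hit (V := V) (m'+1) 0 (by simp)
    simp only [add_zero, Multiset.card_zero, Nat.cast_zero] at h1
    have h3 : ((m'+1 : ℕ) : ℝ) * ((m'+1 : ℕ) : ℝ) / (Fintype.card V : ℝ) ≤ ε := by
      rw [hV, div_le_iff₀ hn0, ← hM]; nlinarith
    have h4 : cnt V (m'+1) (fun s => ¬ s.Nodup) = pr (fun x : Fin (m'+1) → V => ¬ (mt x).Nodup) := rfl
    rw [h4] at h1
    linarith
  rcases hdich (Fin (m'+1) → V) (Adj Ed) (fun x => (mt x).Nodup) (fun x y h => h.symm) hinj (fun x hx => by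
      have := hdeg x hx; linarith) with hA | ⟨χ, ψ, x1, x2, x3⟩
  · refine hN V (by omega) (hV ▸ hdv) Ed hnd (fun s hs hsc => ?_) (fun x y hx hy => hA x y hx hy)
    have := hcod s hs hsc
    linarith
  · obtain ⟨A, p, hAp⟩ := hS V (by omega) Ed χ ψ (fun s hs hsc => by have := hcod s hs hsc; linarith) x1 x2 x3
    have hEG := hAp.toEG hθ0 hθ100 hnd
    have hθθ : θ * θ ≤ θ := by nlinarith
    obtain ⟨B, hB, b1, b2, b3⟩ : ∃ B : V → Prop, EG m' Ed B p θ ∧ 1/2 - θ ≤ pr B ∧ pr B ≤ 1/2 + θ ∧ 2 * (univ.filter B).card ≤ n := by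
      by_cases hh : 2 * (univ.filter A).card ≤ n
      · exact ⟨A, hEG, by linarith [hAp.e2], by linarith [hAp.e2'], hh⟩
      · refine ⟨fun v => ¬ A v, hEG.compl, ?_, ?_, ?_⟩
        · rw [pr_not]; linarith [hAp.e2']
        · rw [pr_not]; linarith [hAp.e2]
        · have h5 : (univ.filter A).card + (univ.filter (fun v => ¬ A v)).card = n := by
            rw [← hV, ← Finset.card_univ]
            convert Finset.card_filter_add_card_filter_not (s := (univ : Finset V)) A
          have h6 : 2 * (univ.filter (fun v => ¬ A v)).card ≤ n := by omega
          convert h6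
    have hFX : FX m' Ed B p θ c := by
      refine ⟨hm, hB, hθ100, c0, c1, hθ2, ?_, b1, b2, fun x hx => ?_, hE V (by omega) Ed B p θ hθ1 hB⟩
      · rw [hV, ← hM]
        have : ε * n ≤ c * n := mul_le_mul_of_nonneg_right (by linarith) hn0.le
        nlinarith
      · have := hdeg x hx; linarith
    exact E_case hFX c2 c3 n hV (by omega) hdv b3 hD

end HC
end

section
open Finset
open scoped Classical
namespace HC

lemma to_half (m n : ℕ) (hm : 0 < m) (H : Finset (Finset (Fin n)))
    (h : HamCyc m (fun s : Multiset (Fin n) => s.Nodup ∧ s.toFinset ∈ H)) : HamHalfCycle n (2 * m) (fun e => e ∈ H) := by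
  obtain ⟨Q, x, hx, hch, hQ⟩ := h
  obtain ⟨t, ht⟩ : ∃ t, t = Q.length := ⟨_, rfl⟩
  have ht0 : 0 < t := by
    rw [ht]
    cases Q with
    | nil => simp at hx
    | cons => simp
  have hn : n = m * t := by
    have := congrArg Multiset.card hQ
    rw [card_vs] at this
    simp at this
    rw [ht]; exact this.symm
  obtain ⟨g, hg⟩ : ∃ g : Fin t → Fin m → Fin n, Q = List.ofFn g := by
    subst ht
    exact ⟨fun i => Q.get i, (List.ofFn_get Q).symm⟩
  have hvs : mt (fun z : Fin t × Fin m => g z.1 z.2) = (Finset.univ : Finset (Fin n)).val := by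
    rw [← vs_ofFn, ← hg, hQ]
  have hinj : Function.Injective (fun z : Fin t × Fin m => g z.1 z.2) := by
    have h1 : (mt (fun z : Fin t × Fin m => g z.1 z.2)).Nodup := by rw [hvs]; exact Finset.univ.nodup
    intro a b hab
    exact Multiset.inj_on_of_nodup_map h1 a (Finset.mem_univ_val a) b (Finset.mem_univ_val b) hab
  have hsurj : ∀ v : Fin n, ∃ i a, g i a = v := by
    intro v
    have h1 : v ∈ mt (fun z : Fin t × Fin m => g z.1 z.2) := by rw [hvs]; exact Finset.mem_univ_val v
    obtain ⟨z, hz⟩ := (mem_mt _ _).1 h1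
    exact ⟨z.1, z.2, hz⟩
  have hadj : ∀ i : ℕ, Adj (fun s : Multiset (Fin n) => s.Nodup ∧ s.toFinset ∈ H) (g ⟨i % t, Nat.mod_lt _ ht0⟩) (g ⟨(i+1) % t, Nat.mod_lt _ ht0⟩) := by
    intro i
    have h1 : i % t < t := Nat.mod_lt _ ht0
    rw [List.isChain_iff_getElem] at hch
    have h2 := hch (i % t) (by simp; omega)
    have hlen : (List.ofFn g).length = t := by simp
    subst hg
    have e1 : (List.ofFn g ++ [x])[i % t]'(by simp; omega) = g ⟨i % t, Nat.mod_lt _ ht0⟩ := by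
      rw [List.getElem_append_left (by simp; omega)]; simp
    have e2 : (List.ofFn g ++ [x])[i % t + 1]'(by simp; omega) = g ⟨(i+1) % t, Nat.mod_lt _ ht0⟩ := by
      by_cases hlt : i % t + 1 < t
      · rw [List.getElem_append_left (by simp; omega)]
        simp only [List.getElem_ofFn]
        congr 2
        rw [Nat.add_mod, Nat.mod_eq_of_lt (by omega : 1 < t), Nat.mod_eq_of_lt hlt]
      · have he : i % t + 1 = t := by omega
        have hz : (i + 1) % t = 0 := by
          rw [← Nat.mod_add_mod, he, Nat.mod_self]
        rw [List.getElem_append_right (by simp; omega)]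
        simp only [List.getElem_singleton]
        rw [List.head?_eq_getElem?, List.getElem?_eq_getElem (by simp; omega)] at hx
        simp only [List.getElem_ofFn, Option.some.injEq] at hx
        rw [← hx]
        congr 2
        exact hz.symm
    rw [e1, e2] at h2
    exact h2
  refine ⟨t, fun i => (mt (g ⟨i % t, Nat.mod_lt _ ht0⟩)).toFinset, ?_, ht0, ?_, ?_, ?_, ?_, ?_⟩
  · rw [hn, ← mul_assoc, Nat.mul_div_cancel_left _ (by omega)]
  · intro i; simp only [Nat.add_mod_right]
  · intro i
    rw [Multiset.toFinset_card_of_nodup]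
    · simp
    · exact (Multiset.nodup_add.1 (hadj i).1).1
  · intro i hi j hj hij
    rw [Finset.disjoint_left]
    intro v hv hv'
    rw [Multiset.mem_toFinset, mem_mt] at hv hv'
    obtain ⟨a, ha⟩ := hv
    obtain ⟨b, hb⟩ := hv'
    have := @hinj (⟨i % t, Nat.mod_lt _ ht0⟩, a) (⟨j % t, Nat.mod_lt _ ht0⟩, b) (ha.trans hb.symm)
    have h3 := congrArg (fun z : Fin t × Fin m => z.1.1) this
    simp only [Nat.mod_eq_of_lt hi, Nat.mod_eq_of_lt hj] at h3
    exact hij h3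
  · rw [Finset.eq_univ_iff_forall]
    intro v
    obtain ⟨i, a, hia⟩ := hsurj v
    rw [Finset.mem_biUnion]
    refine ⟨i.1, Finset.mem_range.2 i.2, ?_⟩
    rw [Multiset.mem_toFinset, mem_mt]
    refine ⟨a, ?_⟩
    rw [← hia]
    congr 2
    exact Nat.mod_eq_of_lt i.2
  · intro i
    have := (hadj i).2
    rw [Multiset.toFinset_add] at this
    exact this

end HC
end

/-- Minimum codegree threshold for Hamilton (k/2)-cycles in k-graphs, k ≥ 6 even. -/
theorem codegree_ham_half_cycle (k : ℕ) (hke : Even k) (hk : 6 ≤ k) :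
    ∃ n₀ : ℕ, ∀ n ≥ n₀, k / 2 ∣ n →
      ∀ H : Finset (Finset (Fin n)), (∀ e ∈ H, e.card = k) →
      (∀ S : Finset (Fin n), S.card = k - 1 →
        (if k ∣ n ∧ Even (n / 2 - n / k) then n / 2 - k + 1 else n / 2 - k + 2)
          < (Finset.univ.filter (fun v => v ∉ S ∧ insert v S ∈ H)).card) →
      HamHalfCycle n k (fun e => e ∈ H) := by
  obtain ⟨m', hm', rfl⟩ : ∃ m', 2 ≤ m' ∧ k = 2 * m' + 2 := by
    obtain ⟨r, rfl⟩ := hke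
    exact ⟨r - 1, by omega, by omega⟩
  obtain ⟨n0, h⟩ := HC.main_cyc m' hm'
  refine ⟨n0, fun n hn hdv H hH hcod => ?_⟩
  rw [show (2 * m' + 2) / 2 = m' + 1 by omega] at hdv
  refine HC.to_half (m'+1) n (by omega) H (h n hn hdv (Fin n) (Fintype.card_fin n) _ (fun s hs => hs.1) ?_)
  intro s hs hsc
  have h1 := hcod s.toFinset (by rw [Multiset.toFinset_card_of_nodup hs, hsc]; omega)
  refine lt_of_lt_of_le (by convert h1) (Finset.card_le_card ?_)
  intro v hv
  rw [Finset.mem_filter] at hv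
  refine (@Finset.mem_filter _ _ (_) _ _).2 ⟨Finset.mem_univ _, ?_, ?_⟩
  · rw [Multiset.nodup_add]
    refine ⟨hs, Multiset.nodup_singleton _, ?_⟩
    rw [Multiset.disjoint_singleton]
    intro hmem
    exact hv.2.1 (Multiset.mem_toFinset.2 hmem)
  · have e : (s + {v}).toFinset = insert v s.toFinset := by
      ext w; simp [or_comm]
    rw [e]; exact hv.2.2
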